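/- For every ε > 0 there exists a constant C = C(ε, q) such that for every n ≥ 1, every affine-linear map ℓ : F_q^n → F_q (that is, ℓ(x) = c_0 + ∑_{i<n} c_i x_i), and every additive character χ of F_q, one has |∑_{f monic, deg f = n} μ(f) · χ(ℓ(x_0(f), …, x_{n−1}(f)))| ≤ C · q^{(3/4 + ε)n}, where x_0(f), …, x_{n−1}(f) are the coefficients of f below its leading term. -/

import Mathlib

open Polynomial

/- The Möbius function on `F_q[t]`. -/
open scoped Classical in
noncomputable def polyMu {F : Type*} [Field F] (f : Polynomial F) : ℤ :=
  if Squarefree f then (-1) ^ (UniqueFactorizationMonoid.normalizedFactors f).card else 0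

/-- The monic polynomial of degree `n` whose lower coefficient vector is `x ∈ F_q^n`. -/
noncomputable def monicPoly (F : Type*) [Field F] (n : ℕ) (x : Fin n → F) : Polynomial F :=
  X ^ n + ∑ i : Fin n, C (x i) * X ^ (i : ℕ)

section DegreeFiltration

variable {k O ι : Type*} [Field k] [CommRing O] [Algebra k[X] O] [Algebra k O]
  [IsScalarTower k k[X] O]

/-- The elements of a free `k[X]`-module whose coordinates have degree `< w`. -/
noncomputable def coordDegreeLT (e : Module.Basis ι k[X] O) (w : ℕ) : Submodule k O where
  carrier := {f | ∀ i, e.repr f i ∈ degreeLT k w}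
  add_mem' := fun ha hb i => by
    rw [map_add]; exact Submodule.add_mem _ (ha i) (hb i)
  zero_mem' := fun i => by simp
  smul_mem' := fun c f hf i => by
    rw [← algebraMap_smul k[X] c f, map_smul, Finsupp.smul_apply, algebraMap_smul]
    exact Submodule.smul_mem _ _ (hf i)

theorem coordDegreeLT_mono (e : Module.Basis ι k[X] O) {v w : ℕ} (h : v ≤ w) :
    coordDegreeLT e v ≤ coordDegreeLT e w := fun _ hf i => degreeLT_mono h (hf i)

theorem pow_mem_coordDegreeLT {e : Module.Basis ι k[X] O} {c : ℕ}
    (hc : ∀ v w, ∀ f ∈ coordDegreeLT e v, ∀ g ∈ coordDegreeLT e w,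
      f * g ∈ coordDegreeLT e (v + w + c)) {w : ℕ} {f : O} (hf : f ∈ coordDegreeLT e w)
    {n : ℕ} (hn : 1 ≤ n) : f ^ n ∈ coordDegreeLT e ((w + c) * n) := by
  induction n, hn using Nat.le_induction with
  | base => simpa using coordDegreeLT_mono e (by omega) hf
  | succ n hn ih =>
    have : ((w + c) * n + w + c) = (w + c) * (n + 1) := by ring
    rw [pow_succ, ← this]
    exact hc _ _ _ ih _ hf

variable [Fintype ι]

theorem exists_mem_coordDegreeLT (e : Module.Basis ι k[X] O) (f : O) :
    ∃ w, f ∈ coordDegreeLT e w := by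
  refine ⟨∑ i, ((e.repr f i).natDegree + 1), fun i => ?_⟩
  refine degreeLT_mono (Finset.single_le_sum (f := fun i => (e.repr f i).natDegree + 1)
    (fun _ _ => Nat.zero_le _) (Finset.mem_univ i)) ?_
  rw [mem_degreeLT]
  exact degree_le_natDegree.trans_lt (by exact_mod_cast Nat.lt_succ_self _)

theorem exists_forall_mem_coordDegreeLT (e : Module.Basis ι k[X] O) {J : Type*} [Finite J]
    (f : J → O) : ∃ w, ∀ j, f j ∈ coordDegreeLT e w := by
  have := Fintype.ofFinite J
  choose w hw using fun j => exists_mem_coordDegreeLT e (f j)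
  exact ⟨∑ j, w j, fun j => coordDegreeLT_mono e
    (Finset.single_le_sum (fun _ _ => Nat.zero_le _) (Finset.mem_univ j)) (hw j)⟩

/-- `coordDegreeLT e w` is a product of copies of the polynomials of degree `< w`. -/
noncomputable def coordDegreeLTEquiv (e : Module.Basis ι k[X] O) (w : ℕ) :
    (ι → degreeLT k w) ≃ₗ[k] coordDegreeLT e w where
  toFun p := ⟨e.equivFun.symm fun i => p i, fun i => by
    rw [← e.equivFun_apply, LinearEquiv.apply_symm_apply]; exact (p i).2⟩
  invFun f i := ⟨e.repr f i, f.2 i⟩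
  map_add' p p' := by
    ext1; simp [add_smul, Finset.sum_add_distrib]
  map_smul' c p := by
    ext1
    simp [Module.Basis.equivFun_symm_apply, Finset.smul_sum]
  left_inv p := by
    funext i
    ext1
    change e.repr (e.equivFun.symm fun i => (p i : k[X])) i = p i
    rw [← e.equivFun_apply, LinearEquiv.apply_symm_apply]
  right_inv f := by
    ext1
    simp [Module.Basis.sum_repr]

theorem finrank_coordDegreeLT (e : Module.Basis ι k[X] O) (w : ℕ) :
    Module.finrank k (coordDegreeLT e w) = Fintype.card ι * w := by
  rw [← (coordDegreeLTEquiv e w).finrank_eq, Module.finrank_pi_fintype]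
  simp [(degreeLTEquiv k w).finrank_eq]

instance (e : Module.Basis ι k[X] O) (w : ℕ) : Module.Finite k (coordDegreeLT e w) :=
  have : Module.Finite k (degreeLT k w) := Module.Finite.equiv (degreeLTEquiv k w).symm
  Module.Finite.equiv (coordDegreeLTEquiv e w)

theorem mul_mem_degreeLT_add {p r : k[X]} {v w : ℕ} (hp : p ∈ degreeLT k v)
    (hr : r.natDegree ≤ w) : p * r ∈ degreeLT k (v + w) := by
  rcases eq_or_ne p 0 with rfl | hp0
  · simp
  rcases eq_or_ne r 0 with rfl | hr0
  · simp
  rw [mem_degreeLT, degree_eq_natDegree hp0] at hp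
  rw [mem_degreeLT, degree_mul, degree_eq_natDegree hp0, degree_eq_natDegree hr0]
  norm_cast at hp ⊢
  omega

/-- A `k[X]`-linear endomorphism raises coordinate degrees by a bounded amount. -/
theorem exists_map_mem_coordDegreeLT (e : Module.Basis ι k[X] O) (σ : O →ₗ[k[X]] O) :
    ∃ c, ∀ w, ∀ f ∈ coordDegreeLT e w, σ f ∈ coordDegreeLT e (w + c) := by
  refine ⟨∑ i, ∑ j, (e.repr (σ (e j)) i).natDegree, fun w f hf i => ?_⟩
  have : e.repr (σ f) i = ∑ j, e.repr f j * e.repr (σ (e j)) i := by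
    conv_lhs => rw [← e.sum_repr f]
    rw [map_sum, map_sum, Finsupp.finsetSum_apply]
    simp only [map_smul, Finsupp.smul_apply, smul_eq_mul]
  rw [this]
  refine Submodule.sum_mem _ fun j _ => mul_mem_degreeLT_add (hf j) ?_
  refine le_trans ?_ (Finset.single_le_sum (f := fun i => ∑ j, (e.repr (σ (e j)) i).natDegree)
    (fun _ _ => Nat.zero_le _) (Finset.mem_univ i))
  exact Finset.single_le_sum (f := fun j => (e.repr (σ (e j)) i).natDegree)
    (fun _ _ => Nat.zero_le _) (Finset.mem_univ j)

/-- The coordinate degree is subadditive for products, up to a constant. -/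
theorem exists_mul_mem_coordDegreeLT (e : Module.Basis ι k[X] O) :
    ∃ c, ∀ v w, ∀ f ∈ coordDegreeLT e v, ∀ g ∈ coordDegreeLT e w,
      f * g ∈ coordDegreeLT e (v + w + c) := by
  choose c hc using fun j => exists_map_mem_coordDegreeLT e (LinearMap.mulRight k[X] (e j))
  refine ⟨∑ j, c j, fun v w f hf g hg => ?_⟩
  have : f * g = ∑ j, e.repr g j • (f * e j) := by
    conv_lhs => rw [← e.sum_repr g]
    rw [Finset.mul_sum]
    simp only [mul_smul_comm]
  rw [this]
  refine Submodule.sum_mem _ fun j _ i => ?_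
  rcases eq_or_ne (e.repr g j) 0 with h0 | h0
  · simp [h0]
  have h1 : (e.repr g j).natDegree ≤ w := by
    have := hg j
    rw [mem_degreeLT] at this
    exact natDegree_le_of_degree_le this.le
  rw [map_smul, Finsupp.smul_apply, smul_eq_mul, mul_comm]
  refine degreeLT_mono ?_ (mul_mem_degreeLT_add (hc j v f hf i) h1)
  have := Finset.single_le_sum (f := c) (fun _ _ => Nat.zero_le _) (Finset.mem_univ j)
  omega

variable [IsDomain O]

/-- If multiples of `h ≠ 0` are killed by `L`, then the rank of `L` is bounded by the degree
of `h`. -/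
theorem card_le_of_linearIndependent_of_map_mul_eq_zero {e : Module.Basis ι k[X] O} {c : ℕ}
    (hc : ∀ v w, ∀ f ∈ coordDegreeLT e v, ∀ g ∈ coordDegreeLT e w,
      f * g ∈ coordDegreeLT e (v + w + c)) {w : ℕ} {h : O} (hw : h ∈ coordDegreeLT e w)
    (h0 : h ≠ 0) {V J : Type*} [AddCommGroup V] [Module k V] [Fintype J] (L : O →ₗ[k] V)
    (hL : ∀ u, L (h * u) = 0) (f : J → O) (hf : LinearIndependent k (L ∘ f)) :
    Fintype.card J ≤ Fintype.card ι * (w + c) := by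
  obtain ⟨W, hW⟩ := exists_forall_mem_coordDegreeLT e f
  let Φ : (coordDegreeLT e W × (J → k)) →ₗ[k] coordDegreeLT e (w + W + c) :=
    LinearMap.codRestrict _
      (((LinearMap.mulLeft k h).comp (coordDegreeLT e W).subtype).coprod
        (Fintype.linearCombination k f)) (fun p => by
        refine Submodule.add_mem _ (hc _ _ _ hw _ p.1.2) ?_
        refine Submodule.sum_mem _ fun j _ => Submodule.smul_mem _ _ ?_
        exact coordDegreeLT_mono e (by omega) (hW j))
  have hΦ : Function.Injective Φ := by
    rw [← LinearMap.ker_eq_bot, LinearMap.ker_eq_bot']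
    rintro ⟨u, κ⟩ hz
    have hz' : h * u + ∑ j, κ j • f j = 0 := congrArg Subtype.val hz
    have hκ : κ = 0 := by
      have := congrArg L hz'
      rw [map_add, hL, zero_add, map_sum, map_zero] at this
      simp only [map_smul] at this
      exact funext (Fintype.linearIndependent_iff.1 hf κ this)
    subst hκ
    have : (u : O) = 0 := by simpa [h0] using hz'
    exact Prod.ext (Subtype.ext this) rfl
  have := LinearMap.finrank_le_finrank_of_injective hΦ
  rw [Module.finrank_prod, finrank_coordDegreeLT, finrank_coordDegreeLT,
    Module.finrank_fintype_fun_eq_card] at this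
  nlinarith

variable {K : Type*} [Field K] [Algebra k K]

/-- A nonzero element vanishes at few points. -/
theorem card_points_le_of_mem_coordDegreeLT {e : Module.Basis ι k[X] O} {c : ℕ}
    (hc : ∀ v w, ∀ f ∈ coordDegreeLT e v, ∀ g ∈ coordDegreeLT e w,
      f * g ∈ coordDegreeLT e (v + w + c)) {w : ℕ} {h : O} (hw : h ∈ coordDegreeLT e w)
    (h0 : h ≠ 0) (T : Finset (O →ₐ[k] K)) (hT : ∀ P ∈ T, P h = 0) :
    T.card ≤ Fintype.card ι * (w + c) := by
  classical
  have hli : LinearIndependent K (fun P : T => ((P : O →ₐ[k] K) : O → K)) := by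
    have h1 := linearIndependent_monoidHom O K
    refine h1.comp (fun P : T => ((P : O →ₐ[k] K) : O →* K)) fun P P' hP => ?_
    ext x
    exact DFunLike.congr_fun hP x
  let ev : O →ₗ[k] (T → K) := LinearMap.pi fun P => (P : O →ₐ[k] K).toLinearMap
  have hspan : Submodule.span K (Set.range ev) = ⊤ := by
    by_contra hne
    obtain ⟨φ, hφ, hφ'⟩ := Submodule.exists_dual_map_eq_bot_of_lt_top (lt_top_iff_ne_top.2 hne)
      inferInstance
    apply hφ
    have h2 : ∀ x : O, φ (ev x) = 0 := fun x => by
      have : φ (ev x) ∈ Submodule.map φ (Submodule.span K (Set.range ev)) :=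
        ⟨_, Submodule.subset_span ⟨x, rfl⟩, rfl⟩
      rwa [hφ', Submodule.mem_bot] at this
    have h3 := Fintype.linearIndependent_iff.1 hli (fun P => φ (Pi.single P 1)) (by
      ext x
      have := h2 x
      rw [LinearMap.pi_apply_eq_sum_univ φ] at this
      simp only [Finset.sum_apply, Pi.smul_apply, smul_eq_mul, Pi.zero_apply]
      rw [← this]
      refine Finset.sum_congr rfl fun P _ => ?_
      rw [smul_eq_mul, mul_comm]
      congr 2
      ext P'
      simp [Pi.single_apply, eq_comm])
    refine LinearMap.pi_ext' fun P => LinearMap.ext_ring ?_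
    simpa using h3 P
  obtain ⟨s, hs, hsp, hsl⟩ := exists_linearIndependent K (Set.range ev)
  rw [hspan] at hsp
  let b := Module.Basis.mk hsl (by rw [Subtype.range_coe]; exact hsp.ge)
  have : Fintype s := FiniteDimensional.fintypeBasisIndex b
  have hcard : Fintype.card s = T.card := by
    rw [← Module.finrank_eq_card_basis b]; simp
  choose f hf using fun v : s => hs v.2
  rw [← hcard]
  refine card_le_of_linearIndependent_of_map_mul_eq_zero hc hw h0 ev (fun u => ?_) f ?_
  · ext P; simp [ev, hT P P.2]
  · have : ev ∘ f = fun v : s => (v : T → K) := funext hf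
    rw [this]
    exact hsl.restrict_scalars' k

/-- A nonzero element has bounded order of vanishing at the origin. -/
theorem le_of_X_pow_dvd {e : Module.Basis ι k[X] O} {c : ℕ}
    (hc : ∀ v w, ∀ f ∈ coordDegreeLT e v, ∀ g ∈ coordDegreeLT e w,
      f * g ∈ coordDegreeLT e (v + w + c)) {w : ℕ} {h : O} (hw : h ∈ coordDegreeLT e w)
    (h0 : h ≠ 0) (τ : O →ₐ[k[X]] PowerSeries k) {n : ℕ} (hn : PowerSeries.X ^ n ∣ τ h) :
    n ≤ Fintype.card ι * (w + c) := by
  have hco : ∀ (a : k) (f : PowerSeries k), a • f = (C a : k[X]) • f := fun a f => by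
    rw [Algebra.smul_def, Algebra.smul_def, PowerSeries.algebraMap_apply']; simp
  let L : O →ₗ[k] (Fin n → k) :=
    { toFun := fun f i => PowerSeries.coeff i (τ f)
      map_add' := fun f g => by ext; simp
      map_smul' := fun a f => by
        ext i
        rw [← algebraMap_smul k[X] a f, map_smul]
        have : (algebraMap k k[X] a) • τ f = a • τ f := (hco a _).symm
        rw [this]
        simp }
  have := card_le_of_linearIndependent_of_map_mul_eq_zero hc hw h0 L (fun u => ?_)
    (fun i : Fin n => algebraMap k[X] O (X ^ (i : ℕ))) ?_
  · simpa using this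
  · ext i
    obtain ⟨v, hv⟩ := hn
    simp only [L, LinearMap.coe_mk, AddHom.coe_mk, map_mul, hv, mul_assoc]
    rw [PowerSeries.coeff_X_pow_mul']
    simp [i.2]
  · have : (L ∘ fun i : Fin n => algebraMap k[X] O (X ^ (i : ℕ))) = Pi.basisFun k (Fin n) := by
      ext i j
      simp only [L, Function.comp, LinearMap.coe_mk, AddHom.coe_mk, AlgHom.commutes]
      have : algebraMap k[X] (PowerSeries k) (X ^ (i : ℕ)) = PowerSeries.X ^ (i : ℕ) := by
        simp [PowerSeries.algebraMap_apply']
      rw [this, PowerSeries.coeff_X_pow]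
      simp [Pi.single_apply, Fin.ext_iff]
    rw [this]
    exact (Pi.basisFun k (Fin n)).linearIndependent

end DegreeFiltration

section Stepanov

variable (k : Type*) [Field k] [Fintype k]

/-- The `a`-th power of the Frobenius endomorphism over a finite field. -/
noncomputable def iterFrobenius (A : Type*) [CommRing A] [Algebra k A] (a : ℕ) : A →ₐ[k] A :=
  (FiniteField.frobeniusAlgHom k A) ^ a

theorem iterFrobenius_apply (A : Type*) [CommRing A] [Algebra k A] (a : ℕ) (x : A) :
    iterFrobenius k A a x = x ^ Fintype.card k ^ a := by
  induction a generalizing x with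
  | zero => simp [iterFrobenius]
  | succ a ih =>
    have : iterFrobenius k A (a + 1) x = iterFrobenius k A a (x ^ Fintype.card k) := by
      simp [iterFrobenius, pow_succ]
    rw [this, ih, ← pow_mul, pow_succ' (Fintype.card k)]

theorem sum_pow_card_pow {A J : Type*} [CommRing A] [Algebra k A] (s : Finset J) (f : J → A)
    (a : ℕ) : (∑ j ∈ s, f j) ^ Fintype.card k ^ a = ∑ j ∈ s, f j ^ Fintype.card k ^ a := by
  simp only [← iterFrobenius_apply, map_sum]

variable {k}

theorem eq_zero_of_sum_mul_pow_eq_zero {J : Type*} [Fintype J] {a : ℕ} (b : J → PowerSeries k)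
    (hb : ∀ κ : J → k, PowerSeries.X ^ Fintype.card k ^ a ∣ ∑ j, κ j • b j → κ = 0)
    (σ : J → PowerSeries k) (h : ∑ j, b j * σ j ^ Fintype.card k ^ a = 0) : σ = 0 := by
  set R := Fintype.card k ^ a with hR
  have key : ∀ N, ∀ j, PowerSeries.X ^ N ∣ σ j := by
    intro N
    induction N with
    | zero => simp
    | succ N ih =>
      choose τ hτ using ih
      have h1 : ∑ j, b j * τ j ^ R = 0 := by
        have h2 : (PowerSeries.X ^ N : PowerSeries k) ^ R * ∑ j, b j * τ j ^ R = 0 := by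
          rw [← h, Finset.mul_sum]
          exact Finset.sum_congr rfl fun j _ => by rw [hτ j, mul_pow]; ring
        exact (mul_eq_zero.1 h2).resolve_left (pow_ne_zero _ (pow_ne_zero _ PowerSeries.X_ne_zero))
      have h3 : ∀ j, PowerSeries.X ∣
          τ j - (PowerSeries.constantCoeff (τ j)) • (1 : PowerSeries k) := fun j => by
        rw [PowerSeries.X_dvd_iff]; simp
      choose ρ hρ using h3
      have h4 : ∀ j, τ j ^ R =
          (PowerSeries.constantCoeff (τ j)) • (1 : PowerSeries k) + PowerSeries.X ^ R *
              ρ j ^ R := by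
        intro j
        have h5 : τ j = PowerSeries.constantCoeff (τ j) • (1 : PowerSeries k)
            + PowerSeries.X * ρ j := by
          rw [← hρ j]; ring
        conv_lhs => rw [h5]
        rw [← iterFrobenius_apply, map_add, map_smul, map_one, iterFrobenius_apply, mul_pow]
      have h6 := hb (fun j => PowerSeries.constantCoeff (τ j)) ⟨- ∑ j, b j * ρ j ^ R, by
        have : ∑ j, b j * τ j ^ R = ∑ j, PowerSeries.constantCoeff (τ j) • b j
            + PowerSeries.X ^ R * ∑ j, b j * ρ j ^ R := by
          rw [Finset.mul_sum, ← Finset.sum_add_distrib]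
          refine Finset.sum_congr rfl fun j _ => ?_
          rw [h4 j, mul_add, mul_smul_comm, mul_one]; ring
        rw [h1] at this
        linear_combination -this⟩
      intro j
      obtain ⟨v, hv⟩ := PowerSeries.X_dvd_iff.2 (congrFun h6 j)
      exact ⟨v, by rw [hτ j, hv, pow_succ]; ring⟩
  ext j n
  simpa using PowerSeries.X_pow_dvd_iff.1 (key (n + 1) j) n (Nat.lt_succ_self n)

end Stepanov

section Stepanov

variable {k : Type*} [Field k] [Fintype k]

variable {O : Type*} [CommRing O] [IsDomain O] [Algebra k[X] O] [Algebra k O]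
  [IsScalarTower k k[X] O] {K : Type*} [Field K] [Algebra k K]

theorem exists_vanishing_of_mul_lt {ι : Type*} [Fintype ι] {e : Module.Basis ι k[X] O} {c : ℕ}
    (hc : ∀ v w, ∀ f ∈ coordDegreeLT e v, ∀ g ∈ coordDegreeLT e w,
      f * g ∈ coordDegreeLT e (v + w + c))
    {σ : O →ₐ[k[X]] O} {c' : ℕ}
    (hσ : ∀ w, ∀ f ∈ coordDegreeLT e w, σ f ∈ coordDegreeLT e (w + c'))
    {τ : O →ₐ[k[X]] PowerSeries k} (hτ : Function.Injective τ) {a L T : ℕ}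
    (hL : Fintype.card ι * (L + c) < Fintype.card k ^ a)
    (hLT : Fintype.card ι * ((L + c) * Fintype.card k ^ a + (T + c') + c) <
      Fintype.card ι * L * (Fintype.card ι * T)) :
    ∃ h ∈ coordDegreeLT e (L + (T + c) * Fintype.card k ^ a + c), h ≠ 0 ∧
      ∀ P : O →ₐ[k] K, (∀ f, P f ^ (Fintype.card k ^ (a + a)) = P (σ f)) → P h = 0 := by
  have hR1 : 1 ≤ Fintype.card k ^ a := Nat.one_le_pow _ _ Fintype.card_pos
  have : IsScalarTower k k[X] (PowerSeries k) := .of_algebraMap_eq fun x => by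
    simp [PowerSeries.algebraMap_apply']
  have hRR : Fintype.card k ^ (a + a) = Fintype.card k ^ a * Fintype.card k ^ a := pow_add _ _ _
  set R := Fintype.card k ^ a with hR
  let b := Module.finBasis k (coordDegreeLT e L)
  let s := Module.finBasis k (coordDegreeLT e T)
  let Ψ : (_ × _ → k) →ₗ[k] coordDegreeLT e ((L + c) * R + (T + c') + c) :=
    LinearMap.codRestrict _ (Fintype.linearCombination k
      fun p : Fin _ × Fin _ => (b p.1 : O) ^ R * σ (s p.2)) (fun v =>
        Submodule.sum_mem _ fun p _ => Submodule.smul_mem _ _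
          (hc _ _ _ (pow_mem_coordDegreeLT hc (b p.1).2 hR1) _ (hσ _ _ (s p.2).2)))
  have hker : LinearMap.ker Ψ ≠ ⊥ := by
    apply LinearMap.ker_ne_bot_of_finrank_lt
    rw [finrank_coordDegreeLT, Module.finrank_fintype_fun_eq_card, Fintype.card_prod,
      Fintype.card_fin, Fintype.card_fin, finrank_coordDegreeLT, finrank_coordDegreeLT]
    exact hLT
  obtain ⟨v, hv, hv0⟩ := Submodule.exists_mem_ne_zero_of_ne_bot hker
  have hv' : ∑ p, v p • ((b p.1 : O) ^ R * σ (s p.2)) = 0 := congrArg Subtype.val hv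
  let S : _ → O := fun i => ∑ j, v (i, j) • (s j : O)
  refine ⟨∑ i, (b i : O) * S i ^ R, ?_, ?_, ?_⟩
  · refine Submodule.sum_mem _ fun i _ => hc _ _ _ (b i).2 _ (pow_mem_coordDegreeLT hc ?_ hR1)
    exact Submodule.sum_mem _ fun j _ => Submodule.smul_mem _ _ (s j).2
  · intro h0
    have h1 := eq_zero_of_sum_mul_pow_eq_zero (a := a) (fun i => τ (b i)) (fun κ hκ => ?_)
      (fun i => τ (S i)) (by simpa [map_sum] using congrArg τ h0)
    · apply hv0
      ext ⟨i, j⟩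
      have h2 : S i = 0 := hτ (by rw [map_zero]; exact congrFun h1 i)
      have h3 : ∑ j, v (i, j) • s j = 0 := by
        apply Subtype.ext
        simpa [S] using h2
      exact Fintype.linearIndependent_iff.1 s.linearIndependent _ h3 j
    · have h2 : ∑ j, κ j • τ (b j) = τ (∑ j, κ j • b j : coordDegreeLT e L) := by
        rw [← AlgHom.restrictScalars_apply k τ]
        simp [map_sum]
      rw [h2] at hκ
      have h3 : ∑ j, κ j • b j = 0 := by
        by_contra hne
        have := le_of_X_pow_dvd hc (∑ j, κ j • b j).2 (fun h => hne (Subtype.ext h)) τ hκ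
        omega
      exact funext (Fintype.linearIndependent_iff.1 b.linearIndependent _ h3)
  · intro P hP
    have hR0 : R ≠ 0 := by omega
    rw [← pow_eq_zero_iff hR0, ← map_pow, hR, sum_pow_card_pow, ← hR]
    rw [← map_zero P, ← hv', map_sum, map_sum, Fintype.sum_prod_type]
    refine Finset.sum_congr rfl fun i _ => ?_
    rw [mul_pow, ← pow_mul, ← hRR, map_mul, map_pow, map_pow, hP]
    simp only [S, map_sum, Finset.mul_sum]
    refine Finset.sum_congr rfl fun j _ => ?_
    have : σ (v (i, j) • (s j : O)) = v (i, j) • σ (s j) := by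
      rw [← AlgHom.restrictScalars_apply k σ, map_smul]; rfl
    rw [this, map_smul, map_smul, map_mul, mul_smul_comm, map_pow]

theorem exists_stepanov_parameters {n c R : ℕ} (hn : 0 < n)
    (hRa : 2 * n * (c + 2) + 4 * c + 10 ≤ R) :
    ∃ L t : ℕ, n * (L + c) < R ∧ n * ((L + c) * R + (t + c) + c) < n * L * (n * t) ∧
      n * (L + (t + c) * R + c + c) ≤
        R * R + (1 + n * (2 * c + 5) + n * c + 2 * c * n) * R := by
  have hexp : 2 * n * (c + 2) = 2 * (n * c) + 4 * n := by ring
  obtain ⟨u, hu⟩ : ∃ u, (R - 1) / n = u := ⟨_, rfl⟩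
  obtain ⟨v, hv⟩ : ∃ v, R / n = v := ⟨_, rfl⟩
  have hL1 : n * u ≤ R - 1 := hu ▸ Nat.mul_div_le _ _
  have hL2 : R - 1 < n * u + n := by
    rw [← hu]; exact Nat.lt_mul_div_succ _ hn |>.trans_le (by ring_nf; rfl)
  have ht1 : n * v ≤ R := hv ▸ Nat.mul_div_le _ _
  have ht2 : R < n * v + n := by
    rw [← hv]; exact Nat.lt_mul_div_succ _ hn |>.trans_le (by ring_nf; rfl)
  have hvR : v ≤ R := hv ▸ Nat.div_le_self R n
  have hcL : c ≤ u := by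
    rw [← hu, Nat.le_div_iff_mul_le hn, mul_comm]; omega
  obtain ⟨L, rfl⟩ := Nat.exists_eq_add_of_le' hcL
  clear hu hv
  have hL3 : n * (L + c) = n * L + n * c := by ring
  have hnL : R ≤ 2 * (n * L) := by omega
  have hR1 : 1 ≤ R := by omega
  have hnt : n * (v + (2 * c + 5)) = n * v + n + n * (2 * c + 4) := by ring
  have hnt1 : R + n * (2 * c + 4) ≤ n * (v + (2 * c + 5)) := by omega
  have hnt' : n * (v + (2 * c + 5)) ≤ R + n * (2 * c + 5) := by rw [mul_add]; omega
  refine ⟨L, v + (2 * c + 5), by omega, ?_, ?_⟩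
  · have h1 : L * (R + n * (2 * c + 4)) ≤ L * (n * (v + (2 * c + 5))) :=
      Nat.mul_le_mul_left _ hnt1
    have h3 : R * (c + 2) ≤ 2 * (n * L) * (c + 2) := Nat.mul_le_mul_right _ hnL
    have h5 : (L + c) * R + (v + (2 * c + 5) + c) + c < L * (n * (v + (2 * c + 5))) := by
      nlinarith
    calc n * ((L + c) * R + (v + (2 * c + 5) + c) + c) < n * (L * (n * (v + (2 * c + 5)))) :=
          Nat.mul_lt_mul_of_pos_left h5 hn
      _ = _ := by ring
  · have h5 : n * L ≤ R := by omega
    have h6 : 2 * c * n ≤ 2 * c * n * R := Nat.le_mul_of_pos_right _ hR1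
    have h7 : n * (v + (2 * c + 5)) * R ≤ (R + n * (2 * c + 5)) * R :=
      Nat.mul_le_mul_right _ hnt'
    nlinarith

/-- **Stepanov's method**: an upper bound for the number of points on which the Frobenius acts
as a given automorphism. -/
theorem exists_card_points_le [Module.Finite k[X] O] (σ : O →ₐ[k[X]] O)
    {τ : O →ₐ[k[X]] PowerSeries k} (hτ : Function.Injective τ) :
    ∃ C A : ℕ, ∀ a, A ≤ a → ∀ T : Finset (O →ₐ[k] K),
      (∀ P ∈ T, ∀ f, P f ^ (Fintype.card k ^ (a + a)) = P (σ f)) →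
        T.card ≤ Fintype.card k ^ (a + a) + C * Fintype.card k ^ a := by
  have : IsScalarTower k k[X] (PowerSeries k) := .of_algebraMap_eq fun x => by
    simp [PowerSeries.algebraMap_apply']
  have hinj : Function.Injective (algebraMap k[X] O) := by
    have h1 : Function.Injective (algebraMap k[X] (PowerSeries k)) := by
      intro p p' hp
      simpa [PowerSeries.algebraMap_apply'] using hp
    rw [← τ.comp_algebraMap] at h1
    exact Function.Injective.of_comp h1
  have : Module.IsTorsionFree k[X] O := (Module.isTorsionFree_iff_algebraMap_injective).2 hinj
  obtain ⟨n, e⟩ := Module.basisOfFiniteTypeTorsionFree' (R := k[X]) (M := O)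
  obtain ⟨c₁, hc₁⟩ := exists_mul_mem_coordDegreeLT e
  obtain ⟨c₂, hσ⟩ := exists_map_mem_coordDegreeLT e σ.toLinearMap
  have hn : 0 < n := by
    rcases Nat.eq_zero_or_pos n with rfl | h
    · exact absurd (e.ext_elem (x := 1) (y := 0) fun i => i.elim0) one_ne_zero
    · exact h
  obtain ⟨c, hcc₁, hcc₂⟩ : ∃ c, c₁ ≤ c ∧ c₂ ≤ c := ⟨c₁ + c₂, by omega, by omega⟩
  have hc : ∀ v w, ∀ f ∈ coordDegreeLT e v, ∀ g ∈ coordDegreeLT e w,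
      f * g ∈ coordDegreeLT e (v + w + c) := fun v w f hf g hg =>
    coordDegreeLT_mono e (by omega) (hc₁ v w f hf g hg)
  have hσ' : ∀ w, ∀ f ∈ coordDegreeLT e w, σ f ∈ coordDegreeLT e (w + c) := fun w f hf =>
    coordDegreeLT_mono e (by omega) (hσ w f hf)
  refine ⟨1 + n * (2 * c + 5) + n * c + 2 * c * n, 2 * n * (c + 2) + 4 * c + 10,
    fun a ha T hT => ?_⟩
  obtain ⟨L, t, h1, h2, h3⟩ := exists_stepanov_parameters (c := c) hn
    (ha.trans (Nat.lt_pow_self (Fintype.one_lt_card (α := k))).le)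
  obtain ⟨h, hh, h0, hP⟩ := exists_vanishing_of_mul_lt (K := K) hc hσ' hτ (a := a) (L := L)
    (T := t) (by rwa [Fintype.card_fin]) (by rwa [Fintype.card_fin])
  have := card_points_le_of_mem_coordDegreeLT hc hh h0 T fun P hPT => hP P (hT P hPT)
  rw [Fintype.card_fin] at this
  rw [pow_add]
  exact this.trans h3

omit [Fintype k] in
/-- A nonzero function vanishes at boundedly many points. -/
theorem exists_card_zeros_le [Module.Finite k[X] O]
    (τ : O →ₐ[k[X]] PowerSeries k) {h : O} (h0 : h ≠ 0) :
    ∃ C : ℕ, ∀ T : Finset (O →ₐ[k] K), (∀ P ∈ T, P h = 0) → T.card ≤ C := by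
  have hinj : Function.Injective (algebraMap k[X] O) := by
    have h1 : Function.Injective (algebraMap k[X] (PowerSeries k)) := by
      intro p p' hp
      simpa [PowerSeries.algebraMap_apply'] using hp
    rw [← τ.comp_algebraMap] at h1
    exact Function.Injective.of_comp h1
  have : Module.IsTorsionFree k[X] O := (Module.isTorsionFree_iff_algebraMap_injective).2 hinj
  obtain ⟨n, e⟩ := Module.basisOfFiniteTypeTorsionFree' (R := k[X]) (M := O)
  obtain ⟨c, hc⟩ := exists_mul_mem_coordDegreeLT e
  obtain ⟨w, hw⟩ := exists_mem_coordDegreeLT e h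
  exact ⟨_, fun T hT => card_points_le_of_mem_coordDegreeLT hc hw h0 T hT⟩

end Stepanov

section Integrality

theorem exists_ringHom_comp_algebraMap_eq {R S K : Type*} [CommRing R] [CommRing S] [IsDomain S]
    [Algebra R S] [Algebra.IsIntegral R S] [Field K] [IsAlgClosed K]
    (hinj : Function.Injective (algebraMap R S)) (φ : R →+* K) :
    ∃ ψ : S →+* K, ψ.comp (algebraMap R S) = φ := by
  obtain ⟨p, hp⟩ : ∃ p, p = RingHom.ker φ := ⟨_, rfl⟩
  have hP : p.IsPrime := hp ▸ RingHom.ker_isPrime φ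
  obtain ⟨Q, hQ, hQP⟩ := Ideal.exists_ideal_over_prime_of_isIntegral_of_isDomain (S := S)
    p (by rw [(RingHom.injective_iff_ker_eq_bot _).1 hinj]; exact bot_le)
  have hφ : ∀ a ∈ p, φ a = 0 := fun a ha => by rwa [hp, RingHom.mem_ker] at ha
  let _ : Algebra (R ⧸ p) K := (Ideal.Quotient.lift p φ hφ).toAlgebra
  have h1 : Q.LiesOver p := ⟨hQP.symm⟩
  have h2 : Module.IsTorsionFree (R ⧸ p) (S ⧸ Q) := by
    rw [Module.isTorsionFree_iff_algebraMap_injective]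
    rintro ⟨a⟩ ⟨b⟩ hab
    have h6 : algebraMap R S a - algebraMap R S b ∈ Q := Ideal.Quotient.eq.1 hab
    rw [← map_sub, ← Ideal.mem_comap, hQP] at h6
    exact Ideal.Quotient.eq.2 h6
  have h3 : Module.IsTorsionFree (R ⧸ p) K := by
    rw [Module.isTorsionFree_iff_algebraMap_injective]
    exact RingHom.lift_injective_of_ker_le_ideal p hφ hp.ge
  have h4 : Algebra.IsIntegral (R ⧸ p) (S ⧸ Q) := inferInstance
  have h5 : Algebra.IsAlgebraic (R ⧸ p) (S ⧸ Q) := inferInstance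
  let l : (S ⧸ Q) →ₐ[R ⧸ p] K := IsAlgClosed.lift
  refine ⟨l.toRingHom.comp (Ideal.Quotient.mk Q), ?_⟩
  ext x
  have := l.commutes (Ideal.Quotient.mk _ x)
  simp only [RingHom.comp_apply]
  exact this

/-- If the `q`-th powers of finitely many elements lie in their span together with `1`, then
they are integral. -/
theorem isIntegral_of_pow_mem_span {R A J : Type*} [CommRing R] [CommRing A] [IsDomain A]
    [Algebra R A] [Fintype J] (y : J → A) {q : ℕ} (hq : 2 ≤ q)
    (h1 : 1 ∈ Submodule.span R (Set.range y))
    (hy : ∀ j, y j ^ q ∈ Submodule.span R (Set.range y)) (j : J) : IsIntegral R (y j) := by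
  classical
  set W := Submodule.span R (Set.range y) with hW
  have hmono : ∀ {a b : ℕ}, a ≤ b → W ^ a ≤ W ^ b := fun {a b} hab => by
    obtain ⟨d, rfl⟩ := Nat.exists_eq_add_of_le hab
    rw [pow_add]
    intro x hx
    rw [← mul_one x]
    refine Submodule.mul_mem_mul hx ?_
    have := Submodule.pow_mem_pow W h1 d
    rwa [one_pow] at this
  set D := Fintype.card J * (q - 1) with hD
  have hstab : W ^ (D + 1) ≤ W ^ D := by
    rw [hW, Submodule.span_pow, ← hW, Submodule.span_le]
    intro x hx
    obtain ⟨f, rfl⟩ := Set.mem_pow.1 hx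
    choose g hg using fun i => (f i).2
    obtain ⟨i, hi⟩ := Fintype.exists_lt_card_fiber_of_mul_lt_card g (n := q - 1)
      (by rw [Fintype.card_fin]; omega)
    rw [List.prod_ofFn]
    simp only [← hg]
    obtain ⟨s, hs, hsq⟩ := Finset.exists_subset_card_eq
      (show q ≤ ({x | g x = i} : Finset _).card by omega)
    rw [← Finset.prod_mul_prod_compl s]
    have h2 : ∏ t ∈ s, y (g t) = y i ^ q := by
      rw [← hsq]
      exact Finset.prod_eq_pow_card fun t ht => by rw [(Finset.mem_filter.1 (hs ht)).2]
    have h3 : ∏ t ∈ sᶜ, y (g t) ∈ W ^ (sᶜ).card := by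
      clear h2 hsq hs
      generalize sᶜ = u
      induction u using Finset.induction_on with
      | empty => simp [Submodule.one_le.1 le_rfl]
      | insert a u ha ih =>
        rw [Finset.prod_insert ha, Finset.card_insert_of_notMem ha, pow_succ']
        exact Submodule.mul_mem_mul (Submodule.subset_span ⟨_, rfl⟩) ih
    rw [Finset.card_compl, Fintype.card_fin, hsq] at h3
    have h4 : q ≤ D + 1 := by
      simpa [hsq] using Finset.card_le_univ s
    have h5 := Submodule.mul_mem_mul (hy i) h3
    rw [← pow_succ'] at h5
    rw [h2]
    exact hmono (by omega) h5
  refine isIntegral_of_smul_mem_submodule (W ^ D) ?_ ?_ _ fun n hn => ?_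
  · intro h0
    have := Submodule.pow_mem_pow W h1 D
    rw [h0, one_pow, Submodule.mem_bot] at this
    exact one_ne_zero this
  · exact (Submodule.fg_span (Set.finite_range y)).pow D
  · rw [smul_eq_mul]
    refine hstab ?_
    rw [pow_succ']
    exact Submodule.mul_mem_mul (Submodule.subset_span ⟨j, rfl⟩) hn

end Integrality

section TorsorSeries

variable {k : Type*} [Field k] [Fintype k] {m : Type*} [Fintype m] [DecidableEq m]

/-- Coefficients of the solution `Y` of `Y^(q) = β Y`, `Y(0) = 1`. -/
noncomputable def torsorCoeff (β : Matrix m m k[X]) : ℕ → Matrix m m k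
  | 0 => 1
  | n + 1 => (if Fintype.card k ∣ n + 1 then torsorCoeff β (min n ((n + 1) / Fintype.card k))
      else 0) -
      ∑ j : Fin (n + 1), β.map (fun p => p.coeff (n + 1 - j)) * torsorCoeff β j
decreasing_by
  · omega
  · exact j.2

theorem powerSeries_coeff_pow_card (f : PowerSeries k) (n : ℕ) :
    PowerSeries.coeff n (f ^ Fintype.card k) =
      if Fintype.card k ∣ n then PowerSeries.coeff (n / Fintype.card k) f else 0 := by
  have hp := Fintype.card_ne_zero (α := k)
  have h1 : ∀ p : k[X], PowerSeries.coeff n ((p : PowerSeries k) ^ Fintype.card k) =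
      if Fintype.card k ∣ n then PowerSeries.coeff (n / Fintype.card k) (p : PowerSeries k)
        else 0 := fun p => by
    rw [← Polynomial.coe_pow, ← FiniteField.expand_card, Polynomial.coeff_coe,
      Polynomial.coeff_expand (Nat.pos_of_ne_zero hp), Polynomial.coeff_coe]
  obtain ⟨g, hg⟩ : (PowerSeries.X : PowerSeries k) ^ (n + 1) ∣
      f - (PowerSeries.trunc (n + 1) f : PowerSeries k) := by
    rw [PowerSeries.X_pow_dvd_iff]
    intro i hi
    rw [map_sub, Polynomial.coeff_coe, PowerSeries.coeff_trunc, if_pos hi, sub_self]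
  have h2 : f = (PowerSeries.trunc (n + 1) f : PowerSeries k) + PowerSeries.X ^ (n + 1) * g := by
    rw [← hg]; ring
  have h3 : f ^ Fintype.card k = (PowerSeries.trunc (n + 1) f : PowerSeries k) ^ Fintype.card k +
      PowerSeries.X ^ (n + 1) * (PowerSeries.X ^ (n + 1)) ^ (Fintype.card k - 1) *
        g ^ Fintype.card k := by
    conv_lhs => rw [h2]
    have := iterFrobenius_apply k (PowerSeries k) 1
    simp only [pow_one] at this
    rw [← this, map_add, this, this, mul_pow, ← pow_succ', Nat.sub_add_cancel
      (Nat.pos_of_ne_zero hp)]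
  rw [h3, map_add, h1, mul_assoc, PowerSeries.coeff_X_pow_mul', if_neg (Nat.not_succ_le_self n),
      add_zero,
    Polynomial.coeff_coe, PowerSeries.coeff_trunc,
    if_pos (Nat.lt_succ_of_le (Nat.div_le_self _ _))]

theorem exists_torsor (β : Matrix m m k[X]) (hβ : β.map (fun p => p.coeff 0) = 1) :
    ∃ Y : Matrix m m (PowerSeries k), Y.map PowerSeries.constantCoeff = 1 ∧
      ∀ i j, Y i j ^ Fintype.card k = ∑ l, β i l • Y l j := by
  refine ⟨Matrix.of fun i j => PowerSeries.mk fun n => torsorCoeff β n i j, ?_, fun i j => ?_⟩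
  · ext i j
    rw [Matrix.map_apply, Matrix.of_apply, ← PowerSeries.coeff_zero_eq_constantCoeff_apply,
        PowerSeries.coeff_mk,
      torsorCoeff]
  · ext n
    rw [powerSeries_coeff_pow_card, map_sum]
    simp only [Matrix.of_apply, Algebra.smul_def, PowerSeries.algebraMap_apply',
        PowerSeries.coeff_mul,
      PowerSeries.coeff_mk, Algebra.algebraMap_self, PowerSeries.map_id,
      Polynomial.coeff_coe, id]
    rw [Finset.sum_comm, Finset.Nat.sum_antidiagonal_eq_sum_range_succ
      (fun a b => ∑ x, (β i x).coeff a * torsorCoeff β b x j), ← Finset.sum_range_reflect]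
    rcases n with _ | n
    · simp only [dvd_zero, if_true, Nat.zero_div, Finset.sum_range_one]
      rw [torsorCoeff]
      have := congrFun (congrFun hβ i) j
      simp only [Matrix.map_apply] at this
      rw [← this]
      simp [Matrix.one_apply]
    · have hrec := congrFun (congrFun (torsorCoeff.eq_2 β n) i) j
      have hmin : min n ((n + 1) / Fintype.card k) = (n + 1) / Fintype.card k :=
        min_eq_right (Nat.le_of_lt_succ
          (Nat.div_lt_self (Nat.succ_pos n) (Fintype.one_lt_card (α := k))))
      rw [Matrix.sub_apply, Matrix.sum_apply, hmin] at hrec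
      rw [Finset.sum_range_succ]
      have h1 : ∑ x, (β i x).coeff (n + 1 + 1 - 1 - (n + 1)) *
          torsorCoeff β (n + 1 - (n + 1 + 1 - 1 - (n + 1))) x j = torsorCoeff β (n + 1) i j := by
        have h2 : (β.map (fun p => p.coeff 0) * torsorCoeff β (n + 1)) i j =
          torsorCoeff β (n + 1) i j := by rw [hβ, one_mul]
        rw [← h2, Matrix.mul_apply]
        simp
      rw [h1, hrec, Finset.sum_range]
      have h3 : ∀ x : Fin (n + 1), ∑ l, (β i l).coeff (n + 1 + 1 - 1 - x) *
          torsorCoeff β (n + 1 - (n + 1 + 1 - 1 - x)) l j =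
          (β.map (fun p => p.coeff (n + 1 - x)) * torsorCoeff β x) i j := fun x => by
        rw [Matrix.mul_apply]
        have h4 : n + 1 + 1 - 1 - (x : ℕ) = n + 1 - x := by omega
        have h5 : n + 1 - (n + 1 - (x : ℕ)) = x := by omega
        rw [h4, h5]
        rfl
      simp only [h3]
      split_ifs <;> simp

end TorsorSeries

section TorsorRing

variable {k : Type*} [Field k] {m : Type*}

/-- The ring generated over `k[X]` by the entries of a matrix of power series. -/
noncomputable def torsorRing (Y : Matrix m m (PowerSeries k)) : Subalgebra k[X] (PowerSeries k) :=
  Algebra.adjoin k[X] (Set.range (Function.uncurry Y))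

/-- The matrix `Y`, seen over the ring generated by its entries. -/
noncomputable def torsorMatrix (Y : Matrix m m (PowerSeries k)) : Matrix m m (torsorRing Y) :=
  Matrix.of fun i j => ⟨Y i j, Algebra.subset_adjoin ⟨(i, j), rfl⟩⟩

theorem val_torsorMatrix (Y : Matrix m m (PowerSeries k)) (i j : m) :
    (torsorMatrix Y i j : PowerSeries k) = Y i j := rfl

theorem algebraMap_torsorRing_injective (Y : Matrix m m (PowerSeries k)) :
    Function.Injective (algebraMap k[X] (torsorRing Y)) := by
  intro p p' hp
  have := congrArg Subtype.val hp
  change algebraMap k[X] (PowerSeries k) p = algebraMap k[X] (PowerSeries k) p' at this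
  simpa [PowerSeries.algebraMap_apply'] using this

instance (Y : Matrix m m (PowerSeries k)) : IsScalarTower k k[X] (torsorRing Y) := by
  have : IsScalarTower k k[X] (PowerSeries k) := .of_algebraMap_eq fun x => by
    simp [PowerSeries.algebraMap_apply']
  refine .of_algebraMap_eq fun x => Subtype.ext ?_
  change algebraMap k (PowerSeries k) x = _
  rw [IsScalarTower.algebraMap_apply k k[X] (PowerSeries k)]
  rfl

variable [Fintype m]

/-- Substitution of `N * Y` into polynomials in the entries of a matrix. -/
noncomputable def torsorEval (Y : Matrix m m (PowerSeries k)) (N : Matrix m m k) :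
    MvPolynomial (m × m) k[X] →ₐ[k[X]] torsorRing Y :=
  MvPolynomial.aeval fun p => ∑ l, N p.1 l • torsorMatrix Y l p.2

theorem torsorEval_X (Y : Matrix m m (PowerSeries k)) (N : Matrix m m k) (i j : m) :
    torsorEval Y N (MvPolynomial.X (i, j)) = ∑ l, N i l • torsorMatrix Y l j := by
  simp [torsorEval]

variable [DecidableEq m]

theorem torsorEval_one_X (Y : Matrix m m (PowerSeries k)) (i j : m) :
    torsorEval Y 1 (MvPolynomial.X (i, j)) = torsorMatrix Y i j := by
  rw [torsorEval_X]
  simp [Matrix.one_apply]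

theorem torsorEval_one_surjective (Y : Matrix m m (PowerSeries k)) :
    Function.Surjective (torsorEval Y 1) := by
  rintro ⟨f, hf⟩
  rw [torsorRing, Algebra.adjoin_range_eq_range_aeval] at hf
  obtain ⟨G, rfl⟩ := hf
  refine ⟨G, Subtype.ext ?_⟩
  have : (torsorRing Y).val.comp (torsorEval Y 1) = MvPolynomial.aeval (Function.uncurry Y) := by
    ext ⟨i, j⟩ : 1
    rw [AlgHom.comp_apply, torsorEval_one_X]
    simp [val_torsorMatrix, Function.uncurry]
  exact DFunLike.congr_fun this G

variable [Fintype k]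

omit [DecidableEq m] in
theorem torsorRing_finite {β : Matrix m m k[X]} {Y : Matrix m m (PowerSeries k)}
    (hY : ∀ i j, Y i j ^ Fintype.card k = ∑ l, β i l • Y l j) :
    Module.Finite k[X] (torsorRing Y) := by
  let y : Option (m × m) → PowerSeries k := fun o => o.elim 1 (Function.uncurry Y)
  have hintegral : ∀ o, IsIntegral k[X] (y o) :=
    isIntegral_of_pow_mem_span y (q := Fintype.card k) (Fintype.one_lt_card (α := k))
      (Submodule.subset_span ⟨none, rfl⟩) (by
        rintro (_ | ⟨i, j⟩)
        · exact Submodule.subset_span ⟨none, by simp [y]⟩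
        · change Y i j ^ _ ∈ _
          rw [hY]
          exact Submodule.sum_mem _ fun l _ => Submodule.smul_mem _ _
            (Submodule.subset_span ⟨some (l, j), rfl⟩))
  refine Module.Finite.of_fg (N :=
      (torsorRing Y).toSubmodule) (fg_adjoin_of_finite (Set.finite_range _) ?_)
  rintro _ ⟨p, rfl⟩
  exact hintegral (some p)

variable {β : Matrix m m k[X]} {Y : Matrix m m (PowerSeries k)}

omit [DecidableEq m] in
theorem torsorMatrix_pow (hY : ∀ i j, Y i j ^ Fintype.card k = ∑ l, β i l • Y l j) (i j : m) :
    torsorMatrix Y i j ^ Fintype.card k = ∑ l, β i l • torsorMatrix Y l j := by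
  apply Subtype.ext
  rw [SubmonoidClass.coe_pow, val_torsorMatrix, hY]
  simp [val_torsorMatrix]

variable {K : Type*} [Field K] [Algebra k K]

/-- `β(z)β(z^q)⋯`, the matrix by which the `q^n`-Frobenius acts on the fibre over `z`. -/
noncomputable def torsorNorm (β : Matrix m m k[X]) (n : ℕ) (z : K) : Matrix m m K :=
  match n with
  | 0 => 1
  | n + 1 => β.map (aeval (z ^ Fintype.card k ^ n)) * torsorNorm β n z

omit [DecidableEq m] [Fintype m] [Fintype k] in
theorem algHom_algebraMap_eq_aeval (P : torsorRing Y →ₐ[k] K) (p : k[X]) :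
    P (algebraMap k[X] _ p) = aeval (P (algebraMap k[X] _ X)) p := by
  have : P.comp (IsScalarTower.toAlgHom k k[X] (torsorRing Y)) =
      aeval (P (algebraMap k[X] _ X)) := by
    ext; simp
  exact DFunLike.congr_fun this p

theorem map_torsorMatrix_pow (hY : ∀ i j, Y i j ^ Fintype.card k = ∑ l, β i l • Y l j)
    (P : torsorRing Y →ₐ[k] K) (n : ℕ) :
    ((torsorMatrix Y).map P).map (· ^ Fintype.card k ^ n) =
      torsorNorm β n (P (algebraMap k[X] _ X)) * (torsorMatrix Y).map P := by
  induction n with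
  | zero => ext i j; simp [torsorNorm]
  | succ n ih =>
    ext i j
    rw [torsorNorm, Matrix.mul_assoc, ← ih]
    simp only [Matrix.map_apply, Matrix.mul_apply]
    rw [pow_succ', pow_mul, ← map_pow, torsorMatrix_pow hY, map_sum, sum_pow_card_pow]
    refine Finset.sum_congr rfl fun l _ => ?_
    rw [Algebra.smul_def, map_mul, mul_pow, algHom_algebraMap_eq_aeval,
      ← iterFrobenius_apply k K n (aeval _ _), ← aeval_algHom_apply, iterFrobenius_apply]

theorem pow_eq_torsorEval (hY : ∀ i j, Y i j ^ Fintype.card k = ∑ l, β i l • Y l j)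
    (P : torsorRing Y →ₐ[k] K) {n : ℕ} {z : K} (hz : P (algebraMap k[X] _ X) = z)
    (hzn : z ^ Fintype.card k ^ n = z) {N : Matrix m m k}
    (hN : torsorNorm β n z = N.map (algebraMap k K)) (G : MvPolynomial (m × m) k[X]) :
    P (torsorEval Y 1 G) ^ Fintype.card k ^ n = P (torsorEval Y N G) := by
  rw [← iterFrobenius_apply k]
  change ((iterFrobenius k K n : K →+* K).comp ((P : torsorRing Y →+* K).comp
    (torsorEval Y 1 : MvPolynomial (m × m) k[X] →+* torsorRing Y))) G =
    ((P : torsorRing Y →+* K).comp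
    (torsorEval Y N : MvPolynomial (m × m) k[X] →+* torsorRing Y)) G
  refine RingHom.congr_fun (MvPolynomial.ringHom_ext (fun p => ?_) fun ⟨i, j⟩ => ?_) G
  · simp only [RingHom.comp_apply, RingHom.coe_coe, ← MvPolynomial.algebraMap_eq,
      AlgHom.commutes]
    rw [algHom_algebraMap_eq_aeval, hz, ← aeval_algHom_apply, iterFrobenius_apply, hzn]
  · simp only [RingHom.comp_apply, RingHom.coe_coe, iterFrobenius_apply]
    rw [torsorEval_one_X, torsorEval_X]
    have := congrFun (congrFun (map_torsorMatrix_pow hY P n) i) j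
    rw [hz, hN, Matrix.mul_apply] at this
    simp only [Matrix.map_apply] at this
    rw [this, map_sum]
    exact Finset.sum_congr rfl fun l _ => by rw [map_smul, Algebra.smul_def]

theorem det_torsorMatrix_pow (hY : ∀ i j, Y i j ^ Fintype.card k = ∑ l, β i l • Y l j)
    (hY0 : Y.map PowerSeries.constantCoeff = 1) :
    (torsorMatrix Y).det ^ (Fintype.card k - 1) = algebraMap k[X] _ β.det := by
  have hne : (torsorMatrix Y).det ≠ 0 := by
    intro h
    have h1 := congrArg (PowerSeries.constantCoeff.comp
      (torsorRing Y).val.toRingHom : torsorRing Y →+* k) h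
    rw [RingHom.map_det] at h1
    have h2 : (PowerSeries.constantCoeff.comp (torsorRing Y).val.toRingHom).mapMatrix
        (torsorMatrix Y) = 1 := by
      rw [← hY0]; rfl
    rw [h2] at h1
    simp at h1
  have hp := Fintype.card_pos (α := k)
  have h1 := iterFrobenius_apply k (torsorRing Y) 1
  simp only [pow_one] at h1
  have h3 : ((iterFrobenius k (torsorRing Y) 1).toRingHom.mapMatrix (torsorMatrix Y)) =
      (algebraMap k[X] (torsorRing Y)).mapMatrix β * torsorMatrix Y := by
    refine Matrix.ext fun i j => ?_
    rw [Matrix.mul_apply]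
    simp only [RingHom.mapMatrix_apply, Matrix.map_apply]
    change iterFrobenius k (torsorRing Y) 1 (torsorMatrix Y i j) = _
    rw [h1, torsorMatrix_pow hY]
    simp [Algebra.smul_def]
  have h2 : (torsorMatrix Y).det ^ Fintype.card k =
      algebraMap k[X] _ β.det * (torsorMatrix Y).det := by
    rw [← h1]
    change (iterFrobenius k (torsorRing Y) 1).toRingHom _ = _
    rw [RingHom.map_det, h3, Matrix.det_mul, RingHom.map_det]
  refine mul_right_cancel₀ hne ?_
  rw [← h2, ← pow_succ, Nat.sub_add_cancel hp]

theorem isUnit_det_map_torsorMatrix (hY : ∀ i j, Y i j ^ Fintype.card k = ∑ l, β i l • Y l j)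
    (hY0 : Y.map PowerSeries.constantCoeff = 1) (P : torsorRing Y →ₐ[k] K)
    (hz : aeval (P (algebraMap k[X] _ X)) β.det ≠ 0) :
    IsUnit ((torsorMatrix Y).map P).det := by
  have h1 : ((torsorMatrix Y).map P).det = P (torsorMatrix Y).det :=
    (RingHom.map_det (P : torsorRing Y →+* K) _).symm
  rw [isUnit_iff_ne_zero, h1]
  intro h0
  have h2 := congrArg P (det_torsorMatrix_pow hY hY0)
  rw [map_pow, h0, zero_pow (Nat.sub_ne_zero_of_lt Fintype.one_lt_card),
    algHom_algebraMap_eq_aeval] at h2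
  exact hz h2.symm

omit [DecidableEq m] in
theorem exists_point [IsAlgClosed K] (hY : ∀ i j, Y i j ^ Fintype.card k = ∑ l, β i l • Y l j)
    (z : K) : ∃ P : torsorRing Y →ₐ[k] K, P (algebraMap k[X] _ X) = z := by
  classical
  have := torsorRing_finite hY
  obtain ⟨ψ, hψ⟩ := exists_ringHom_comp_algebraMap_eq (algebraMap_torsorRing_injective Y)
    (aeval z : k[X] →ₐ[k] K).toRingHom
  refine ⟨{ ψ with commutes' := fun r => ?_ }, ?_⟩
  · have := RingHom.congr_fun hψ (C r)
    simp only [RingHom.comp_apply] at this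
    rw [← Polynomial.algebraMap_eq, ← IsScalarTower.algebraMap_apply k k[X] (torsorRing Y)] at this
    simpa using this
  · simpa using RingHom.congr_fun hψ X

end TorsorRing

section TorsorCount

variable {k : Type*} [Field k] {m : Type*} [Fintype m] [DecidableEq m]

/-- The elements of `Γ` that act on the ring of a torsor through `ρ`. -/
noncomputable def torsorStabilizer {Γ : Type*} [CommMonoid Γ] (ρ : Γ →* Matrix m m k)
    (Y : Matrix m m (PowerSeries k)) : Submonoid Γ where
  carrier := {γ | ∃ σ : torsorRing Y →ₐ[k[X]] torsorRing Y,
    σ.comp (torsorEval Y 1) = torsorEval Y (ρ γ)}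
  one_mem' := ⟨AlgHom.id _ _, by rw [map_one]; rfl⟩
  mul_mem' := by
    rintro γ δ ⟨σ, hσ⟩ ⟨σ', hσ'⟩
    refine ⟨σ.comp σ', ?_⟩
    rw [AlgHom.comp_assoc, hσ', mul_comm, map_mul]
    refine MvPolynomial.algHom_ext fun ⟨i, j⟩ => ?_
    have h1 : ∀ l, σ (torsorMatrix Y l j) = ∑ r, ρ γ l r • torsorMatrix Y r j := fun l => by
      rw [← torsorEval_one_X, ← AlgHom.comp_apply, hσ, torsorEval_X]
    have h2 : ∀ (c : k) (f : torsorRing Y), σ (c • f) = c • σ f := fun c f =>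
      map_smul (σ.restrictScalars k) c f
    rw [AlgHom.comp_apply, torsorEval_X, torsorEval_X, map_sum]
    simp only [h2, h1, Finset.smul_sum, smul_smul, Matrix.mul_apply, Finset.sum_smul]
    exact Finset.sum_comm

variable [Fintype k] {β : Matrix m m k[X]} {Y : Matrix m m (PowerSeries k)}
  {K : Type*} [Field K] [Algebra k K] {Γ : Type*} [CommMonoid Γ] {ρ : Γ →* Matrix m m k}

theorem card_mul_card_fiber_le [IsAlgClosed K]
    (hY : ∀ i j, Y i j ^ Fintype.card k = ∑ l, β i l • Y l j)
    (hY0 : Y.map PowerSeries.constantCoeff = 1) (hρ : Function.Injective ρ) {H : Finset Γ}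
    (hH : ∀ γ, γ ∈ H ↔ γ ∈ torsorStabilizer ρ Y) {γ : Γ} (hγ : γ ∈ H) :
    ∃ C A : ℕ, ∀ a, A ≤ a → ∀ Z : Finset K, (∀ z ∈ Z, z ^ Fintype.card k ^ (a + a) = z ∧
      aeval z β.det ≠ 0 ∧ torsorNorm β (a + a) z = (ρ γ).map (algebraMap k K)) →
      H.card * Z.card ≤ Fintype.card k ^ (a + a) + C * Fintype.card k ^ a := by
  classical
  have := torsorRing_finite hY
  obtain ⟨σ, hσ⟩ := (hH γ).1 hγ
  obtain ⟨C, A, hCA⟩ := exists_card_points_le (K := K) σ (τ := (torsorRing Y).val)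
    Subtype.val_injective
  refine ⟨C, A, fun a ha Z hZ => ?_⟩
  choose P hP using exists_point (K := K) hY
  have hs : ∀ h : H, ∃ s : torsorRing Y →ₐ[k[X]] torsorRing Y,
    s.comp (torsorEval Y 1) = torsorEval Y (ρ h) := fun h => (hH _).1 h.2
  choose s hs using hs
  let f : K × H → (torsorRing Y →ₐ[k] K) := fun p => (P p.1).comp ((s p.2).restrictScalars k)
  have hfX : ∀ p, f p (algebraMap k[X] _ X) = p.1 := fun p => by
    simp [f, hP]
  have hfY : ∀ p, (torsorMatrix Y).map (f p) =
      (ρ p.2).map (algebraMap k K) * (torsorMatrix Y).map (P p.1) := fun p => by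
    ext i j
    have h1 : s p.2 (torsorMatrix Y i j) = ∑ r, ρ p.2 i r • torsorMatrix Y r j := by
      rw [← torsorEval_one_X, ← AlgHom.comp_apply, hs, torsorEval_X]
    simp [f, h1, Matrix.mul_apply, Algebra.smul_def]
  have hinj : Set.InjOn f (Z ×ˢ (Finset.univ : Finset H) : Finset (K × H)) := by
    rintro ⟨z, h⟩ hz ⟨z', h'⟩ hz' he
    have h1 : z = z' := (hfX (z, h)).symm.trans (he ▸ hfX (z', h'))
    subst h1
    have h2 := (hfY (z, h)).symm.trans (he ▸ hfY (z, h'))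
    have h3 : IsUnit ((torsorMatrix Y).map (P z)).det := isUnit_det_map_torsorMatrix hY hY0 _ (by
      rw [hP]; exact (hZ z (Finset.mem_product.1 hz).1).2.1)
    have h4 := ((Matrix.isUnit_iff_isUnit_det _).2 h3).mul_right_cancel h2
    have h5 : ρ h = ρ h' := Matrix.map_injective (algebraMap k K).injective h4
    rw [Subtype.ext (hρ h5)]
  have hcard := hCA a ha (Finset.image f (Z ×ˢ Finset.univ)) (by
    intro Q hQ g
    obtain ⟨⟨z, h⟩, hzh, rfl⟩ := Finset.mem_image.1 hQ
    obtain ⟨hz, -, hN⟩ := hZ z (Finset.mem_product.1 hzh).1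
    obtain ⟨G, rfl⟩ := torsorEval_one_surjective Y g
    rw [← AlgHom.comp_apply σ, hσ]
    exact pow_eq_torsorEval hY _ (hfX (z, h)) hz hN G)
  rw [Finset.card_image_of_injOn hinj, Finset.card_product, Finset.card_univ,
    Fintype.card_coe, mul_comm] at hcard
  exact hcard

theorem exists_card_fiber_le [IsAlgClosed K]
    (hY : ∀ i j, Y i j ^ Fintype.card k = ∑ l, β i l • Y l j)
    {γ : Γ} (hγ : γ ∉ torsorStabilizer ρ Y) :
    ∃ C : ℕ, ∀ n, ∀ Z : Finset K, (∀ z ∈ Z, z ^ Fintype.card k ^ n = z ∧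
      torsorNorm β n z = (ρ γ).map (algebraMap k K)) → Z.card ≤ C := by
  classical
  have := torsorRing_finite hY
  obtain ⟨G, hG1, hG2⟩ : ∃ G, torsorEval Y 1 G = 0 ∧ torsorEval Y (ρ γ) G ≠ 0 := by
    by_contra! hcon
    refine hγ ⟨AlgHom.liftOfSurjective _ (torsorEval_one_surjective Y) (torsorEval Y (ρ γ))
      (fun G hG => hcon G hG), AlgHom.liftOfSurjective_comp _ _ _ _⟩
  obtain ⟨C, hC⟩ := exists_card_zeros_le (K := K) (torsorRing Y).val hG2
  refine ⟨C, fun n Z hZ => ?_⟩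
  choose P hP using exists_point (K := K) hY
  have hinj : Function.Injective P := fun z z' h => by rw [← hP z, h, hP]
  rw [← Finset.card_image_of_injective Z hinj]
  refine hC _ fun Q hQ => ?_
  obtain ⟨z, hz, rfl⟩ := Finset.mem_image.1 hQ
  rw [← pow_eq_torsorEval hY (P z) (hP z) (hZ z hz).1 (hZ z hz).2 G, hG1, map_zero,
    zero_pow (pow_ne_zero _ Fintype.card_ne_zero)]

end TorsorCount

section Dichotomy

theorem norm_sum_sub_le_of_counts {Γ : Type*} [Fintype Γ] [DecidableEq Γ] {H : Finset Γ}
    {χ : Γ → ℂ} (hχ : ∀ γ, ‖χ γ‖ ≤ 1) {c : Γ → ℝ} (hc : ∀ γ, 0 ≤ c γ) {Q C₀ C₁ : ℝ}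
    (hC₁ : 0 ≤ C₁) (h0 : |∑ γ, c γ - Q| ≤ C₀) (h1 : ∀ γ, γ ∉ H → c γ ≤ C₁)
    (hH : ∀ h ∈ H, χ h = 1) :
    ‖∑ γ, c γ * χ γ - Q‖ ≤ C₀ + 2 * Fintype.card Γ * C₁ := by
  have h2 : ∑ γ, c γ * χ γ - Q = ((∑ γ, c γ - Q : ℝ) : ℂ) + ∑ γ, c γ * (χ γ - 1) := by
    simp only [mul_sub, mul_one, Finset.sum_sub_distrib]
    push_cast
    ring
  rw [h2]
  refine (norm_add_le _ _).trans (add_le_add (by rwa [Complex.norm_real]) ?_)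
  refine (norm_sum_le _ _).trans ?_
  have : ∀ γ ∈ (Finset.univ : Finset Γ), ‖(c γ : ℂ) * (χ γ - 1)‖ ≤ 2 * C₁ := fun γ _ => by
    by_cases hγ : γ ∈ H
    · rw [hH γ hγ, sub_self, mul_zero, norm_zero]; positivity
    · rw [norm_mul, Complex.norm_real, Real.norm_of_nonneg (hc γ)]
      have h3 : ‖χ γ - 1‖ ≤ 2 := (norm_sub_le _ _).trans (by rw [norm_one]; linarith [hχ γ])
      calc c γ * ‖χ γ - 1‖ ≤ C₁ * 2 := mul_le_mul (h1 γ hγ) h3 (norm_nonneg _) hC₁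
        _ = 2 * C₁ := mul_comm _ _
  refine (Finset.sum_le_card_nsmul _ _ _ this).trans ?_
  rw [nsmul_eq_mul, Finset.card_univ]
  exact le_of_eq (by ring)

theorem sum_eq_zero_of_mul_mem {Γ : Type*} [CommGroup Γ] {H : Finset Γ}
    (hmul : ∀ a ∈ H, ∀ b ∈ H, a * b ∈ H) (χ : Γ →* ℂ) {h : Γ} (hh : h ∈ H) (hχ : χ h ≠ 1) :
    ∑ γ ∈ H, χ γ = 0 := by
  classical
  have h1 : H.image (h * ·) = H := by
    refine Finset.eq_of_subset_of_card_le (Finset.image_subset_iff.2 fun b hb => hmul h hh b hb) ?_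
    rw [Finset.card_image_of_injective _ (mul_right_injective h)]
  have h2 : ∑ γ ∈ H, χ γ = χ h * ∑ γ ∈ H, χ γ := by
    conv_lhs => rw [← h1, Finset.sum_image fun a _ b _ hab => mul_right_injective h hab]
    rw [Finset.mul_sum]
    exact Finset.sum_congr rfl fun _ _ => map_mul χ _ _
  have h3 : (1 - χ h) * ∑ γ ∈ H, χ γ = 0 := by linear_combination h2
  exact (mul_eq_zero.1 h3).resolve_left (sub_ne_zero.2 (Ne.symm hχ))

theorem norm_sum_le_of_counts {Γ : Type*} [CommGroup Γ] [Fintype Γ] [DecidableEq Γ]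
    {H : Finset Γ} (hmul : ∀ a ∈ H, ∀ b ∈ H, a * b ∈ H) {χ : Γ →* ℂ} (hχ : ∀ γ, ‖χ γ‖ ≤ 1)
    {c : Γ → ℝ} (hc : ∀ γ, 0 ≤ c γ) {Q s C₀ C₁ C₂ : ℝ} (hC₁ : 0 ≤ C₁)
    (h0 : |∑ γ, c γ - Q| ≤ C₀) (h1 : ∀ γ, γ ∉ H → c γ ≤ C₁)
    (h2 : ∀ γ ∈ H, H.card * c γ ≤ Q + C₂ * s) {h : Γ} (hh : h ∈ H) (hχh : χ h ≠ 1) :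
    ‖∑ γ, c γ * χ γ‖ ≤ C₀ + 2 * Fintype.card Γ * C₁ + C₂ * s := by
  have hHpos : (0 : ℝ) < H.card := by exact_mod_cast Finset.card_pos.2 ⟨h, hh⟩
  have hsplit : ∑ γ, c γ = ∑ γ ∈ H, c γ + ∑ γ ∈ Hᶜ, c γ := (Finset.sum_add_sum_compl H c).symm
  have hcompl : ∑ γ ∈ Hᶜ, c γ ≤ Fintype.card Γ * C₁ := by
    refine (Finset.sum_le_card_nsmul _ _ _ fun γ hγ => h1 γ (Finset.mem_compl.1 hγ)).trans ?_
    rw [nsmul_eq_mul]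
    exact mul_le_mul_of_nonneg_right (by exact_mod_cast Finset.card_le_univ _) hC₁
  have hin : ‖∑ γ ∈ H, c γ * χ γ‖ ≤ C₀ + Fintype.card Γ * C₁ + C₂ * s := by
    have h3 : (H.card : ℂ) * ∑ γ ∈ H, c γ * χ γ =
        ∑ γ ∈ H, ((H.card * c γ - (Q + C₂ * s) : ℝ) : ℂ) * χ γ := by
      have h4 : ∑ γ ∈ H, ((H.card * c γ - (Q + C₂ * s) : ℝ) : ℂ) * χ γ =
          (H.card : ℂ) * ∑ γ ∈ H, c γ * χ γ - (Q + C₂ * s) * ∑ γ ∈ H, χ γ := by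
        rw [Finset.mul_sum, Finset.mul_sum, ← Finset.sum_sub_distrib]
        exact Finset.sum_congr rfl fun _ _ => by push_cast; ring
      rw [h4, sum_eq_zero_of_mul_mem hmul χ hh hχh, mul_zero, sub_zero]
    have h5 : H.card * ‖∑ γ ∈ H, c γ * χ γ‖ ≤
        H.card * (C₀ + Fintype.card Γ * C₁ + C₂ * s) := by
      have : (H.card : ℝ) * ‖∑ γ ∈ H, c γ * χ γ‖ = ‖(H.card : ℂ) * ∑ γ ∈ H, c γ * χ γ‖ := by
        rw [norm_mul, Complex.norm_natCast]
      rw [this, h3]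
      calc _ ≤ ∑ γ ∈ H, (Q + C₂ * s - H.card * c γ) := by
            refine norm_sum_le_of_le _ fun γ hγ => ?_
            rw [norm_mul, Complex.norm_real, Real.norm_of_nonpos (by linarith [h2 γ hγ])]
            have := h2 γ hγ
            calc _ ≤ -(H.card * c γ - (Q + C₂ * s)) * 1 :=
                  mul_le_mul_of_nonneg_left (hχ γ) (by linarith)
              _ = _ := by ring
        _ = H.card * (Q + C₂ * s - ∑ γ ∈ H, c γ) := by
            rw [Finset.sum_sub_distrib, Finset.sum_const, nsmul_eq_mul, ← Finset.mul_sum]; ring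
        _ ≤ _ := mul_le_mul_of_nonneg_left (by linarith [(abs_le.1 h0).1]) hHpos.le
    exact le_of_mul_le_mul_left h5 hHpos
  have hout : ‖∑ γ ∈ Hᶜ, c γ * χ γ‖ ≤ Fintype.card Γ * C₁ := by
    refine (norm_sum_le_of_le _ fun γ _ => ?_).trans hcompl
    rw [norm_mul, Complex.norm_real, Real.norm_of_nonneg (hc γ)]
    exact mul_le_of_le_one_right (hc γ) (hχ γ)
  rw [← Finset.sum_add_sum_compl H fun γ => (c γ : ℂ) * χ γ]
  refine (norm_add_le _ _).trans ?_
  linarith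

/-- Character sums over the fibres of a Lang torsor: either square-root cancellation, or no
cancellation up to a bounded error. -/
theorem torsor_dichotomy {k : Type*} [Field k] [Fintype k] {m : Type*} [Fintype m]
    [DecidableEq m] {β : Matrix m m k[X]} (hβ : β.map (fun p => p.coeff 0) = 1)
    {K : Type*} [Field K] [Algebra k K] [IsAlgClosed K]
    {Γ : Type*} [CommGroup Γ] [Finite Γ] {ρ : Γ →* Matrix m m k} (hρ : Function.Injective ρ)
    {χ : Γ →* ℂ} (hχ : ∀ γ, ‖χ γ‖ ≤ 1) (n₀ : ℕ) (Z : ℕ → Finset K) (v : ℕ → K → ℂ)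
    (hZc : ∀ a, (Z a).card = Fintype.card k ^ (a + a))
    (hZ : ∀ a, ∀ z ∈ Z a, z ^ Fintype.card k ^ (a + a) = z)
    (hv1 : ∀ a z, ‖v a z‖ ≤ 1)
    (hv : ∀ a, n₀ ∣ a → ∀ z ∈ Z a, aeval z β.det ≠ 0 →
      ∃ γ, torsorNorm β (a + a) z = (ρ γ).map (algebraMap k K) ∧ v a z = χ γ) :
    (∃ C : ℝ, ∃ A : ℕ, ∀ a, A ≤ a → n₀ ∣ a → ‖∑ z ∈ Z a, v a z‖ ≤ C * Fintype.card k ^ a) ∨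
    (∃ C : ℝ, ∀ a, n₀ ∣ a → ‖∑ z ∈ Z a, v a z - Fintype.card k ^ (a + a)‖ ≤ C) := by
  classical
  have := Fintype.ofFinite Γ
  obtain ⟨Y, hY0, hY⟩ := exists_torsor β hβ
  set H : Finset Γ := Finset.univ.filter (· ∈ torsorStabilizer ρ Y) with hHdef
  have hH : ∀ γ, γ ∈ H ↔ γ ∈ torsorStabilizer ρ Y := fun γ => by simp [H]
  choose! C₁ hC₁ using fun γ (hγ : γ ∉ torsorStabilizer ρ Y) =>
    exists_card_fiber_le (K := K) hY hγ
  choose! C₂ A hC₂ using fun γ (hγ : γ ∈ H) =>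
    card_mul_card_fiber_le (K := K) hY hY0 hρ hH hγ
  have hdet : β.det ≠ 0 := by
    intro h
    have h1 := congrArg (Polynomial.evalRingHom 0) h
    rw [RingHom.map_det] at h1
    have h2 : (Polynomial.evalRingHom 0).mapMatrix β = 1 := by
      rw [← hβ]
      ext i j
      simp [Polynomial.coeff_zero_eq_eval_zero]
    rw [h2] at h1
    simp at h1
  let bad : ℕ → Finset K := fun a => (Z a).filter fun z => aeval z β.det = 0
  let good : ℕ → Finset K := fun a => (Z a).filter fun z => aeval z β.det ≠ 0
  let c : ℕ → Γ → ℕ := fun a γ =>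
    ((good a).filter fun z => torsorNorm β (a + a) z = (ρ γ).map (algebraMap k K)).card
  set D := β.det.natDegree with hD
  have hbad : ∀ a, (bad a).card ≤ D := fun a => by
    refine (Finset.card_le_card (t := (β.det.map (algebraMap k K)).roots.toFinset)
      fun z hz => ?_).trans ((Multiset.toFinset_card_le _).trans ((card_roots' _).trans ?_))
    · rw [Multiset.mem_toFinset, mem_roots (Polynomial.map_ne_zero hdet), IsRoot.def,
        eval_map_algebraMap]
      exact (Finset.mem_filter.1 hz).2
    · rw [natDegree_map]
  have hcard : ∀ a, (bad a).card + (good a).card = Fintype.card k ^ (a + a) := fun a => by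
    rw [← hZc]
    exact Finset.card_filter_add_card_filter_not _
  have hρK : Function.Injective fun γ => (ρ γ).map (algebraMap k K) := fun γ δ h =>
    hρ (Matrix.map_injective (algebraMap k K).injective h)
  have hsum : ∀ a, n₀ ∣ a → ∀ w : K → ℂ, ∑ z ∈ good a, w z =
      ∑ γ, ∑ z ∈ (good a).filter fun z => torsorNorm β (a + a) z = (ρ γ).map (algebraMap k K),
        w z := fun a ha w => by
    choose! γ hγ using hv a ha
    rw [← Finset.sum_fiberwise (good a) γ w]
    refine Finset.sum_congr rfl fun δ _ => Finset.sum_congr (Finset.filter_congr fun z hz => ?_)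
      fun _ _ => rfl
    obtain ⟨hz1, hz2⟩ := Finset.mem_filter.1 hz
    rw [(hγ z hz1 hz2).1]
    exact hρK.eq_iff.symm
  have hvsum : ∀ a, n₀ ∣ a → ∑ z ∈ good a, v a z = ∑ γ, ((c a γ : ℝ) : ℂ) * χ γ := fun a ha => by
    rw [hsum a ha]
    refine Finset.sum_congr rfl fun γ _ => ?_
    rw [Finset.sum_congr rfl (g := fun _ => χ γ) fun z hz => ?_, Finset.sum_const, nsmul_eq_mul]
    · simp [c]
    · obtain ⟨hz1, hz2⟩ := Finset.mem_filter.1 hz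
      obtain ⟨hz1, hz3⟩ := Finset.mem_filter.1 hz1
      obtain ⟨δ, h1, h2⟩ := hv a ha z hz1 hz3
      rw [h2, hρK (h1.symm.trans hz2)]
  have hcsum : ∀ a, n₀ ∣ a → |∑ γ, (c a γ : ℝ) - (Fintype.card k : ℝ) ^ (a + a)| ≤ D :=
    fun a ha => by
    have h1 : ((good a).card : ℝ) = ∑ γ, (c a γ : ℝ) := by
      have := hsum a ha (fun _ => 1)
      simp only [Finset.sum_const, nsmul_eq_mul, mul_one] at this
      exact_mod_cast this
    have h2 : ((bad a).card : ℝ) + (good a).card = (Fintype.card k : ℝ) ^ (a + a) := by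
      exact_mod_cast hcard a
    have h3 : ((bad a).card : ℝ) ≤ D := by exact_mod_cast hbad a
    rw [← h1, ← h2, abs_le]
    constructor <;> linarith [Nat.cast_nonneg (α := ℝ) (bad a).card,
      Nat.cast_nonneg (α := ℝ) D]
  have hbadsum : ∀ a, ‖∑ z ∈ bad a, v a z‖ ≤ D := fun a => by
    refine (norm_sum_le_of_le _ fun z _ => hv1 a z).trans ?_
    rw [Finset.sum_const, nsmul_eq_mul, mul_one]
    exact_mod_cast hbad a
  have htot : ∀ a, ∑ z ∈ Z a, v a z = ∑ z ∈ bad a, v a z + ∑ z ∈ good a, v a z := fun a =>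
    (Finset.sum_filter_add_sum_filter_not _ _ _).symm
  have hcC₁ : ∀ a γ, γ ∉ H → (c a γ : ℝ) ≤ ((∑ δ, C₁ δ : ℕ) : ℝ) := fun a γ hγ => by
    have h1 : c a γ ≤ C₁ γ := hC₁ γ (fun h => hγ ((hH γ).2 h)) (a + a) _ fun z hz => by
      obtain ⟨hz1, hz2⟩ := Finset.mem_filter.1 hz
      exact ⟨hZ a z (Finset.mem_filter.1 hz1).1, hz2⟩
    exact_mod_cast h1.trans (Finset.single_le_sum (fun _ _ => Nat.zero_le _) (Finset.mem_univ γ))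
  by_cases hχH : ∃ h ∈ H, χ h ≠ 1
  · obtain ⟨h, hh, hχh⟩ := hχH
    left
    refine ⟨D + (D + 2 * Fintype.card Γ * ((∑ δ, C₁ δ : ℕ) : ℝ) + ((∑ δ, C₂ δ : ℕ) : ℝ)),
      ∑ δ, A δ, fun a ha hna => ?_⟩
    have h1 := norm_sum_le_of_counts (H := H) (fun x hx y hy => (hH _).2
      (mul_mem ((hH x).1 hx) ((hH y).1 hy))) hχ (c := fun γ => c a γ)
      (fun γ => Nat.cast_nonneg _) (s := (Fintype.card k : ℝ) ^ a)
      (C₂ := ((∑ δ, C₂ δ : ℕ) : ℝ)) (Nat.cast_nonneg _) (hcsum a hna) (hcC₁ a) (fun γ hγ => by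
        have h2 : H.card * c a γ ≤ Fintype.card k ^ (a + a) + C₂ γ * Fintype.card k ^ a :=
          hC₂ γ hγ a ((Finset.single_le_sum (fun _ _ => Nat.zero_le _)
            (Finset.mem_univ γ)).trans ha) _ fun z hz => by
            obtain ⟨hz1, hz2⟩ := Finset.mem_filter.1 hz
            obtain ⟨hz1, hz3⟩ := Finset.mem_filter.1 hz1
            exact ⟨hZ a z hz1, hz3, hz2⟩
        have h3 : C₂ γ ≤ ∑ δ, C₂ δ :=
          Finset.single_le_sum (fun _ _ => Nat.zero_le _) (Finset.mem_univ γ)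
        have h4 := h2.trans (Nat.add_le_add_left (Nat.mul_le_mul_right _ h3) _)
        exact_mod_cast h4) hh hχh
    rw [htot, hvsum a hna]
    refine (norm_add_le _ _).trans ((add_le_add (hbadsum a) h1).trans ?_)
    have hs1 : (1 : ℝ) ≤ (Fintype.card k : ℝ) ^ a :=
      one_le_pow₀ (by exact_mod_cast Fintype.card_pos (α := k))
    have h5 : (0 : ℝ) ≤ D + (D + 2 * Fintype.card Γ * ((∑ δ, C₁ δ : ℕ) : ℝ)) := by positivity
    nlinarith
  · push Not at hχH
    right
    refine ⟨D + (D + 2 * Fintype.card Γ * ((∑ δ, C₁ δ : ℕ) : ℝ)), fun a hna => ?_⟩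
    have h1 := norm_sum_sub_le_of_counts hχ (c := fun γ => c a γ) (fun γ => Nat.cast_nonneg _)
      (Nat.cast_nonneg _) (hcsum a hna) (hcC₁ a) hχH
    rw [htot, hvsum a hna, add_sub_assoc]
    push_cast at h1 ⊢
    exact (norm_add_le _ _).trans (add_le_add (hbadsum a) h1)

end Dichotomy

section PowerSums

open Filter Topology

theorem norm_le_one_of_norm_sum_pow_le {ι : Type*} [Fintype ι] (γ : ι → ℂ) {C : ℝ} {A : ℕ}
    (h : ∀ n, A ≤ n → ‖∑ i, γ i ^ n‖ ≤ C) (i : ι) : ‖γ i‖ ≤ 1 := by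
  classical
  by_contra! hi
  obtain ⟨i₀, -, hmax⟩ :=
      Finset.exists_max_image Finset.univ (fun i => ‖γ i‖) ⟨i, Finset.mem_univ i⟩
  have hρ : 1 < ‖γ i₀‖ := hi.trans_le (hmax i (Finset.mem_univ i))
  set ρ := ‖γ i₀‖ with hρdef
  have hρ0 : 0 < ρ := zero_lt_one.trans hρ
  let θ : ι → ℂ := fun i => γ i / ρ
  have hθ : ∀ i, ‖θ i‖ ≤ 1 := fun i => by
    simp only [θ, norm_div, Complex.norm_real, Real.norm_of_nonneg hρ0.le]
    exact (div_le_one hρ0).2 (hmax i (Finset.mem_univ i))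
  let J : Finset ι := Finset.univ.filter fun i => ‖θ i‖ = 1
  have hi₀ : i₀ ∈ J := by
    simp only [J, Finset.mem_filter, Finset.mem_univ, true_and, θ, norm_div, Complex.norm_real,
      Real.norm_of_nonneg hρ0.le]
    exact div_self hρ0.ne'
  have ht1 : Tendsto (fun n : ℕ => ∑ i, θ i ^ n) atTop (𝓝 0) := by
    refine squeeze_zero_norm' (a := fun n : ℕ => C * (1 / ρ) ^ n) ?_ ?_
    · filter_upwards [eventually_ge_atTop A] with n hn
      have : ∑ i, θ i ^ n = (∑ i, γ i ^ n) * ((1 / ρ : ℝ) : ℂ) ^ n := by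
        rw [Finset.sum_mul]
        refine Finset.sum_congr rfl fun i _ => ?_
        rw [← mul_pow]; simp [θ, div_eq_mul_inv]
      rw [this, norm_mul, norm_pow, Complex.norm_real, Real.norm_of_nonneg (by positivity)]
      exact mul_le_mul_of_nonneg_right (h n hn) (by positivity)
    · rw [← mul_zero C]
      exact (tendsto_pow_atTop_nhds_zero_of_lt_one (by positivity)
        ((div_lt_one hρ0).2 hρ)).const_mul C
  have ht2 : Tendsto (fun n : ℕ => ∑ i ∈ Jᶜ, θ i ^ n) atTop (𝓝 0) := by
    rw [← Finset.sum_const_zero (s := Jᶜ)]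
    refine tendsto_finsetSum _ fun i hi => tendsto_pow_atTop_nhds_zero_of_norm_lt_one ?_
    exact lt_of_le_of_ne (hθ i) fun h => Finset.mem_compl.1 hi (by simp [J, h])
  have ht3 : Tendsto (fun n : ℕ => ∑ i ∈ J, θ i ^ n) atTop (𝓝 0) := by
    have := ht1.sub ht2
    rw [sub_zero] at this
    refine this.congr fun n => ?_
    rw [← Finset.sum_add_sum_compl J, add_sub_cancel_right]
  let u : J → Circle := fun i => ⟨θ i, by
    exact mem_sphere_zero_iff_norm.2 (Finset.mem_filter.1 i.2).2⟩
  have hcl := mapClusterPt_one_atTop_pow u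
  let Φ : (J → Circle) → ℂ := fun w => ∑ i, (w i : ℂ)
  have hΦ : Continuous Φ := continuous_finsetSum _ fun i _ =>
    continuous_subtype_val.comp (continuous_apply i)
  have hcl2 : MapClusterPt (Φ 1) atTop (Φ ∘ fun n : ℕ => u ^ n) :=
    hcl.continuousAt_comp hΦ.continuousAt
  have hΦn : (Φ ∘ fun n : ℕ => u ^ n) = fun n : ℕ => ∑ i ∈ J, θ i ^ n := by
    funext n
    simp only [Φ, Function.comp, u]
    exact Finset.sum_coe_sort J fun i => θ i ^ n
  rw [hΦn] at hcl2
  have hΦ1 : Φ 1 = (J.card : ℂ) := by simp [Φ]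
  have h0 : Φ 1 = 0 := by
    by_contra hne
    have hd := disjoint_nhds_nhds.2 hne
    exact hcl2.neBot.ne (hd.mono_right ht3).eq_bot
  rw [hΦ1] at h0
  exact Finset.card_ne_zero_of_mem hi₀ (by exact_mod_cast h0)

theorem norm_le_of_norm_sum_pow_le {ι : Type*} [Fintype ι] (α : ι → ℂ) {r C : ℝ} (hr : 0 < r)
    {A n₀ : ℕ} (hn₀ : 0 < n₀)
    (h : ∀ a, A ≤ a → n₀ ∣ a → ‖∑ i, α i ^ (a + a)‖ ≤ C * r ^ (a + a)) (i : ι) : ‖α i‖ ≤ r := by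
  have h1 := norm_le_one_of_norm_sum_pow_le (fun i => (α i / r) ^ (n₀ + n₀)) (C := C) (A := A)
    (fun n hn => by
      have h2 := h (n₀ * n) (hn.trans (Nat.le_mul_of_pos_left n hn₀)) ⟨n, rfl⟩
      have h3 : ∑ i, ((α i / r) ^ (n₀ + n₀)) ^ n =
          (∑ i, α i ^ (n₀ * n + n₀ * n)) / (r : ℂ) ^ (n₀ * n + n₀ * n) := by
        rw [Finset.sum_div]
        refine Finset.sum_congr rfl fun i _ => ?_
        rw [← pow_mul, div_pow, add_mul]
      rw [h3, norm_div, norm_pow, Complex.norm_real, Real.norm_of_nonneg hr.le]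
      exact (div_le_iff₀ (by positivity)).2 h2) i
  rw [norm_pow, norm_div, Complex.norm_real, Real.norm_of_nonneg hr.le] at h1
  have h4 := (pow_le_one_iff_of_nonneg (by positivity) (by omega)).1 h1
  exact (div_le_one hr).1 h4

end PowerSums

section MonicPolynomials

variable {F : Type*} [Field F]

theorem monic_monicPoly (n : ℕ) (x : Fin n → F) : (monicPoly F n x).Monic :=
  monic_X_pow_add (degree_sum_fin_lt x)

theorem natDegree_monicPoly (n : ℕ) (x : Fin n → F) : (monicPoly F n x).natDegree = n := by
  refine natDegree_eq_of_degree_eq_some ?_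
  rw [monicPoly, degree_add_eq_left_of_degree_lt, degree_X_pow]
  rw [degree_X_pow]; exact degree_sum_fin_lt x

theorem coeff_monicPoly (n : ℕ) (x : Fin n → F) (i : Fin n) : (monicPoly F n x).coeff i = x i := by
  rw [monicPoly, coeff_add, coeff_X_pow, if_neg i.2.ne, zero_add, finsetSum_coeff,
    Finset.sum_eq_single i]
  · simp
  · intro j _ hj
    rw [coeff_C_mul_X_pow, if_neg fun h => hj (Fin.ext h.symm)]
  · simp

theorem monicPoly_injective (n : ℕ) : Function.Injective (monicPoly F n) := fun x y h => by
  funext i; rw [← coeff_monicPoly n x i, h, coeff_monicPoly]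

theorem monicPoly_coeff {n : ℕ} {f : F[X]} (hf : f.Monic) (hn : f.natDegree = n) :
    monicPoly F n (fun i => f.coeff i) = f := by
  rw [monicPoly, Fin.sum_univ_eq_sum_range (fun i => C (f.coeff i) * X ^ i)]
  subst hn
  exact hf.as_sum.symm

variable [Fintype F]

open scoped Classical in
/-- The finite set of monic polynomials of degree `n`. -/
noncomputable def monicsOfDegree (F : Type*) [Field F] [Fintype F] (n : ℕ) : Finset F[X] :=
  Finset.univ.image (monicPoly F n)

theorem mem_monicsOfDegree {n : ℕ} {f : F[X]} :
    f ∈ monicsOfDegree F n ↔ f.Monic ∧ f.natDegree = n := by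
  classical
  rw [monicsOfDegree, Finset.mem_image]
  constructor
  · rintro ⟨x, -, rfl⟩
    exact ⟨monic_monicPoly n x, natDegree_monicPoly n x⟩
  · rintro ⟨h1, h2⟩
    exact ⟨_, Finset.mem_univ _, monicPoly_coeff h1 h2⟩

theorem sum_monicsOfDegree {M : Type*} [AddCommMonoid M] (n : ℕ) (φ : F[X] → M) :
    ∑ f ∈ monicsOfDegree F n, φ f = ∑ x : Fin n → F, φ (monicPoly F n x) := by
  classical
  rw [monicsOfDegree]
  exact Finset.sum_image (monicPoly_injective n).injOn

theorem card_monicsOfDegree (n : ℕ) : (monicsOfDegree F n).card = Fintype.card F ^ n := by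
  rw [Finset.card_eq_sum_ones, sum_monicsOfDegree]; simp

theorem monicsOfDegree_zero : monicsOfDegree F 0 = {1} := by
  ext f
  rw [mem_monicsOfDegree, Finset.mem_singleton]
  exact ⟨fun h => h.1.natDegree_eq_zero.1 h.2, fun h => by simp [h]⟩

open scoped Classical in
/-- Sums over the monic multiples of `a` are sums over the cofactors. -/
theorem sum_filter_dvd_monicsOfDegree {M : Type*} [AddCommMonoid M] {n j : ℕ} (hj : j ≤ n)
    {a : F[X]} (ha : a ∈ monicsOfDegree F j) (φ : F[X] → M) :
    ∑ f ∈ (monicsOfDegree F n).filter (a ∣ ·), φ f =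
      ∑ h ∈ monicsOfDegree F (n - j), φ (a * h) := by
  rw [mem_monicsOfDegree] at ha
  symm
  refine Finset.sum_bij (fun h _ => a * h) ?_ ?_ ?_ ?_
  · intro h hh
    rw [mem_monicsOfDegree] at hh
    rw [Finset.mem_filter, mem_monicsOfDegree]
    refine ⟨⟨ha.1.mul hh.1, ?_⟩, dvd_mul_right _ _⟩
    rw [ha.1.natDegree_mul hh.1, ha.2, hh.2]; omega
  · intro h _ h' _ e
    exact mul_left_cancel₀ ha.1.ne_zero e
  · intro f hf
    rw [Finset.mem_filter, mem_monicsOfDegree] at hf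
    obtain ⟨⟨h1, h2⟩, h, rfl⟩ := hf
    have hm := ha.1.of_mul_monic_left h1
    refine ⟨h, ?_, rfl⟩
    rw [mem_monicsOfDegree]
    refine ⟨hm, ?_⟩
    rw [ha.1.natDegree_mul hm] at h2; omega
  · intros; rfl

open scoped Classical in
/-- The finite set of monic divisors of a polynomial. -/
noncomputable def monicDivisors (f : F[X]) : Finset F[X] :=
  ((Finset.range (f.natDegree + 1)).biUnion (monicsOfDegree F)).filter (· ∣ f)

theorem mem_monicDivisors {f d : F[X]} (hf : f ≠ 0) :
    d ∈ monicDivisors f ↔ d.Monic ∧ d ∣ f := by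
  simp only [monicDivisors, Finset.mem_filter, Finset.mem_biUnion, Finset.mem_range,
    mem_monicsOfDegree]
  constructor
  · rintro ⟨⟨n, -, h, -⟩, h'⟩; exact ⟨h, h'⟩
  · rintro ⟨h, h'⟩
    exact ⟨⟨_, Nat.lt_succ_of_le (natDegree_le_of_dvd h' hf), h, rfl⟩, h'⟩

open scoped Classical in
theorem sum_monicDivisors {M : Type*} [AddCommMonoid M] (f : F[X]) (φ : F[X] → M) :
    ∑ d ∈ monicDivisors f, φ d =
      ∑ j ∈ Finset.range (f.natDegree + 1), ∑ d ∈ (monicsOfDegree F j).filter (· ∣ f), φ d := by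
  rw [monicDivisors, Finset.filter_biUnion, Finset.sum_biUnion]
  intro i _ j _ hij
  refine Finset.disjoint_left.2 fun d h1 h2 => hij ?_
  rw [Finset.mem_filter, mem_monicsOfDegree] at h1 h2
  exact h1.1.2.symm.trans h2.1.2

theorem sum_sum_monicDivisors {M : Type*} [AddCommMonoid M] (n : ℕ) (φ : F[X] → F[X] → M) :
    ∑ f ∈ monicsOfDegree F n, ∑ d ∈ monicDivisors f, φ d f =
      ∑ j ∈ Finset.range (n + 1), ∑ d ∈ monicsOfDegree F j, ∑ h ∈ monicsOfDegree F (n - j),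
        φ d (d * h) := by
  classical
  have h1 : ∀ f ∈ monicsOfDegree F n, ∑ d ∈ monicDivisors f, φ d f =
      ∑ j ∈ Finset.range (n + 1), ∑ d ∈ monicsOfDegree F j, if d ∣ f then φ d f else 0 := by
    intro f hf
    rw [sum_monicDivisors, (mem_monicsOfDegree.1 hf).2]
    simp_rw [Finset.sum_filter]
  rw [Finset.sum_congr rfl h1, Finset.sum_comm]
  refine Finset.sum_congr rfl fun j hj => ?_
  rw [Finset.sum_comm]
  refine Finset.sum_congr rfl fun d hd => ?_
  rw [← Finset.sum_filter, sum_filter_dvd_monicsOfDegree (Finset.mem_range_succ_iff.1 hj) hd]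

end MonicPolynomials

section Moebius

variable {F : Type*} [Field F]

theorem polyMu_one : polyMu (1 : F[X]) = 1 := by
  classical
  rw [polyMu, if_pos squarefree_one, UniqueFactorizationMonoid.normalizedFactors_one]; simp

theorem polyMu_mul_of_squarefree {a b : F[X]} (h : Squarefree (a * b)) :
    polyMu (a * b) = polyMu a * polyMu b := by
  classical
  have h0 := h.ne_zero
  rw [polyMu, polyMu, polyMu, if_pos h, if_pos h.of_mul_left, if_pos h.of_mul_right,
    UniqueFactorizationMonoid.normalizedFactors_mul (left_ne_zero_of_mul h0)
      (right_ne_zero_of_mul h0), Multiset.card_add, pow_add]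

theorem polyMu_mul_of_isCoprime {a b : F[X]} (h : IsCoprime a b) :
    polyMu (a * b) = polyMu a * polyMu b := by
  classical
  by_cases hs : Squarefree (a * b)
  · exact polyMu_mul_of_squarefree hs
  · have : ¬ (Squarefree a ∧ Squarefree b) := fun h' =>
      hs ((squarefree_mul_iff).2 ⟨h.isRelPrime, h'.1, h'.2⟩)
    rw [polyMu, if_neg hs]
    by_cases ha : Squarefree a
    · have hb : ¬ Squarefree b := fun hb => this ⟨ha, hb⟩
      rw [polyMu, polyMu, if_neg hb, mul_zero]
    · rw [polyMu, if_neg ha, zero_mul]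

theorem polyMu_of_irreducible {P : F[X]} (h : Irreducible P) : polyMu P = -1 := by
  classical
  rw [polyMu, if_pos h.squarefree, UniqueFactorizationMonoid.normalizedFactors_irreducible h]
  simp

theorem abs_polyMu_le_one (f : F[X]) : |polyMu f| ≤ 1 := by
  classical
  rw [polyMu]; split_ifs <;> simp

variable [Fintype F]

theorem sum_monicDivisors_polyMu {f : F[X]} (hf : f.Monic) (hf1 : f ≠ 1) :
    ∑ d ∈ monicDivisors f, polyMu d = 0 := by
  classical
  obtain ⟨P, hPm, hP, hPf⟩ := f.exists_monic_irreducible_factor fun h => hf1 (hf.isUnit_iff.1 h)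
  have hP0 := hP.ne_zero
  have key : ∀ d, ¬ P ∣ d → polyMu (P * d) = -polyMu d := fun d hd => by
    rw [polyMu_mul_of_isCoprime ((hP.coprime_iff_not_dvd).2 hd), polyMu_of_irreducible hP]; ring
  have key2 : ∀ d, P ∣ d → polyMu (P * d) = 0 := fun d hd => by
    rw [polyMu, if_neg fun hs => hP.not_isUnit (hs P (mul_dvd_mul_left P hd))]
  rw [← Finset.sum_filter_add_sum_filter_not _ (P ∣ ·)]
  have : ∑ d ∈ (monicDivisors f).filter (P ∣ ·), polyMu d =
      ∑ d ∈ (monicDivisors f).filter (¬ P ∣ ·), - polyMu d := by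
    symm
    refine Finset.sum_bij_ne_zero (fun d _ _ => P * d) ?_ ?_ ?_ ?_
    · intro d hd _
      rw [Finset.mem_filter, mem_monicDivisors hf.ne_zero] at hd ⊢
      exact ⟨⟨hPm.mul hd.1.1,
        ((hP.coprime_iff_not_dvd).2 hd.2).mul_dvd hPf hd.1.2⟩, dvd_mul_right _ _⟩
    · intro d _ _ d' _ _ e
      exact mul_left_cancel₀ hP0 e
    · intro d hd h0
      rw [Finset.mem_filter, mem_monicDivisors hf.ne_zero] at hd
      obtain ⟨⟨h1, h2⟩, e, rfl⟩ := hd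
      have he : ¬ P ∣ e := fun he => h0 (key2 e he)
      refine ⟨e, ?_, ?_, rfl⟩
      · rw [Finset.mem_filter, mem_monicDivisors hf.ne_zero]
        exact ⟨⟨hPm.of_mul_monic_left h1, (dvd_mul_left _ _).trans h2⟩, he⟩
      · rwa [← key e he]
    · intro d hd _
      rw [key d (Finset.mem_filter.1 hd).2]
  rw [this, Finset.sum_neg_distrib, neg_add_cancel]

end Moebius

section OrbitPolynomial

variable {F : Type*} [Field F] [Fintype F] {K : Type*} [Field K] [Algebra F K]

theorem mem_range_algebraMap_of_pow_card_eq {y : K} (hy : y ^ Fintype.card F = y) :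
    y ∈ Set.range (algebraMap F K) := by
  have h1 : (X ^ Fintype.card F - X : F[X]) = ∏ a : F, (X - C a) := by
    have h2 := FiniteField.roots_X_pow_card_sub_X F
    have h3 : (X ^ Fintype.card F - X : F[X]).Monic :=
      monic_X_pow_sub (by rw [degree_X]; exact_mod_cast Fintype.one_lt_card)
    rw [← prod_multiset_X_sub_C_of_monic_of_roots_card_eq h3, h2]
    · rfl
    · rw [h2, FiniteField.X_pow_card_sub_X_natDegree_eq F Fintype.one_lt_card]; rfl
  have h4 := congrArg (aeval y) h1
  rw [map_prod] at h4
  simp only [map_sub, map_pow, aeval_X, aeval_C, hy, sub_self] at h4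
  obtain ⟨a, -, ha⟩ := Finset.prod_eq_zero_iff.1 h4.symm
  exact ⟨a, (sub_eq_zero.1 ha).symm⟩

variable (F) in
/-- The product of `X - x ^ q ^ i` over `i < j`, where `q` is the cardinality of `F`. -/
noncomputable def orbitProd (j : ℕ) (x : K) : K[X] :=
  ∏ i ∈ Finset.range j, (X - C (x ^ Fintype.card F ^ i))

omit [Field F] [Algebra F K] in
theorem orbitProd_monic (j : ℕ) (x : K) : (orbitProd F j x).Monic :=
  monic_prod_of_monic _ _ fun _ _ => monic_X_sub_C _

omit [Field F] [Algebra F K] in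
theorem orbitProd_natDegree (j : ℕ) (x : K) : (orbitProd F j x).natDegree = j := by
  rw [orbitProd, natDegree_prod_of_monic _ _ fun _ _ => monic_X_sub_C _]
  simp only [natDegree_X_sub_C, Finset.sum_const, Finset.card_range, smul_eq_mul, mul_one]

theorem orbitProd_mem_lifts {j : ℕ} {x : K} (hx : x ^ Fintype.card F ^ j = x) :
    orbitProd F j x ∈ lifts (algebraMap F K) := by
  let φ : K →ₐ[F] K := iterFrobenius F K 1
  have hφ : ∀ y : K, φ y = y ^ Fintype.card F := fun y => by
    rw [iterFrobenius_apply, pow_one]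
  have h1 : (orbitProd F j x).map (φ : K →+* K) = orbitProd F j x := by
    rw [orbitProd, Polynomial.map_prod]
    have h2 : ∀ i, (X - C (x ^ Fintype.card F ^ i)).map (φ : K →+* K) =
        X - C (x ^ Fintype.card F ^ (i + 1)) := fun i => by
      rw [Polynomial.map_sub, map_X, map_C, pow_succ, pow_mul]
      congr 2
    simp_rw [h2]
    have h3 := Finset.prod_range_succ (fun i => X - C (x ^ Fintype.card F ^ i)) j
    rw [Finset.prod_range_succ', hx, pow_zero, pow_one] at h3
    exact mul_right_cancel₀ (X_sub_C_ne_zero x) h3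
  rw [lifts_iff_coeff_lifts]
  intro n
  apply mem_range_algebraMap_of_pow_card_eq
  conv_rhs => rw [← h1]
  rw [coeff_map]
  exact (hφ _).symm

theorem aeval_pow_card_pow (f : F[X]) (x : K) (i : ℕ) :
    aeval (x ^ Fintype.card F ^ i) f = (aeval x f) ^ Fintype.card F ^ i := by
  rw [← iterFrobenius_apply, ← iterFrobenius_apply F K i (aeval x f)]
  exact aeval_algHom_apply _ _ _

omit [Field F] [Algebra F K] in
theorem iterate_pow_card (x : K) (i : ℕ) :
    (fun y : K => y ^ Fintype.card F)^[i] x = x ^ Fintype.card F ^ i := by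
  induction i with
  | zero => simp
  | succ i ih => rw [Function.iterate_succ_apply', ih, ← pow_mul, pow_succ]

section

variable [Algebra.IsAlgebraic F K]

theorem exists_pow_card_pow_eq (x : K) : ∃ j, 0 < j ∧ x ^ Fintype.card F ^ j = x := by
  have : FiniteDimensional F (IntermediateField.adjoin F {x}) :=
    IntermediateField.adjoin.finiteDimensional (Algebra.IsIntegral.isIntegral x)
  have : Finite (IntermediateField.adjoin F {x}) := Module.finite_of_finite F
  have := Fintype.ofFinite (IntermediateField.adjoin F {x})
  refine ⟨_, Module.finrank_pos (R := F) (M := IntermediateField.adjoin F {x}), ?_⟩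
  rw [← Module.card_eq_pow_finrank]
  have h := FiniteField.pow_card
    (⟨x, IntermediateField.mem_adjoin_simple_self F x⟩ : IntermediateField.adjoin F {x})
  exact congrArg Subtype.val h

theorem map_minpoly_eq_orbitProd (x : K) :
    (minpoly F x).map (algebraMap F K) =
      orbitProd F (Function.minimalPeriod (fun y : K => y ^ Fintype.card F) x) x := by
  set d := Function.minimalPeriod (fun y : K => y ^ Fintype.card F) x with hd
  have hintegral : IsIntegral F x := Algebra.IsIntegral.isIntegral x
  have hper : x ^ Fintype.card F ^ d = x := by
    rw [← iterate_pow_card]; exact Function.iterate_minimalPeriod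
  have hd0 : 0 < d := by
    obtain ⟨j, hj, hx⟩ := exists_pow_card_pow_eq (F := F) x
    refine Function.IsPeriodicPt.minimalPeriod_pos hj ?_
    rw [Function.IsPeriodicPt, Function.IsFixedPt, iterate_pow_card, hx]
  obtain ⟨P, hP⟩ := (mem_lifts _).1 (orbitProd_mem_lifts hper)
  have h1 : minpoly F x ∣ P := by
    refine minpoly.dvd F x ?_
    rw [← eval_map_algebraMap, hP, orbitProd, eval_prod]
    exact Finset.prod_eq_zero (Finset.mem_range.2 hd0) (by simp)
  have h2 : orbitProd F d x ∣ (minpoly F x).map (algebraMap F K) := by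
    refine Finset.prod_dvd_of_coprime ?_ fun i _ => ?_
    · intro i hi j hj hij
      refine isCoprime_X_sub_C_of_isUnit_sub (sub_ne_zero.2 fun h => hij ?_).isUnit
      refine Function.iterate_injOn_Iio_minimalPeriod (f := fun y : K => y ^ Fintype.card F)
        (x := x) (by simpa using hi) (by simpa using hj) ?_
      simpa only [iterate_pow_card] using h
    · rw [dvd_iff_isRoot, IsRoot, eval_map_algebraMap, aeval_pow_card_pow, minpoly.aeval,
        zero_pow (pow_ne_zero _ Fintype.card_ne_zero)]
  refine eq_of_monic_of_associated ((minpoly.monic hintegral).map _) (orbitProd_monic _ _)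
    (associated_of_dvd_dvd ?_ h2)
  rw [← hP]
  exact Polynomial.map_dvd _ h1

theorem pow_card_pow_eq_iff (x : K) (j : ℕ) :
    x ^ Fintype.card F ^ j = x ↔ (minpoly F x).natDegree ∣ j := by
  have h := congrArg natDegree (map_minpoly_eq_orbitProd (F := F) x)
  rw [natDegree_map, orbitProd_natDegree] at h
  rw [h, ← Function.isPeriodicPt_iff_minimalPeriod_dvd, Function.IsPeriodicPt, Function.IsFixedPt,
    iterate_pow_card]

variable (F) in
/-- The characteristic polynomial over `F` of `x` as an element of the extension of degree `j`. -/
noncomputable def orbitPoly (j : ℕ) (x : K) : F[X] :=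
  minpoly F x ^ (j / (minpoly F x).natDegree)

theorem map_orbitPoly {j : ℕ} {x : K} (hx : x ^ Fintype.card F ^ j = x) :
    (orbitPoly F j x).map (algebraMap F K) = orbitProd F j x := by
  have h := congrArg natDegree (map_minpoly_eq_orbitProd (F := F) x)
  rw [natDegree_map, orbitProd_natDegree] at h
  have h1 := map_minpoly_eq_orbitProd (F := F) x
  have h2 := (pow_card_pow_eq_iff (F := F) x (minpoly F x).natDegree).2 dvd_rfl
  obtain ⟨k, rfl⟩ := (pow_card_pow_eq_iff x j).1 hx
  have hd : 0 < (minpoly F x).natDegree := minpoly.natDegree_pos (Algebra.IsIntegral.isIntegral x)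
  rw [orbitPoly, Nat.mul_div_cancel_left _ hd, Polynomial.map_pow, h1, ← h]
  clear hx h1
  generalize (minpoly F x).natDegree = d at *
  induction k with
  | zero => simp [orbitProd]
  | succ k ih =>
    rw [pow_succ, ih, mul_add, mul_one]
    unfold orbitProd
    rw [Finset.prod_range_add]
    congr 1
    refine Finset.prod_congr rfl fun i _ => ?_
    rw [pow_add, pow_mul]
    congr 3
    clear ih
    induction k with
    | zero => simp
    | succ k ih => rw [mul_add, mul_one, pow_add, pow_mul, ← ih, h2]

omit [Fintype F] in
theorem orbitPoly_monic (j : ℕ) (x : K) : (orbitPoly F j x).Monic :=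
  (minpoly.monic (Algebra.IsIntegral.isIntegral x)).pow _

theorem orbitPoly_natDegree {j : ℕ} {x : K} (hx : x ^ Fintype.card F ^ j = x) :
    (orbitPoly F j x).natDegree = j := by
  rw [← natDegree_map (algebraMap F K), map_orbitPoly hx, orbitProd_natDegree]

theorem minpoly_pow_dvd_iff {f : F[X]} (hf : f ≠ 0) (x : K) (k : ℕ) :
    minpoly F x ^ k ∣ f ↔ k ≤ rootMultiplicity x (f.map (algebraMap F K)) := by
  classical
  have hintegral : IsIntegral F x := Algebra.IsIntegral.isIntegral x
  have hirr := minpoly.irreducible hintegral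
  have hM : FiniteMultiplicity (minpoly F x) f :=
    finiteMultiplicity_of_degree_pos_of_monic (degree_pos_of_irreducible hirr)
      (minpoly.monic hintegral) hf
  rw [hM.pow_dvd_iff_le_multiplicity]
  obtain ⟨h, h1, h2⟩ := hM.exists_eq_pow_mul_and_not_dvd
  set M := multiplicity (minpoly F x) f
  suffices hs : rootMultiplicity x (f.map (algebraMap F K)) = M by rw [hs]
  have hf' : f.map (algebraMap F K) ≠ 0 :=
      (Polynomial.map_ne_zero_iff (algebraMap F K).injective).2 hf
  rw [h1, Polynomial.map_mul, Polynomial.map_pow] at hf' ⊢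
  have hp : rootMultiplicity x ((minpoly F x).map (algebraMap F K)) = 1 := by
    refine le_antisymm (rootMultiplicity_le_one_of_separable ?_ x) ?_
    · exact (PerfectField.separable_of_irreducible hirr).map
    · refine (rootMultiplicity_pos ?_).2 ?_
      · exact (Polynomial.map_ne_zero_iff (algebraMap F K).injective).2 hirr.ne_zero
      · rw [IsRoot, eval_map_algebraMap, minpoly.aeval]
  rw [rootMultiplicity_mul hf', ← count_roots, roots_pow, Multiset.count_nsmul, count_roots, hp,
    mul_one, rootMultiplicity_eq_zero, add_zero]
  rw [IsRoot, eval_map_algebraMap]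
  exact fun h => h2 (minpoly.dvd F x h)

variable (F K) in
open scoped Classical in
/-- The finite set of elements of `K` fixed by the `j`-th iterate of Frobenius. -/
noncomputable def frobeniusFixed (j : ℕ) : Finset K :=
  (X ^ Fintype.card F ^ j - X : K[X]).roots.toFinset

omit [Algebra F K] [Algebra.IsAlgebraic F K] in
theorem mem_frobeniusFixed {j : ℕ} (hj : j ≠ 0) {x : K} :
    x ∈ frobeniusFixed F K j ↔ x ^ Fintype.card F ^ j = x := by
  classical
  rw [frobeniusFixed, Multiset.mem_toFinset,
    mem_roots (FiniteField.X_pow_card_pow_sub_X_ne_zero K hj Fintype.one_lt_card), IsRoot]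
  simp [sub_eq_zero]

omit [Algebra.IsAlgebraic F K] in
theorem card_frobeniusFixed [IsAlgClosed K] {j : ℕ} (hj : j ≠ 0) :
    (frobeniusFixed F K j).card = Fintype.card F ^ j := by
  classical
  obtain ⟨p, hp⟩ := CharP.exists F
  have : CharP K p := charP_of_injective_algebraMap (algebraMap F K).injective p
  have h1 : p ∣ Fintype.card F ^ j :=
    dvd_pow ((CharP.cast_eq_zero_iff F p _).1 (FiniteField.cast_card_eq_zero F)) hj
  have h2 := galois_poly_separable (K := K) p _ h1
  rw [frobeniusFixed, Multiset.toFinset_card_of_nodup (nodup_roots h2),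
    ← (IsAlgClosed.splits (X ^ Fintype.card F ^ j - X : K[X])).natDegree_eq_card_roots,
    FiniteField.X_pow_card_pow_sub_X_natDegree_eq K hj Fintype.one_lt_card]

open scoped Classical in
theorem card_filter_orbitPoly_dvd {n : ℕ} {f : F[X]} (hf : f ∈ monicsOfDegree F n) {x : K} :
    ((Finset.Icc 1 n).filter fun j => x ^ Fintype.card F ^ j = x ∧ orbitPoly F j x ∣ f).card =
      rootMultiplicity x (f.map (algebraMap F K)) := by
  rw [mem_monicsOfDegree] at hf
  set m := rootMultiplicity x (f.map (algebraMap F K)) with hm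
  set d := (minpoly F x).natDegree with hd
  have hd0 : 0 < d := minpoly.natDegree_pos (Algebra.IsIntegral.isIntegral x)
  have h : ((Finset.Icc 1 n).filter fun j => x ^ Fintype.card F ^ j = x ∧ orbitPoly F j x ∣ f) =
      (Finset.Icc 1 m).image (d * ·) := by
    ext j
    rw [Finset.mem_filter, Finset.mem_image, pow_card_pow_eq_iff, ← hd]
    constructor
    · rintro ⟨h1, ⟨k, rfl⟩, h3⟩
      refine ⟨k, ?_, rfl⟩
      rw [orbitPoly, ← hd, Nat.mul_div_cancel_left _ hd0, minpoly_pow_dvd_iff hf.1.ne_zero] at h3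
      rw [Finset.mem_Icc] at h1 ⊢
      exact ⟨Nat.pos_of_mul_pos_left h1.1, h3⟩
    · rintro ⟨k, hk, rfl⟩
      rw [Finset.mem_Icc] at hk
      have h3 := (minpoly_pow_dvd_iff hf.1.ne_zero x k).2 hk.2
      rw [orbitPoly, ← hd, Nat.mul_div_cancel_left _ hd0, Finset.mem_Icc]
      refine ⟨⟨Nat.mul_pos hd0 hk.1, ?_⟩, dvd_mul_right _ _, h3⟩
      have := natDegree_le_of_dvd h3 hf.1.ne_zero
      rwa [natDegree_pow, hf.2, mul_comm] at this
  rw [h, Finset.card_image_of_injective _ (mul_right_injective₀ hd0.ne'), Nat.card_Icc]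
  omega

open scoped Classical in
theorem sum_card_orbitPoly_dvd [IsAlgClosed K] {n : ℕ} {f : F[X]} (hf : f ∈ monicsOfDegree F n) :
    ∑ j ∈ Finset.Icc 1 n, ((frobeniusFixed F K j).filter fun x => orbitPoly F j x ∣ f).card =
        n := by
  have hf' := mem_monicsOfDegree.1 hf
  set P := f.map (algebraMap F K) with hP
  have hP0 : P ≠ 0 := (Polynomial.map_ne_zero_iff (algebraMap F K).injective).2 hf'.1.ne_zero
  have h1 : ∀ j ∈ Finset.Icc 1 n, ((frobeniusFixed F K j).filter fun x => orbitPoly F j x ∣ f) =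
      P.roots.toFinset.bipartiteAbove
        (fun j x => x ^ Fintype.card F ^ j = x ∧ orbitPoly F j x ∣ f) j := by
    intro j hj
    have hj0 : j ≠ 0 := by rw [Finset.mem_Icc] at hj; omega
    ext x
    rw [Finset.mem_filter, mem_frobeniusFixed hj0, Finset.mem_bipartiteAbove, Multiset.mem_toFinset,
      mem_roots hP0]
    refine ⟨fun h => ⟨?_, h⟩, fun h => h.2⟩
    rw [IsRoot, hP, eval_map_algebraMap]
    obtain ⟨g, hg⟩ := h.2
    have h2 := eval_map_algebraMap (orbitPoly F j x) x
    rw [map_orbitPoly h.1, orbitProd, eval_prod,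
      Finset.prod_eq_zero (Finset.mem_range.2 (Nat.pos_of_ne_zero hj0)) (by simp)] at h2
    rw [hg, map_mul, ← h2, zero_mul]
  rw [Finset.sum_congr rfl fun j hj => by rw [h1 j hj],
    Finset.sum_card_bipartiteAbove_eq_sum_card_bipartiteBelow]
  simp only [Finset.bipartiteBelow]
  rw [Finset.sum_congr rfl fun x _ => card_filter_orbitPoly_dvd hf]
  have h3 := (IsAlgClosed.splits P).natDegree_eq_card_roots
  rw [hP, natDegree_map, hf'.2] at h3
  conv_rhs => rw [h3]
  rw [← Multiset.toFinset_sum_count_eq]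
  simp only [count_roots]
  rfl

end

end OrbitPolynomial

section LFunction

variable {F : Type*} [Field F] [Fintype F]

/-- The `n`-th coefficient of the `L`-function of `ψ`. -/
noncomputable def lCoeff (ψ : F[X] →* ℂ) (n : ℕ) : ℂ := ∑ f ∈ monicsOfDegree F n, ψ f

/-- The `n`-th coefficient of the inverse of the `L`-function of `ψ`. -/
noncomputable def muCoeff (ψ : F[X] →* ℂ) (n : ℕ) : ℂ :=
  ∑ f ∈ monicsOfDegree F n, (polyMu f : ℂ) * ψ f

variable (K : Type*) [Field K] [Algebra F K]

/-- The `j`-th power sum of the `L`-function of `ψ`. -/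
noncomputable def powerSum (ψ : F[X] →* ℂ) (j : ℕ) : ℂ :=
  ∑ x ∈ frobeniusFixed F K j, ψ (orbitPoly F j x)

theorem natCast_mul_lCoeff [IsAlgClosed K] [Algebra.IsAlgebraic F K] (ψ : F[X] →* ℂ) (n : ℕ) :
    (n : ℂ) * lCoeff ψ n = ∑ j ∈ Finset.Icc 1 n, powerSum K ψ j * lCoeff ψ (n - j) := by
  classical
  rw [lCoeff, Finset.mul_sum]
  have h1 : ∀ f ∈ monicsOfDegree F n, (n : ℂ) * ψ f =
      ∑ j ∈ Finset.Icc 1 n, ∑ x ∈ frobeniusFixed F K j, if orbitPoly F j x ∣ f then ψ f else 0 := by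
    intro f hf
    have h := sum_card_orbitPoly_dvd (K := K) hf
    rw [← Nat.cast_inj (R := ℂ), Nat.cast_sum] at h
    rw [← h, Finset.sum_mul]
    refine Finset.sum_congr rfl fun j _ => ?_
    rw [← Finset.sum_filter, Finset.sum_const, nsmul_eq_mul]
  rw [Finset.sum_congr rfl h1, Finset.sum_comm]
  refine Finset.sum_congr rfl fun j hj => ?_
  rw [Finset.mem_Icc] at hj
  rw [Finset.sum_comm, powerSum, Finset.sum_mul]
  refine Finset.sum_congr rfl fun x hx => ?_
  rw [mem_frobeniusFixed (by omega)] at hx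
  rw [← Finset.sum_filter, sum_filter_dvd_monicsOfDegree hj.2
    (mem_monicsOfDegree.2 ⟨orbitPoly_monic j x, orbitPoly_natDegree hx⟩), lCoeff, Finset.mul_sum]
  simp only [map_mul]

theorem sum_muCoeff_mul_lCoeff (ψ : F[X] →* ℂ) (n : ℕ) :
    ∑ j ∈ Finset.range (n + 1), muCoeff ψ j * lCoeff ψ (n - j) = if n = 0 then 1 else 0 := by
  have h := sum_sum_monicDivisors (F := F) n fun d f => (polyMu d : ℂ) * ψ f
  have h1 : ∀ j, ∑ d ∈ monicsOfDegree F j, ∑ h ∈ monicsOfDegree F (n - j),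
      (polyMu d : ℂ) * ψ (d * h) =
      muCoeff ψ j * lCoeff ψ (n - j) := by
    intro j
    rw [muCoeff, lCoeff, Finset.sum_mul_sum]
    simp only [map_mul, mul_assoc]
  simp_rw [h1] at h
  rw [← h]
  simp_rw [← Finset.sum_mul]
  split_ifs with hn
  · subst hn
    rw [monicsOfDegree_zero, Finset.sum_singleton, map_one, mul_one, sum_monicDivisors]
    simp [monicsOfDegree_zero, Finset.filter_singleton, polyMu_one]
  · refine Finset.sum_eq_zero fun f hf => ?_
    rw [mem_monicsOfDegree] at hf
    have : f ≠ 1 := fun h => hn (by rw [← hf.2, h, natDegree_one])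
    rw [← Int.cast_sum, sum_monicDivisors_polyMu hf.1 this, Int.cast_zero, zero_mul]

theorem natCast_mul_muCoeff [IsAlgClosed K] [Algebra.IsAlgebraic F K] (ψ : F[X] →* ℂ) (n : ℕ) :
    (n : ℂ) * muCoeff ψ n = -∑ j ∈ Finset.Icc 1 n, powerSum K ψ j * muCoeff ψ (n - j) := by
  let L : PowerSeries ℂ := PowerSeries.mk (lCoeff ψ)
  let M : PowerSeries ℂ := PowerSeries.mk (muCoeff ψ)
  let S : PowerSeries ℂ := PowerSeries.mk fun j => if j = 0 then 0 else powerSum K ψ j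
  have hconv : ∀ (a : ℕ → ℂ) (n : ℕ), PowerSeries.coeff n (S * PowerSeries.mk a) =
      ∑ j ∈ Finset.Icc 1 n, powerSum K ψ j * a (n - j) := by
    intro a n
    rw [PowerSeries.coeff_mul, Finset.Nat.sum_antidiagonal_eq_sum_range_succ_mk,
        Finset.sum_range_succ',
      Finset.range_eq_Ico, Finset.sum_Ico_add' (fun j => PowerSeries.coeff j S *
      PowerSeries.coeff (n - j) (PowerSeries.mk a)) 0 n 1]
    simp only [S, PowerSeries.coeff_mk, if_true, zero_mul, add_zero]
    refine Finset.sum_congr (by ext; simp) fun j hj => ?_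
    rw [Finset.mem_Icc] at hj
    rw [if_neg (by omega)]
  have hder : ∀ a : ℕ → ℂ, ∀ n,
      PowerSeries.coeff n (PowerSeries.X * PowerSeries.derivative ℂ (PowerSeries.mk a)) = n * a n := by
    intro a n
    cases n with
    | zero => simp
    | succ n => rw [PowerSeries.coeff_succ_X_mul, PowerSeries.coeff_derivative,
        PowerSeries.coeff_mk]; push_cast; ring
  have hML : M * L = 1 := by
    ext n
    rw [PowerSeries.coeff_mul, Finset.Nat.sum_antidiagonal_eq_sum_range_succ_mk,
        PowerSeries.coeff_one]
    simp only [M, L, PowerSeries.coeff_mk]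
    exact sum_muCoeff_mul_lCoeff ψ n
  have hL : PowerSeries.X * PowerSeries.derivative ℂ L = S * L := by
    ext n
    rw [hder, hconv, natCast_mul_lCoeff K]
  have hM : PowerSeries.X * PowerSeries.derivative ℂ M = -(S * M) := by
    have h := congrArg (PowerSeries.derivative ℂ) hML
    rw [Derivation.leibniz, Derivation.map_one_eq_zero, smul_eq_mul, smul_eq_mul] at h
    linear_combination M * PowerSeries.X * h -
        (PowerSeries.X * PowerSeries.derivative ℂ M + S * M) * hML
      - M ^ 2 * hL
  have := congrArg (PowerSeries.coeff n) hM
  rwa [hder, map_neg, hconv] at this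

end LFunction

section HomogeneousEval

variable {R : Type*} [CommRing R] {E : Type*} [Ring E] [Algebra R E]

/-- The value at `(U, V)` of the homogenization of degree `n` of the polynomial `P`. -/
noncomputable def homEval (U V : E) (n : ℕ) (P : R[X]) : E :=
  ∑ i ∈ Finset.range (n + 1), P.coeff i • (U ^ i * V ^ (n - i))

theorem homEval_finset_sum {ι : Type*} (U V : E) (n : ℕ) (s : Finset ι) (P : ι → R[X]) :
    homEval U V n (∑ i ∈ s, P i) = ∑ i ∈ s, homEval U V n (P i) := by
  simp only [homEval, finsetSum_coeff, Finset.sum_smul]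
  exact Finset.sum_comm

theorem homEval_monomial (U V : E) {n i : ℕ} (hi : i ≤ n) (a : R) :
    homEval U V n (monomial i a) = a • (U ^ i * V ^ (n - i)) := by
  rw [homEval, Finset.sum_eq_single i]
  · rw [coeff_monomial_same]
  · intro j _ hj
    rw [coeff_monomial_of_ne _ hj, zero_smul]
  · intro h; exact absurd (Finset.mem_range_succ_iff.2 hi) h

theorem homEval_mul {U V : E} (h : Commute U V) {m n : ℕ} {P Q : R[X]} (hP : P.natDegree ≤ m)
    (hQ : Q.natDegree ≤ n) : homEval U V (m + n) (P * Q) = homEval U V m P * homEval U V n Q := by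
  conv_lhs => rw [P.as_sum_range' (m + 1) (by omega), Q.as_sum_range' (n + 1) (by omega)]
  rw [Finset.sum_mul_sum, homEval_finset_sum, homEval, homEval, Finset.sum_mul_sum]
  refine Finset.sum_congr rfl fun i hi => ?_
  rw [homEval_finset_sum]
  refine Finset.sum_congr rfl fun j hj => ?_
  rw [Finset.mem_range_succ_iff] at hi hj
  rw [monomial_mul_monomial, homEval_monomial _ _ (by omega), smul_mul_smul_comm]
  congr 1
  have h1 : m + n - (i + j) = (m - i) + (n - j) := by omega
  rw [h1, pow_add, pow_add]
  have h2 := (h.pow_pow j (m - i)).eq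
  calc U ^ i * U ^ j * (V ^ (m - i) * V ^ (n - j)) =
      U ^ i * (U ^ j * V ^ (m - i)) * V ^ (n - j) := by
        noncomm_ring
    _ = _ := by rw [h2]; noncomm_ring

theorem homEval_one (U V : E) : homEval U V 0 (1 : R[X]) = 1 := by simp [homEval]

end HomogeneousEval

section

variable {m : Type*} [Fintype m] [DecidableEq m]

theorem map_homEval {R S : Type*} [CommRing R] [CommRing S] (φ : R →+* S) (U V : Matrix m m R)
    (n : ℕ) (P : R[X]) :
    (homEval U V n P).map φ = homEval (U.map φ) (V.map φ) n (P.map φ) := by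
  have h : ∀ M : Matrix m m R, M.map φ = φ.mapMatrix M := fun _ => rfl
  rw [h, homEval, homEval, map_sum]
  refine Finset.sum_congr rfl fun i _ => ?_
  have h1 : ∀ (c : R) (M : Matrix m m R), φ.mapMatrix (c • M) = φ c • φ.mapMatrix M :=
    fun c M => by ext; simp
  rw [coeff_map, h, h, ← map_pow, ← map_pow, ← map_mul, h1]

theorem isUnit_of_det_leftMulMatrix_ne_zero {F B : Type*} [Field F] [Finite F] [CommRing B]
    [Algebra F B] [Module.Finite F B] (b : Module.Basis m F B) {x : B}
    (hx : (Algebra.leftMulMatrix b x).det ≠ 0) : IsUnit x := by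
  have : Finite B := Module.finite_of_finite F
  have hinj : Function.Injective (x * ·) := by
    rw [← AddMonoidHom.coe_mulLeft]
    refine (injective_iff_map_eq_zero _).2 fun y hy => ?_
    rw [AddMonoidHom.coe_mulLeft] at hy
    have h1 : Algebra.leftMulMatrix b x * Algebra.leftMulMatrix b y = 0 := by
      rw [← map_mul, hy, map_zero]
    have h2 : Algebra.leftMulMatrix b y = 0 := by
      rw [← Matrix.nonsing_inv_mul_cancel_left _ (Algebra.leftMulMatrix b y)
          (isUnit_iff_ne_zero.2 hx), h1,
        Matrix.mul_zero]
    exact Algebra.leftMulMatrix_injective b (h2.trans (map_zero _).symm)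
  obtain ⟨y, hy⟩ := (Finite.injective_iff_surjective.1 hinj) 1
  exact IsUnit.of_mul_eq_one y hy

theorem norm_mulChar_le_one {B : Type*} [CommMonoid B] [Finite B] (χ : MulChar B ℂ) (b : B) :
    ‖χ b‖ ≤ 1 := by
  by_cases hb : IsUnit b
  · obtain ⟨u, rfl⟩ := hb
    have h := congrArg χ (congrArg Units.val (pow_card_eq_one' (x := u)))
    rw [Units.val_pow_eq_pow_val, map_pow, Units.val_one, map_one] at h
    have h2 := congrArg norm h
    rw [norm_pow, norm_one] at h2
    exact ((pow_eq_one_iff_of_nonneg (norm_nonneg _) Nat.card_pos.ne').1 h2).le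
  · rw [χ.map_nonunit hb]; simp


theorem add_pow_card_pow {F K : Type*} [Field F] [Fintype F] [Field K] [Algebra F K] (x y : K)
    (i : ℕ) : (x + y) ^ Fintype.card F ^ i = x ^ Fintype.card F ^ i + y ^ Fintype.card F ^ i := by
  rw [← iterFrobenius_apply, map_add, iterFrobenius_apply, iterFrobenius_apply]

variable {F k K : Type*} [Field F] [Fintype F] [Field k] [Fintype k] [Algebra F k] [Field K]
  [Algebra F K] [Algebra k K] [IsScalarTower F k K]

/-- The matrix of polynomials defining the Lang torsor attached to `(U, V)`, normalized by `W`. -/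
noncomputable def orbitMatrix (U V W : Matrix m m F) (r : ℕ) (x₀ : k) : Matrix m m k[X] :=
  homEval (U.map (algebraMap F k[X])) (V.map (algebraMap F k[X])) r
    (∏ i ∈ Finset.range r, (X - C (C (x₀ ^ Fintype.card F ^ i) + X ^ Fintype.card F ^ i))) *
    W.map (algebraMap F k[X])

omit [Fintype k] in
theorem orbitMatrix_map (U V W : Matrix m m F) (r : ℕ) (x₀ : k) (y : K) :
    (orbitMatrix U V W r x₀).map (aeval y) =
      homEval (U.map (algebraMap F K)) (V.map (algebraMap F K)) r
        (orbitProd F r (algebraMap k K x₀ + y)) * W.map (algebraMap F K) := by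
  have h : ∀ M : Matrix m m F, (M.map (algebraMap F k[X])).map (aeval y : k[X] →ₐ[k] K).toRingHom =
      M.map (algebraMap F K) := fun M => by
    ext i j
    simp only [Matrix.map_apply]
    rw [IsScalarTower.algebraMap_apply F k K, IsScalarTower.algebraMap_apply F k k[X]]
    exact aeval_C y _
  have h1 : (orbitMatrix U V W r x₀).map (aeval y) =
    (aeval y : k[X] →ₐ[k] K).toRingHom.mapMatrix (orbitMatrix U V W r x₀) := rfl
  rw [h1, orbitMatrix, map_mul]
  simp only [RingHom.mapMatrix_apply]
  rw [map_homEval, h, h, h, Polynomial.map_prod, orbitProd]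
  congr 2
  refine Finset.prod_congr rfl fun i _ => ?_
  rw [add_pow_card_pow, Polynomial.map_sub, map_X, map_C]
  congr 2
  simp

theorem torsorNorm_orbitMatrix {U V W : Matrix m m F} (hUV : Commute U V) (hUW : Commute U W)
    (hVW : Commute V W) {r : ℕ} (hr : Fintype.card k = Fintype.card F ^ r)
    (x₀ : k) (n : ℕ) (z : K) :
    torsorNorm (orbitMatrix U V W r x₀) n z =
      homEval (U.map (algebraMap F K)) (V.map (algebraMap F K)) (r * n)
        (orbitProd F (r * n) (algebraMap k K x₀ + z)) * (W.map (algebraMap F K)) ^ n := by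
  have hc : ∀ {M N : Matrix m m F}, Commute M N →
      Commute (M.map (algebraMap F K)) (N.map (algebraMap F K)) := fun h =>
    h.map (algebraMap F K).mapMatrix
  have hcW : ∀ (n : ℕ) (P : K[X]), Commute (W.map (algebraMap F K))
      (homEval (U.map (algebraMap F K)) (V.map (algebraMap F K)) n P) := fun n P =>
    Commute.sum_right _ _ _ fun i _ => Commute.smul_right
      (((hc hUW).symm.pow_right _).mul_right ((hc hVW).symm.pow_right _)) _
  induction n with
  | zero => simp [torsorNorm, orbitProd, homEval_one]
  | succ n ih =>
    rw [torsorNorm, ih, orbitMatrix_map]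
    set x := algebraMap k K x₀ + z with hx
    have h1 : algebraMap k K x₀ + z ^ Fintype.card k ^ n = x ^ Fintype.card F ^ (r * n) := by
      rw [hx, add_pow_card_pow, pow_mul, ← hr, ← map_pow, FiniteField.pow_card_pow]
    have h2 : orbitProd F (r * (n + 1)) x =
        orbitProd F r (x ^ Fintype.card F ^ (r * n)) * orbitProd F (r * n) x := by
      rw [mul_add, mul_one, orbitProd, Finset.prod_range_add, mul_comm, orbitProd, orbitProd]
      congr 1
      refine Finset.prod_congr rfl fun i _ => ?_
      rw [pow_add, pow_mul]
    rw [h1, h2, mul_add, mul_one, add_comm, homEval_mul (hc hUV) (orbitProd_natDegree _ _).le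
      (orbitProd_natDegree _ _).le, pow_succ', Matrix.mul_assoc, Matrix.mul_assoc,
      ← Matrix.mul_assoc (W.map _), (hcW _ _).eq, Matrix.mul_assoc]

theorem det_torsorNorm_ne_zero {β : Matrix m m k[X]} {z : K} (hz : aeval z β.det ≠ 0) (n : ℕ) :
    (torsorNorm β n z).det ≠ 0 := by
  induction n with
  | zero => simp [torsorNorm]
  | succ n ih =>
    rw [torsorNorm, Matrix.det_mul]
    refine mul_ne_zero ?_ ih
    have h : (β.map (aeval (z ^ Fintype.card k ^ n))).det =
        aeval (z ^ Fintype.card k ^ n) β.det := ((aeval (z ^ Fintype.card k ^ n)).map_det β).symm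
    rw [h, aeval_pow_card_pow]
    exact pow_ne_zero _ hz

end

section

theorem map_leftMulMatrix_homEval {F B L m : Type*} [Field F] [CommRing B] [Algebra F B] [Field L]
    [Algebra F L] [Fintype m] [DecidableEq m] (b : Module.Basis m F B) (u v : B) (n : ℕ)
    (P : F[X]) :
    (Algebra.leftMulMatrix b (homEval u v n P)).map (algebraMap F L) =
      homEval ((Algebra.leftMulMatrix b u).map (algebraMap F L))
        ((Algebra.leftMulMatrix b v).map (algebraMap F L)) n (P.map (algebraMap F L)) := by
  rw [← map_homEval]
  congr 1
  simp only [homEval, map_sum, map_smul, map_mul, map_pow]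

variable {F K : Type*} [Field F] [Fintype F] [Field K] [Algebra F K] [IsAlgClosed K]
  [Algebra.IsAlgebraic F K]

theorem powerSum_dichotomy_of_finite_extension {k : Type*} [Field k] [Fintype k] [Algebra F k]
    [Algebra k K] [IsScalarTower F k K]
    {B : Type*} [CommRing B] [Algebra F B] [Module.Finite F B] (cls : F[X] →* B) {u v : B}
    (hcls : ∀ f : F[X], f.Monic → cls f = homEval u v f.natDegree f)
    {x₀ : k} (hx₀ : IsUnit (cls (minpoly F x₀))) (χ : MulChar B ℂ) {n₀ : ℕ}
    (hn₀ : Nat.card Bˣ ∣ n₀) {r : ℕ} (hr : Fintype.card k = Fintype.card F ^ r) (hr0 : r ≠ 0) :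
    (∃ C : ℝ, ∃ A : ℕ, ∀ a, A ≤ a → n₀ ∣ a →
      ‖powerSum K (χ.toMonoidHom.comp cls) (r * (a + a))‖ ≤ C * (Fintype.card F ^ r : ℕ) ^ a) ∨
    (∃ C : ℝ, ∀ a, a ≠ 0 → n₀ ∣ a →
      ‖powerSum K (χ.toMonoidHom.comp cls) (r * (a + a)) - (Fintype.card F ^ r : ℕ) ^ (a + a)‖
        ≤ C) := by
  classical
  have : Finite B := Module.finite_of_finite F
  have : Algebra.IsAlgebraic F k := Algebra.IsAlgebraic.of_finite F k
  let b := Module.finBasis F B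
  let M := Algebra.leftMulMatrix b
  have hk0 : ∀ x : k, x ^ Fintype.card F ^ r = x := fun x => by
    rw [← hr, FiniteField.pow_card]
  have hw : IsUnit (cls (orbitPoly F r x₀)) := by
    rw [orbitPoly, map_pow]; exact hx₀.pow _
  obtain ⟨w, hw⟩ := hw
  let β := orbitMatrix (M u) (M v) (M (w⁻¹ : Bˣ)) r x₀
  have hβ : β.map (fun p => p.coeff 0) = 1 := by
    have h1 : β.map (fun p => p.coeff 0) = β.map (aeval (0 : k)) := by
      ext i j
      rw [Matrix.map_apply, Matrix.map_apply, coeff_zero_eq_aeval_zero]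
    rw [h1, orbitMatrix_map, Algebra.algebraMap_self_apply, add_zero, ← map_orbitPoly (hk0 x₀)]
    have h2 := map_leftMulMatrix_homEval (L := k) b u v r (orbitPoly F r x₀)
    have h3 := hcls _ (orbitPoly_monic r x₀)
    rw [orbitPoly_natDegree (hk0 x₀)] at h3
    rw [← h2, ← h3, ← hw]
    have h4 : ∀ N : Matrix (Fin (Module.finrank F B)) (Fin (Module.finrank F B)) F,
        N.map (algebraMap F k) = (algebraMap F k).mapMatrix N :=
      fun _ => rfl
    rw [h4, h4, ← map_mul, ← map_mul, Units.mul_inv, map_one, map_one]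
  let ρ : Bˣ →* Matrix (Fin (Module.finrank F B)) (Fin (Module.finrank F B)) k :=
    ((algebraMap F k).mapMatrix.toMonoidHom.comp M.toRingHom.toMonoidHom).comp (Units.coeHom B)
  have hρ : Function.Injective ρ := by
    intro γ γ' h
    refine Units.ext (Algebra.leftMulMatrix_injective b ?_)
    ext i j
    exact (algebraMap F k).injective (congrFun (congrFun h i) j)
  let χ' : Bˣ →* ℂ := χ.toMonoidHom.comp (Units.coeHom B)
  let ψ := χ.toMonoidHom.comp cls
  let Z : ℕ → Finset K := fun a => if a = 0 then {0} else frobeniusFixed k K (a + a)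
  let x₁ : K := algebraMap k K x₀
  let val : ℕ → K → ℂ := fun a z => ψ (orbitPoly F (r * (a + a)) (x₁ + z))
  have hZc : ∀ a, (Z a).card = Fintype.card k ^ (a + a) := fun a => by
    by_cases ha : a = 0
    · simp [Z, ha]
    · simp only [Z, if_neg ha]; exact card_frobeniusFixed (by omega)
  have hZ : ∀ a, ∀ z ∈ Z a, z ^ Fintype.card k ^ (a + a) = z := fun a z hz => by
    by_cases ha : a = 0
    · simp [ha]
    · simp only [Z, if_neg ha] at hz; exact (mem_frobeniusFixed (by omega)).1 hz
  have hx₁ : ∀ a, x₁ ^ Fintype.card k ^ a = x₁ := fun a => by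
    simp only [x₁]; rw [← map_pow, FiniteField.pow_card_pow]
  have hv : ∀ a, n₀ ∣ a → ∀ z ∈ Z a, aeval z β.det ≠ 0 →
      ∃ γ, torsorNorm β (a + a) z = (ρ γ).map (algebraMap k K) ∧ val a z = χ' γ := by
    intro a ha z hz hdet
    have hx : (x₁ + z) ^ Fintype.card F ^ (r * (a + a)) = x₁ + z := by
      rw [pow_mul, ← hr]
      have h := add_pow_card_pow (F := k) x₁ z (a + a)
      rwa [hx₁, hZ a z hz] at h
    have hW : (M (w⁻¹ : Bˣ)) ^ (a + a) = 1 := by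
      obtain ⟨c, hc⟩ := hn₀.trans ha
      rw [← map_pow, ← Units.val_pow_eq_pow_val, hc, ← mul_add, pow_mul, pow_card_eq_one', one_pow,
        Units.val_one, map_one]
    have hcomm : ∀ y y' : B, Commute (M y) (M y') := fun y y' => (Commute.all y y').map M
    have hT : torsorNorm β (a + a) z =
        (M (cls (orbitPoly F (r * (a + a)) (x₁ + z)))).map (algebraMap F K) := by
      rw [torsorNorm_orbitMatrix (hcomm _ _) (hcomm _ _) (hcomm _ _) hr, ← map_orbitPoly hx]
      have h2 := map_leftMulMatrix_homEval (L := K) b u v (r * (a + a))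
        (orbitPoly F (r * (a + a)) (x₁ + z))
      have h3 := hcls _ (orbitPoly_monic (r * (a + a)) (x₁ + z))
      rw [orbitPoly_natDegree hx] at h3
      rw [← h3] at h2
      have h4 : ∀ N : Matrix (Fin (Module.finrank F B)) (Fin (Module.finrank F B)) F,
          N.map (algebraMap F K) = (algebraMap F K).mapMatrix N :=
        fun _ => rfl
      rw [← h2, h4 (M (w⁻¹ : Bˣ)), ← map_pow, hW, map_one, Matrix.mul_one]
    have hdet' := det_torsorNorm_ne_zero hdet (a + a)
    have hunit : IsUnit (cls (orbitPoly F (r * (a + a)) (x₁ + z))) := by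
      refine isUnit_of_det_leftMulMatrix_ne_zero b fun h0 => hdet' ?_
      rw [hT]
      exact ((algebraMap F K).map_det _).symm.trans ((congrArg _ h0).trans (map_zero _))
    obtain ⟨γ, hγ⟩ := hunit
    refine ⟨γ, ?_, ?_⟩
    · rw [hT, ← hγ]
      ext i j
      exact IsScalarTower.algebraMap_apply F k K _
    · exact congrArg χ hγ.symm
  have hsum : ∀ a, a ≠ 0 → ∑ z ∈ Z a, val a z = powerSum K ψ (r * (a + a)) := by
    intro a ha
    have ha2 : a + a ≠ 0 := by omega
    have hra : r * (a + a) ≠ 0 := Nat.mul_ne_zero hr0 ha2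
    simp only [Z, if_neg ha, val, powerSum]
    refine Finset.sum_bij' (fun z _ => x₁ + z) (fun x _ => x - x₁) ?_ ?_ ?_ ?_ ?_
    · intro z hz
      rw [mem_frobeniusFixed ha2] at hz
      rw [mem_frobeniusFixed hra, pow_mul, ← hr, add_pow_card_pow (F := k), hx₁, hz]
    · intro x hx
      rw [mem_frobeniusFixed hra, pow_mul, ← hr] at hx
      rw [mem_frobeniusFixed ha2, ← add_right_inj x₁]
      have h := add_pow_card_pow (F := k) x₁ (x - x₁) (a + a)
      rw [hx₁, add_sub_cancel, hx] at h
      rw [← h, add_sub_cancel]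
    · intros; simp
    · intros; simp
    · intros; rfl
  rcases torsor_dichotomy hβ hρ (χ := χ') (fun γ => norm_mulChar_le_one χ γ) n₀ Z val hZc hZ
    (fun a z => norm_mulChar_le_one χ _) hv with ⟨C, A, h⟩ | ⟨C, h⟩
  · refine Or.inl ⟨C, A + 1, fun a ha hd => ?_⟩
    have := h a (by omega) hd
    rwa [hsum a (by omega), hr] at this
  · refine Or.inr ⟨C, fun a ha hd => ?_⟩
    have := h a hd
    rwa [hsum a ha, hr] at this

end

section LogarithmicDerivative

theorem powerSeries_mk_mul_one_sub (α : ℂ) :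
    PowerSeries.mk (fun j => if j = 0 then 0 else α ^ j) * (1 - PowerSeries.C α * PowerSeries.X) =
      PowerSeries.C α * PowerSeries.X := by
  ext n
  rw [mul_sub, mul_one, mul_comm (PowerSeries.C α), ← mul_assoc, map_sub, PowerSeries.coeff_mul_C,
    PowerSeries.coeff_mul_C]
  rcases n with - | n
  · simp
  · rw [PowerSeries.coeff_succ_mul_X, PowerSeries.coeff_mk, PowerSeries.coeff_mk,
      if_neg n.succ_ne_zero, PowerSeries.coeff_X]
    rcases n with - | n
    · simp
    · simp [pow_succ]

theorem X_mul_derivative_prod (s : Multiset ℂ) :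
    PowerSeries.X * PowerSeries.derivative ℂ
        (s.map fun α => 1 - PowerSeries.C α * PowerSeries.X).prod =
      -(s.map fun α => PowerSeries.mk fun j => if j = 0 then 0 else α ^ j).sum *
        (s.map fun α => 1 - PowerSeries.C α * PowerSeries.X).prod := by
  induction s using Multiset.induction with
  | empty => simp
  | cons α s ih =>
    rw [Multiset.map_cons, Multiset.prod_cons, Multiset.map_cons, Multiset.sum_cons,
      Derivation.leibniz, smul_eq_mul, smul_eq_mul]
    have h1 : PowerSeries.derivative ℂ (1 - PowerSeries.C α * PowerSeries.X) =
        -PowerSeries.C α := by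
      rw [map_sub, Derivation.map_one_eq_zero, Derivation.leibniz, PowerSeries.derivative_C,
        PowerSeries.derivative_X]
      simp
    rw [h1]
    linear_combination (1 - PowerSeries.C α * PowerSeries.X) * ih +
      (s.map fun α => 1 - PowerSeries.C α * PowerSeries.X).prod * powerSeries_mk_mul_one_sub α

theorem X_mul_derivative_mk_eq_iff (S c : ℕ → ℂ) :
    PowerSeries.X * PowerSeries.derivative ℂ (PowerSeries.mk c) =
      PowerSeries.mk (fun j => if j = 0 then 0 else S j) * PowerSeries.mk c ↔
    ∀ n : ℕ, (n : ℂ) * c n = ∑ j ∈ Finset.Icc 1 n, S j * c (n - j) := by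
  rw [PowerSeries.ext_iff]
  refine forall_congr' fun n => ?_
  have hl : PowerSeries.coeff n (PowerSeries.X * PowerSeries.derivative ℂ (PowerSeries.mk c)) =
      n * c n := by
    cases n with
    | zero => simp
    | succ n =>
      rw [PowerSeries.coeff_succ_X_mul, PowerSeries.coeff_derivative, PowerSeries.coeff_mk]
      push_cast; ring
  rw [hl, PowerSeries.coeff_mul, Finset.Nat.sum_antidiagonal_eq_sum_range_succ_mk,
    Finset.sum_range_succ', Finset.range_eq_Ico]
  simp only [PowerSeries.coeff_mk, if_true, zero_mul, add_zero]
  rw [Finset.sum_Ico_add' (fun j => (if j = 0 then 0 else S j) * c (n - j)) 0 n 1]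
  refine Eq.congr_right (Finset.sum_congr (by ext; simp) fun j hj => ?_)
  rw [Finset.mem_Icc] at hj
  rw [if_neg (by omega)]

theorem exists_eq_prod_one_sub {P : ℂ[X]} (hP : P.coeff 0 = 1) :
    P = (P.roots.map fun ρ => 1 - C ρ⁻¹ * X).prod := by
  have h1 := (IsAlgClosed.splits P).eq_prod_roots
  have h0 : P ≠ 0 := fun h => by simp [h] at hP
  have hr : ∀ ρ ∈ P.roots, ρ ≠ 0 := fun ρ hρ h => by
    rw [mem_roots h0, h, IsRoot, ← coeff_zero_eq_eval_zero, hP] at hρ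
    exact one_ne_zero hρ
  have h2 : (P.roots.map fun ρ => X - C ρ).prod =
      (P.roots.map fun ρ => C (-ρ)).prod * (P.roots.map fun ρ => 1 - C ρ⁻¹ * X).prod := by
    rw [← Multiset.prod_map_mul]
    congr 1
    refine Multiset.map_congr rfl fun ρ hρ => ?_
    have h3 : C (-ρ) * C ρ⁻¹ = (-1 : ℂ[X]) := by
      rw [← C_mul, neg_mul, mul_inv_cancel₀ (hr ρ hρ), C_neg, C_1]
    rw [mul_sub, ← mul_assoc, h3, C_neg]; ring
  rw [h2, ← mul_assoc] at h1
  have h4 : ∃ a : ℂ, C P.leadingCoeff * (P.roots.map fun ρ => C (-ρ)).prod = C a :=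
    ⟨P.leadingCoeff * (P.roots.map fun ρ => -ρ).prod, by
      rw [C_mul, ← Multiset.prod_hom _ (C : ℂ →+* ℂ[X]), Multiset.map_map]; rfl⟩
  obtain ⟨a, ha⟩ := h4
  rw [ha] at h1
  have h5 := congrArg (eval 0) h1
  rw [eval_mul, eval_C, ← coeff_zero_eq_eval_zero, hP, eval_multiset_prod, Multiset.map_map] at h5
  simp at h5
  rw [← h5, C_1, one_mul] at h1
  exact h1

theorem exists_eq_neg_sum_pow {c S : ℕ → ℂ} (h0 : c 0 = 1) {D : ℕ} (hD : ∀ n, D < n → c n = 0)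
    (h : ∀ n : ℕ, (n : ℂ) * c n = ∑ j ∈ Finset.Icc 1 n, S j * c (n - j)) :
    ∃ N, N ≤ D ∧ ∃ α : Fin N → ℂ, ∀ n, 1 ≤ n → S n = -∑ i, α i ^ n := by
  let P : ℂ[X] := ∑ i ∈ Finset.range (D + 1), monomial i (c i)
  have hP : ∀ n, P.coeff n = c n := fun n => by
    simp only [P, finsetSum_coeff, coeff_monomial]
    rw [Finset.sum_ite_eq']
    split_ifs with hn
    · rfl
    · exact (hD n (by simpa [Nat.lt_succ_iff] using hn)).symm
  have hdeg : P.natDegree ≤ D := natDegree_le_iff_coeff_eq_zero.2 fun n hn => by rw [hP, hD n hn]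
  have hprod := exists_eq_prod_one_sub (P := P) (by rw [hP, h0])
  let s : Multiset ℂ := P.roots.map (·⁻¹)
  let L : PowerSeries ℂ := (P : PowerSeries ℂ)
  have hL : L = (s.map fun α => 1 - PowerSeries.C α * PowerSeries.X).prod := by
    have h1 : L = Polynomial.coeToPowerSeries.ringHom P := rfl
    rw [h1, hprod, map_multiset_prod, Multiset.map_map, Multiset.map_map]
    congr 1
    refine Multiset.map_congr rfl fun ρ _ => ?_
    simp
  have hL0 : L ≠ 0 := fun h1 => by
    have := congrArg (PowerSeries.coeff 0) h1
    rw [Polynomial.coeff_coe, hP, h0] at this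
    simp at this
  let S' : PowerSeries ℂ := PowerSeries.mk fun j => if j = 0 then 0 else S j
  have hS : PowerSeries.X * PowerSeries.derivative ℂ L = S' * L := by
    have hLc : L = PowerSeries.mk c := by
      ext n; rw [Polynomial.coeff_coe, hP, PowerSeries.coeff_mk]
    rw [hLc]
    exact (X_mul_derivative_mk_eq_iff S c).2 h
  have hT := X_mul_derivative_prod s
  rw [← hL, hS] at hT
  have hST := mul_right_cancel₀ hL0 hT
  refine ⟨s.toList.length, ?_, fun i => s.toList[i], fun n hn => ?_⟩
  · rw [Multiset.length_toList, Multiset.card_map]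
    exact (card_roots' P).trans hdeg
  · have h2 := congrArg (PowerSeries.coeff n) hST
    rw [PowerSeries.coeff_mk, if_neg (by omega), map_neg, map_multiset_sum, Multiset.map_map] at h2
    rw [h2]
    refine congrArg Neg.neg (Eq.trans ?_ (Fin.sum_univ_fun_getElem s.toList (· ^ n)).symm)
    rw [← Multiset.sum_coe, ← Multiset.map_coe,
      Multiset.coe_toList]
    congr 1
    refine Multiset.map_congr rfl fun α _ => ?_
    rw [Function.comp, PowerSeries.coeff_mk, if_neg (by omega)]

end LogarithmicDerivative

section RiemannHypothesis

variable {F K : Type*} [Field F] [Fintype F] [Field K] [Algebra F K] [IsAlgClosed K]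
  [Algebra.IsAlgebraic F K]

theorem powerSum_dichotomy {B : Type*} [CommRing B] [Algebra F B] [Module.Finite F B]
    (cls : F[X] →* B) {u v : B}
    (hcls : ∀ f : F[X], f.Monic → cls f = homEval u v f.natDegree f)
    {x₀ : K} (hx₀ : IsUnit (cls (minpoly F x₀))) (χ : MulChar B ℂ) :
    ∃ r n₀ : ℕ, 0 < r ∧ 0 < n₀ ∧
    ((∃ C : ℝ, ∃ A : ℕ, ∀ a, A ≤ a → n₀ ∣ a →
      ‖powerSum K (χ.toMonoidHom.comp cls) (r * (a + a))‖ ≤ C * (Fintype.card F ^ r : ℕ) ^ a) ∨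
    (∃ C : ℝ, ∀ a, a ≠ 0 → n₀ ∣ a →
      ‖powerSum K (χ.toMonoidHom.comp cls) (r * (a + a)) - (Fintype.card F ^ r : ℕ) ^ (a + a)‖
        ≤ C)) := by
  have : Finite B := Module.finite_of_finite F
  have hintegral : IsIntegral F x₀ := Algebra.IsIntegral.isIntegral x₀
  have : FiniteDimensional F (IntermediateField.adjoin F {x₀}) :=
    IntermediateField.adjoin.finiteDimensional hintegral
  have : Finite (IntermediateField.adjoin F {x₀}) := Module.finite_of_finite F
  have := Fintype.ofFinite (IntermediateField.adjoin F {x₀})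
  refine ⟨_, Nat.card Bˣ, Module.finrank_pos (R := F) (M := IntermediateField.adjoin F {x₀}),
    Nat.card_pos, ?_⟩
  refine powerSum_dichotomy_of_finite_extension (k := IntermediateField.adjoin F {x₀}) cls hcls
    (x₀ := IntermediateField.AdjoinSimple.gen F x₀) ?_ χ dvd_rfl Module.card_eq_pow_finrank
    Module.finrank_pos.ne'
  rwa [IntermediateField.minpoly_gen]

theorem norm_powerSum_le {B : Type*} [CommRing B] [Algebra F B] [Module.Finite F B]
    (cls : F[X] →* B) {u v : B}
    (hcls : ∀ f : F[X], f.Monic → cls f = homEval u v f.natDegree f)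
    {x₀ : K} (hx₀ : IsUnit (cls (minpoly F x₀))) (χ : MulChar B ℂ) {D : ℕ}
    (hD : ∀ n, D < n → lCoeff (χ.toMonoidHom.comp cls) n = 0) {n : ℕ} (hn : 1 ≤ n) :
    ‖powerSum K (χ.toMonoidHom.comp cls) n‖ ≤ D * √(Fintype.card F) ^ n := by
  have h0 : lCoeff (χ.toMonoidHom.comp cls) 0 = 1 := by
    rw [lCoeff, monicsOfDegree_zero, Finset.sum_singleton, map_one]
  obtain ⟨N, hN, α, hα⟩ := exists_eq_neg_sum_pow h0 hD (natCast_mul_lCoeff K _)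
  have hq : (1 : ℝ) < Fintype.card F := by exact_mod_cast Fintype.one_lt_card
  suffices hα' : ∀ i, ‖α i‖ ≤ √(Fintype.card F) by
    rw [hα n hn, norm_neg]
    refine (norm_sum_le _ _).trans ?_
    calc ∑ i, ‖α i ^ n‖ ≤ ∑ i : Fin N, √(Fintype.card F) ^ n :=
          Finset.sum_le_sum fun i _ => by
            rw [norm_pow]; exact pow_le_pow_left₀ (norm_nonneg _) (hα' i) n
      _ = N * √(Fintype.card F) ^ n := by simp
      _ ≤ D * √(Fintype.card F) ^ n := by gcongr
  obtain ⟨r, n₀, hr, hn₀, ⟨C, A, h⟩ | ⟨C, h⟩⟩ := powerSum_dichotomy cls hcls hx₀ χ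
  · intro i
    have h1 := norm_le_of_norm_sum_pow_le (fun i => α i ^ r) (r := √(Fintype.card F) ^ r) (C := C)
      (by positivity) (A := A + 1) hn₀ (fun a ha hd => ?_) i
    · rw [norm_pow] at h1
      exact (pow_le_pow_iff_left₀ (norm_nonneg _) (Real.sqrt_nonneg _) hr.ne').1 h1
    · have h2 := h a (by omega) hd
      rw [hα _ (Nat.mul_pos hr (by omega)), norm_neg] at h2
      have h3 : √(Fintype.card F : ℝ) ^ r ^ 1 * √(Fintype.card F) ^ r = Fintype.card F ^ r := by
        rw [pow_one, ← mul_pow, Real.mul_self_sqrt (by positivity)]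
      rw [pow_one] at h3
      rw [pow_add (√(Fintype.card F : ℝ) ^ r), ← mul_pow, h3]
      simpa only [← pow_mul, Nat.cast_pow] using h2
  · exfalso
    have h1 := norm_le_of_norm_sum_pow_le
      (fun i : Option (Fin N) => i.elim ((Fintype.card F : ℂ) ^ r) fun i => α i ^ r) (r := 1)
      (C := C) one_pos (A := 1) hn₀ (fun a ha hd => ?_) none
    · rw [Option.elim_none, norm_pow, Complex.norm_natCast] at h1
      exact absurd h1 (not_le.2 (one_lt_pow₀ hq hr.ne'))
    · have h2 := h a (by omega) hd
      rw [hα _ (Nat.mul_pos hr (by omega)), ← norm_neg] at h2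
      rw [Fintype.sum_option, one_pow, mul_one]
      refine le_of_eq_of_le (congrArg _ ?_) h2
      simp only [Option.elim_none, Option.elim_some, ← pow_mul, Nat.cast_pow]
      ring

end RiemannHypothesis

section ClassMap

variable {F : Type*} [Field F]

theorem AdjoinRoot.isUnit_mk_iff {g f : F[X]} : IsUnit (AdjoinRoot.mk g f) ↔ IsCoprime f g := by
  constructor
  · intro h
    obtain ⟨b, hb⟩ := h.exists_right_inv
    obtain ⟨b, rfl⟩ := AdjoinRoot.mk_surjective b
    rw [← map_mul, ← map_one (AdjoinRoot.mk g), AdjoinRoot.mk_eq_mk] at hb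
    obtain ⟨c, hc⟩ := hb
    exact ⟨b, -c, by linear_combination hc⟩
  · rintro ⟨a, b, h⟩
    refine IsUnit.of_mul_eq_one (AdjoinRoot.mk g a) ?_
    rw [← map_mul, ← map_one (AdjoinRoot.mk g), AdjoinRoot.mk_eq_mk]
    exact ⟨-b, by linear_combination h⟩

/-- The ring of residues modulo `g` together with the `s` coefficients below the leading one. -/
abbrev ClassRing (g : F[X]) (s : ℕ) : Type _ := AdjoinRoot g × AdjoinRoot (X ^ (s + 1) : F[X])

/-- The class of a polynomial modulo `g` together with its top coefficients. -/
noncomputable def classMap (g : F[X]) (s : ℕ) : F[X] →* ClassRing g s where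
  toFun f := (AdjoinRoot.mk g f, AdjoinRoot.mk _ f.reverse)
  map_one' := by rw [← C_1, reverse_C, C_1, map_one, map_one]; rfl
  map_mul' f₁ f₂ := by rw [reverse_mul_of_domain, map_mul, map_mul]; rfl

theorem classMap_apply (g : F[X]) (s : ℕ) (f : F[X]) :
    classMap g s f = (AdjoinRoot.mk g f, AdjoinRoot.mk _ f.reverse) := rfl

theorem classMap_eq_homEval (g : F[X]) (s : ℕ) (f : F[X]) :
    classMap g s f =
      homEval (AdjoinRoot.root g, 1) (1, AdjoinRoot.root (X ^ (s + 1) : F[X])) f.natDegree f := by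
  have h1 : AdjoinRoot.mk g f =
      ∑ i ∈ Finset.range (f.natDegree + 1), f.coeff i • AdjoinRoot.root g ^ i := by
    rw [← AdjoinRoot.aeval_eq, aeval_eq_sum_range]
  have h2 : AdjoinRoot.mk (X ^ (s + 1)) f.reverse = ∑ i ∈ Finset.range (f.natDegree + 1),
      f.coeff i • AdjoinRoot.root (X ^ (s + 1) : F[X]) ^ (f.natDegree - i) := by
    rw [← AdjoinRoot.aeval_eq, aeval_eq_sum_range' (Nat.lt_succ_of_le (reverse_natDegree_le f)),
      ← Finset.sum_range_reflect]
    refine Finset.sum_congr rfl fun i hi => ?_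
    rw [Finset.mem_range] at hi
    rw [coeff_reverse, revAt_le (by omega)]
    congr 2
    omega
  rw [classMap_apply, homEval, Prod.ext_iff, Prod.fst_sum, Prod.snd_sum, h1, h2]
  constructor
  · dsimp only
    refine Finset.sum_congr rfl fun i _ => ?_
    simp
  · dsimp only
    refine Finset.sum_congr rfl fun i _ => ?_
    simp

theorem isUnit_classMap {g f : F[X]} {s : ℕ} (hf : f ≠ 0) :
    IsUnit (classMap g s f) ↔ IsCoprime f g := by
  rw [classMap_apply, Prod.isUnit_iff, AdjoinRoot.isUnit_mk_iff, AdjoinRoot.isUnit_mk_iff,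
    and_iff_left]
  refine IsCoprime.pow_right (IsCoprime.symm (irreducible_X.coprime_iff_not_dvd.2 ?_))
  rw [X_dvd_iff, coeff_zero_reverse, leadingCoeff_eq_zero]
  exact hf

theorem dvd_sub_of_classMap_eq {g f₁ f₂ : F[X]} {s : ℕ} (h : classMap g s f₁ = classMap g s f₂) :
    g ∣ f₁ - f₂ := by
  rw [classMap_apply, classMap_apply, Prod.ext_iff] at h
  exact AdjoinRoot.mk_eq_mk.1 h.1

theorem coeff_eq_of_classMap_eq {g f₁ f₂ : F[X]} {s n : ℕ} (h₁ : f₁.natDegree = n)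
    (h₂ : f₂.natDegree = n) (h : classMap g s f₁ = classMap g s f₂) {i : ℕ} (hi : i ≤ n)
    (his : n ≤ i + s) : f₁.coeff i = f₂.coeff i := by
  rw [classMap_apply, classMap_apply, Prod.ext_iff] at h
  have h3 := X_pow_dvd_iff.1 (AdjoinRoot.mk_eq_mk.1 h.2) (n - i) (by omega)
  rw [coeff_sub, coeff_reverse, coeff_reverse, h₁, h₂, revAt_le (by omega), Nat.sub_sub_self hi,
    sub_eq_zero] at h3
  exact h3

variable [Fintype F]

theorem exists_mem_monicsOfDegree_classMap_eq {g : F[X]} (hg : g.Monic) {s n : ℕ}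
    (hn : g.natDegree + s ≤ n) {f : F[X]} (hf : f.Monic) :
    ∃ f' ∈ monicsOfDegree F n, classMap g s f' = classMap g s f := by
  set b : F[X] := f.reverse %ₘ X ^ (s + 1) with hb
  have hX : (X ^ (s + 1) : F[X]).Monic := monic_X_pow _
  have hbdvd : X ^ (s + 1) ∣ f.reverse - b := by
    refine ⟨f.reverse /ₘ X ^ (s + 1), ?_⟩
    rw [sub_eq_iff_eq_add, add_comm]; exact (modByMonic_add_div _ _).symm
  have hbdeg : b.natDegree ≤ s := by
    have h := natDegree_modByMonic_lt f.reverse hX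
      (fun h => by simpa using congrArg natDegree h)
    rw [natDegree_X_pow] at h
    exact Nat.lt_succ_iff.1 h
  have hb0 : b.coeff 0 = 1 := by
    have h := X_pow_dvd_iff.1 hbdvd 0 (by omega)
    rw [coeff_sub, coeff_zero_reverse, hf.leadingCoeff, sub_eq_zero] at h
    exact h.symm
  set e : F[X] := (reflect n b - f) %ₘ g with he
  have hec : ∀ i, g.natDegree ≤ i → e.coeff i = 0 := fun i hi =>
    coeff_eq_zero_of_degree_lt ((degree_modByMonic_lt _ hg).trans_le
      (degree_le_natDegree.trans (by exact_mod_cast hi)))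
  have hedvd : g ∣ reflect n b - f - e := by
    refine ⟨(reflect n b - f) /ₘ g, ?_⟩
    rw [sub_eq_iff_eq_add, add_comm]; exact (modByMonic_add_div _ _).symm
  have hrdeg : (reflect n b).natDegree ≤ n := by
    rw [natDegree_le_iff_coeff_eq_zero]
    intro i hi
    rw [coeff_reflect, revAt_eq_self_of_lt hi]
    exact coeff_eq_zero_of_natDegree_lt (by omega)
  by_cases hn0 : n = 0
  · refine ⟨1, ?_, ?_⟩
    · rw [mem_monicsOfDegree]; exact ⟨monic_one, by simp [hn0]⟩
    · have hs : s = 0 := by omega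
      have hg1 : g = 1 := hg.natDegree_eq_zero.1 (by omega)
      rw [classMap_apply, classMap_apply, Prod.mk.injEq, AdjoinRoot.mk_eq_mk, AdjoinRoot.mk_eq_mk]
      refine ⟨by rw [hg1]; exact one_dvd _, ?_⟩
      rw [hs, zero_add, pow_one, X_dvd_iff, coeff_sub, coeff_zero_reverse, coeff_zero_reverse,
        hf.leadingCoeff, leadingCoeff_one, sub_self]
  have hcn : (reflect n b - e).coeff n = 1 := by
    rw [coeff_sub, coeff_reflect, revAt_le le_rfl, Nat.sub_self, hb0, hec n (by omega), sub_zero]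
  have hd : (reflect n b - e).natDegree ≤ n := by
    rw [natDegree_le_iff_coeff_eq_zero]
    intro i hi
    rw [coeff_sub, coeff_eq_zero_of_natDegree_lt (by omega), hec i (by omega), sub_zero]
  have hm := monic_of_natDegree_le_of_coeff_eq_one n hd hcn
  have hdn : (reflect n b - e).natDegree = n :=
    le_antisymm hd (le_natDegree_of_ne_zero (by rw [hcn]; exact one_ne_zero))
  refine ⟨reflect n b - e, mem_monicsOfDegree.2 ⟨hm, hdn⟩, ?_⟩
  rw [classMap_apply, classMap_apply, Prod.mk.injEq, AdjoinRoot.mk_eq_mk, AdjoinRoot.mk_eq_mk]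
  refine ⟨by convert hedvd using 1; ring, X_pow_dvd_iff.2 fun i hi => ?_⟩
  have h1 := X_pow_dvd_iff.1 hbdvd i hi
  rw [coeff_sub] at h1 ⊢
  rw [coeff_reverse, hdn, revAt_le (by omega), coeff_sub, hec _ (by omega), coeff_reflect,
    revAt_le (Nat.sub_le _ _), Nat.sub_sub_self (by omega)]
  linear_combination -h1

theorem lCoeff_eq_zero {B : Type*} [CommRing B] [Algebra F B] [Module.Finite F B]
    (cls : F[X] →* B) {u v : B} (hcls : ∀ f : F[X], f.Monic → cls f = homEval u v f.natDegree f)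
    (χ : MulChar B ℂ) {n : ℕ}
    (hn : ∀ f : F[X], f.Monic → ∃ f' ∈ monicsOfDegree F n, cls f' = cls f)
    {f₀ : F[X]} (hf₀ : f₀.Monic) (hu : IsUnit (cls f₀)) (hχ : χ (cls f₀) ≠ 1) :
    lCoeff (χ.toMonoidHom.comp cls) n = 0 := by
  classical
  have : Finite B := Module.finite_of_finite F
  have := Fintype.ofFinite B
  set L : (Fin n → F) →+ B :=
    { toFun := fun x => ∑ i, x i • (u ^ (i : ℕ) * v ^ (n - i))
      map_zero' := by simp
      map_add' := fun x y => by simp [add_smul, Finset.sum_add_distrib] } with hL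
  have hLx : ∀ x, cls (monicPoly F n x) = u ^ n + L x := by
    intro x
    rw [hcls _ (monic_monicPoly n x), natDegree_monicPoly, homEval, Finset.sum_range_succ, add_comm,
      Finset.sum_range]
    have h1 : (monicPoly F n x).coeff n = 1 := by
      have := (monic_monicPoly n x).coeff_natDegree
      rwa [natDegree_monicPoly] at this
    rw [h1, one_smul, Nat.sub_self, pow_zero, mul_one]
    congr 1
    exact Finset.sum_congr rfl fun i _ => by rw [coeff_monicPoly]
  have hex : ∀ f : F[X], f.Monic → ∃ x, u ^ n + L x = cls f := by
    intro f hf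
    obtain ⟨f', hf', h⟩ := hn f hf
    rw [mem_monicsOfDegree] at hf'
    refine ⟨fun i => f'.coeff i, ?_⟩
    rw [← hLx, monicPoly_coeff hf'.1 hf'.2, h]
  set N : B → ℕ := fun γ => Finset.card {x | L x = γ - u ^ n} with hN
  have hNeq : ∀ γ, N γ = N (γ * cls f₀) := by
    intro γ
    by_cases h : ∃ x, u ^ n + L x = γ
    · obtain ⟨x, hx⟩ := h
      obtain ⟨y, hy⟩ := hex _ ((monic_monicPoly n x).mul hf₀)
      rw [map_mul, hLx, hx] at hy
      exact AddMonoidHom.card_fiber_eq_of_mem_range L ⟨x, by rw [← hx]; ring⟩ ⟨y, by rw [← hy]; ring⟩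
    · have h0 : N γ = 0 := by
        rw [hN, Finset.card_eq_zero, Finset.filter_eq_empty_iff]
        intro x _ hx
        exact h ⟨x, by rw [hx]; ring⟩
      rw [h0, eq_comm, hN, Finset.card_eq_zero, Finset.filter_eq_empty_iff]
      intro x _ hx
      obtain ⟨w, hw⟩ := hu
      refine h ?_
      have hfin : 0 < orderOf w := orderOf_pos w
      obtain ⟨y, hy⟩ := hex (monicPoly F n x * f₀ ^ (orderOf w - 1))
        ((monic_monicPoly n x).mul (hf₀.pow _))
      refine ⟨y, hy.trans ?_⟩
      rw [map_mul, hLx, hx, map_pow, add_sub_cancel, mul_assoc, ← hw, ← pow_succ',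
        Nat.sub_add_cancel hfin, ← Units.val_pow_eq_pow_val, pow_orderOf_eq_one, Units.val_one,
        mul_one]
  have hT : lCoeff (χ.toMonoidHom.comp cls) n = ∑ γ, (N γ : ℂ) * χ γ := by
    rw [lCoeff, sum_monicsOfDegree, ← Finset.sum_fiberwise (s := Finset.univ)
      (g := fun x => cls (monicPoly F n x))]
    refine Finset.sum_congr rfl fun γ _ => ?_
    rw [hN, Finset.sum_congr rfl (g := fun _ => χ γ), Finset.sum_const, nsmul_eq_mul]
    · congr 4
      ext x
      simp only [hLx]
      rw [eq_sub_iff_add_eq, add_comm]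
    · intro x hx
      rw [← (Finset.mem_filter.1 hx).2]; rfl
  have h2 : lCoeff (χ.toMonoidHom.comp cls) n =
      lCoeff (χ.toMonoidHom.comp cls) n * χ (cls f₀) := by
    conv_lhs => rw [hT]
    rw [hT, Finset.sum_mul]
    obtain ⟨w, hw⟩ := hu
    rw [← Equiv.sum_comp (Units.mulRight w)]
    refine Finset.sum_congr rfl fun γ _ => ?_
    rw [Units.mulRight_apply, hw, ← hNeq, map_mul, mul_assoc]
  by_contra h
  exact hχ (mul_left_cancel₀ h (by rw [mul_one]; exact h2.symm))

end ClassMap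

section Growth

theorem sum_range_le_choose {b : ℕ → ℝ} {τ : ℕ} (h0 : b 0 ≤ 1)
    (h : ∀ n : ℕ, n * b n ≤ τ * ∑ i ∈ Finset.range n, b i) (n : ℕ) :
    ∑ i ∈ Finset.range (n + 1), b i ≤ (n + τ).choose n := by
  induction n with
  | zero => simpa using h0
  | succ n ih =>
    have h1 := h (n + 1)
    have h2 : ((n + 1 + τ).choose (n + 1) : ℝ) * (n + 1 : ℕ) =
        (n + τ + 1 : ℕ) * (n + τ).choose n := by
      rw [show n + 1 + τ = n + τ + 1 by ring]
      exact_mod_cast (Nat.add_one_mul_choose_eq (n + τ) n).symm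
    rw [Finset.sum_range_succ]
    have hpos : (0 : ℝ) < (n + 1 : ℕ) := by positivity
    refine le_of_mul_le_mul_right ?_ hpos
    rw [h2]
    calc (∑ i ∈ Finset.range (n + 1), b i + b (n + 1)) * (n + 1 : ℕ)
        ≤ (n + τ + 1 : ℕ) * ∑ i ∈ Finset.range (n + 1), b i := by push_cast at h1 ⊢; linarith
      _ ≤ _ := by gcongr

theorem choose_mul_pow_le_one {η : ℝ} (h0 : 0 ≤ η) (h1 : η ≤ 1) (n τ : ℕ) :
    ((n + τ).choose n : ℝ) * ((1 - η) ^ n * η ^ τ) ≤ 1 := by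
  have h := add_pow (1 - η) η (n + τ)
  rw [sub_add_cancel, one_pow] at h
  have h2 : ∀ i ∈ Finset.range (n + τ + 1),
      0 ≤ (1 - η) ^ i * η ^ (n + τ - i) * ((n + τ).choose i : ℝ) := fun i _ =>
    mul_nonneg (mul_nonneg (pow_nonneg (by linarith) _) (pow_nonneg h0 _)) (by positivity)
  have h3 := Finset.single_le_sum h2 (Finset.mem_range.2 (show n < n + τ + 1 by omega))
  rw [Nat.add_sub_cancel_left] at h3
  calc _ = (1 - η) ^ n * η ^ τ * ((n + τ).choose n : ℝ) := by ring
    _ ≤ 1 := h3.trans_eq h.symm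

theorem norm_le_of_recurrence {a E : ℕ → ℂ} {r η : ℝ} {τ : ℕ} (hr : 0 < r) (hη0 : 0 < η)
    (hη1 : η < 1) (h0 : a 0 = 1)
    (h : ∀ n : ℕ, n * a n = -∑ j ∈ Finset.Icc 1 n, E j * a (n - j))
    (hE : ∀ j, 1 ≤ j → ‖E j‖ * r ^ j ≤ τ) (n : ℕ) :
    ‖a n‖ * (r ^ n * (1 - η) ^ n * η ^ τ) ≤ 1 := by
  have hrec : ∀ n : ℕ, n * (‖a n‖ * r ^ n) ≤ τ * ∑ i ∈ Finset.range n, ‖a i‖ * r ^ i := by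
    intro n
    have h1 : (n : ℝ) * ‖a n‖ ≤ ∑ j ∈ Finset.Icc 1 n, ‖E j‖ * ‖a (n - j)‖ := by
      rw [← Complex.norm_natCast n, ← norm_mul, h, norm_neg]
      exact (norm_sum_le _ _).trans_eq (Finset.sum_congr rfl fun _ _ => norm_mul _ _)
    calc n * (‖a n‖ * r ^ n) = n * ‖a n‖ * r ^ n := by ring
      _ ≤ (∑ j ∈ Finset.Icc 1 n, ‖E j‖ * ‖a (n - j)‖) * r ^ n := by gcongr
      _ = ∑ j ∈ Finset.Icc 1 n, (‖E j‖ * r ^ j) * (‖a (n - j)‖ * r ^ (n - j)) := by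
          rw [Finset.sum_mul]
          refine Finset.sum_congr rfl fun j hj => ?_
          rw [Finset.mem_Icc] at hj
          rw [← pow_mul_pow_sub r hj.2]; ring
      _ ≤ ∑ j ∈ Finset.Icc 1 n, τ * (‖a (n - j)‖ * r ^ (n - j)) :=
          Finset.sum_le_sum fun j hj => by
            gcongr; exact hE j (Finset.mem_Icc.1 hj).1
      _ = τ * ∑ i ∈ Finset.range n, ‖a i‖ * r ^ i := by
          rw [← Finset.mul_sum]
          congr 1
          rw [← Finset.sum_range_reflect, Finset.range_eq_Ico, Finset.sum_Ico_eq_sum_range,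
            ← Finset.Ico_add_one_right_eq_Icc, Finset.sum_Ico_eq_sum_range]
          refine Finset.sum_congr rfl fun i _ => ?_
          rw [zero_add, Nat.sub_sub]
  have h1 := sum_range_le_choose (b := fun n => ‖a n‖ * r ^ n) (by simp [h0]) hrec n
  have h2 : ‖a n‖ * r ^ n ≤ ∑ i ∈ Finset.range (n + 1), ‖a i‖ * r ^ i :=
    Finset.single_le_sum (f := fun i => ‖a i‖ * r ^ i) (fun i _ => by positivity)
      (Finset.self_mem_range_succ n)
  have h3 := choose_mul_pow_le_one hη0.le hη1.le n τ
  have h4 : 0 ≤ (1 - η) ^ n * η ^ τ := mul_nonneg (pow_nonneg (by linarith) _) (by positivity)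
  calc ‖a n‖ * (r ^ n * (1 - η) ^ n * η ^ τ) = ‖a n‖ * r ^ n * ((1 - η) ^ n * η ^ τ) := by ring
    _ ≤ (n + τ).choose n * ((1 - η) ^ n * η ^ τ) := by gcongr; exact h2.trans h1
    _ ≤ 1 := h3

theorem exists_norm_le_of_recurrence {q ε : ℝ} (hq : 1 < q) (hε : 0 < ε) :
    ∃ C : ℝ, 0 ≤ C ∧ ∀ (N D : ℕ) (a E : ℕ → ℂ), D ≤ N → a 0 = 1 →
      (∀ n : ℕ, n * a n = -∑ j ∈ Finset.Icc 1 n, E j * a (n - j)) →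
      (∀ j, 1 ≤ j → ‖E j‖ ≤ q ^ j) → (∀ j, 1 ≤ j → ‖E j‖ ≤ D * √q ^ j) →
      ∀ n ≤ N, ‖a n‖ ≤ C * q ^ ((n : ℝ) / 2 + ε * N) := by
  have hq0 : 0 < q := by linarith
  obtain ⟨e, he, rfl⟩ : ∃ e, 0 < e ∧ ε = 3 * e := ⟨ε / 3, by positivity, by ring⟩
  set x : ℝ := q ^ (-e) with hx
  have hx0 : 0 < x := Real.rpow_pos_of_pos hq0 _
  have hx1 : x < 1 := Real.rpow_lt_one_of_one_lt_of_neg hq (by linarith)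
  set η : ℝ := 1 - x with hη
  have hη0 : 0 < η := by linarith
  have hη1 : η < 1 := by linarith
  have hη' : 1 < η⁻¹ := (one_lt_inv₀ hη0).2 hη1
  set δ : ℝ := e * Real.logb η⁻¹ q with hδ
  have hδ0 : 0 < δ := mul_pos he (Real.logb_pos hη' hq)
  have hδη : η⁻¹ ^ δ = q ^ e := by
    rw [hδ, mul_comm, Real.rpow_mul (by positivity),
      Real.rpow_logb (by positivity) hη'.ne' hq0]
  obtain ⟨k, hk⟩ := exists_pow_lt_of_lt_one hδ0 hx1
  refine ⟨η⁻¹ ^ (q ^ k + 1), by positivity, fun N D a E hDN h0 hrec hE1 hE2 n hn => ?_⟩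
  set τ : ℕ := ⌈q ^ k + δ * D⌉₊ with hτ
  have hτ1 : q ^ k + δ * D ≤ τ := Nat.le_ceil _
  have hτ2 : (τ : ℝ) ≤ q ^ k + 1 + δ * N := by
    have h1 : (τ : ℝ) < q ^ k + δ * D + 1 := Nat.ceil_lt_add_one (by positivity)
    have h2 : δ * D ≤ δ * N := by gcongr
    linarith
  have hsx : √q * (x / √q) = x := by field_simp
  have hs1 : 1 ≤ √q := Real.one_le_sqrt.2 hq.le
  have hr0 : 0 < x / √q := by positivity
  have hr1 : x / √q ≤ 1 := by rw [div_le_one (by positivity)]; linarith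
  have key := norm_le_of_recurrence (a := a) (E := E) (r := x / √q) (η := η) (τ := τ)
    hr0 hη0 hη1 h0 hrec (fun j hj => ?_) n
  · have h1 : (x / √q) ^ n * (1 - η) ^ n * η ^ τ =
        ((√q ^ n) * (q ^ e) ^ n * (q ^ e) ^ n * η⁻¹ ^ τ)⁻¹ := by
      have : x = (q ^ e)⁻¹ := Real.rpow_neg hq0.le e
      rw [show 1 - η = x by rw [hη]; ring, this]
      simp only [div_eq_mul_inv, mul_pow, mul_inv, inv_pow, inv_inv]
      ring
    rw [h1, ← div_eq_mul_inv, div_le_one (by positivity)] at key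
    refine key.trans ?_
    have h2 : η⁻¹ ^ τ ≤ η⁻¹ ^ (q ^ k + 1) * q ^ (e * N) := by
      rw [Real.rpow_mul hq0.le, ← hδη, ← Real.rpow_mul (by positivity), ← Real.rpow_natCast,
        ← Real.rpow_add (by positivity)]
      exact Real.rpow_le_rpow_of_exponent_le hη'.le hτ2
    have h3 : (q ^ e) ^ n ≤ q ^ (e * N) := by
      rw [← Real.rpow_natCast, ← Real.rpow_mul hq0.le]
      refine Real.rpow_le_rpow_of_exponent_le hq.le ?_
      gcongr
    have h4 : √q ^ n = q ^ ((n : ℝ) / 2) := by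
      rw [Real.sqrt_eq_rpow, ← Real.rpow_natCast, ← Real.rpow_mul hq0.le]
      congr 1; ring
    calc √q ^ n * (q ^ e) ^ n * (q ^ e) ^ n * η⁻¹ ^ τ
        ≤ √q ^ n * q ^ (e * N) * q ^ (e * N) * (η⁻¹ ^ (q ^ k + 1) * q ^ (e * N)) := by gcongr
      _ = η⁻¹ ^ (q ^ k + 1) * (q ^ ((n : ℝ) / 2) * q ^ (e * N) * q ^ (e * N) * q ^ (e * N)) := by
          rw [h4]; ring
      _ = _ := by
          rw [← Real.rpow_add hq0, ← Real.rpow_add hq0, ← Real.rpow_add hq0]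
          congr 2; ring
  · refine le_trans ?_ hτ1
    rcases le_total j k with hjk | hjk
    · calc ‖E j‖ * (x / √q) ^ j ≤ q ^ j * 1 := by
            gcongr
            · exact hE1 j hj
            · exact pow_le_one₀ hr0.le hr1
        _ ≤ q ^ k := by rw [mul_one]; exact pow_le_pow_right₀ hq.le hjk
        _ ≤ _ := le_add_of_nonneg_right (by positivity)
    · calc ‖E j‖ * (x / √q) ^ j ≤ D * √q ^ j * (x / √q) ^ j := by gcongr; exact hE2 j hj
        _ = x ^ j * D := by rw [mul_assoc, ← mul_pow, hsx, mul_comm]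
        _ ≤ x ^ k * D := by gcongr ?_ * _; exact pow_le_pow_of_le_one hx0.le hx1.le hjk
        _ ≤ δ * D := by gcongr
        _ ≤ _ := le_add_of_nonneg_left (by positivity)

end Growth

section Principal

theorem exists_recurrence_of_pow_add {q : ℂ} {m E : ℕ → ℂ} (h0 : m 0 = 1)
    (h : ∀ n : ℕ, n * m n = -∑ j ∈ Finset.Icc 1 n, (q ^ j + E j) * m (n - j)) :
    ∃ b : ℕ → ℂ, b 0 = 1 ∧ (∀ n : ℕ, n * b n = -∑ j ∈ Finset.Icc 1 n, E j * b (n - j)) ∧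
      ∀ n, m (n + 1) = b (n + 1) - q * b n := by
  set G : PowerSeries ℂ := PowerSeries.mk (q ^ ·) with hG
  set W : PowerSeries ℂ := 1 - PowerSeries.C q * PowerSeries.X with hW
  have hGW : G * W = 1 := by
    ext n
    rw [hW, mul_sub, mul_one, mul_comm (PowerSeries.C q), ← mul_assoc, map_sub,
      PowerSeries.coeff_mul_C]
    cases n with
    | zero => simp [hG]
    | succ n =>
      rw [PowerSeries.coeff_succ_mul_X, hG, PowerSeries.coeff_mk, PowerSeries.coeff_mk,
        PowerSeries.coeff_one, if_neg n.succ_ne_zero, pow_succ, sub_self]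
  have hW0 : W ≠ 0 := fun h1 => by rw [h1, mul_zero] at hGW; exact zero_ne_one hGW
  set b : ℕ → ℂ := fun n => PowerSeries.coeff n (PowerSeries.mk m * G) with hb
  have hbm : PowerSeries.mk b = PowerSeries.mk m * G := by ext n; rw [PowerSeries.coeff_mk]
  have hmb : PowerSeries.mk m = W * PowerSeries.mk b := by
    rw [hbm]; linear_combination -(PowerSeries.mk m) * hGW
  have hdW : PowerSeries.derivative ℂ W = -PowerSeries.C q := by
    rw [hW, map_sub, Derivation.map_one_eq_zero, Derivation.leibniz, PowerSeries.derivative_C,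
      PowerSeries.derivative_X]
    simp
  have h1 := (X_mul_derivative_mk_eq_iff (fun j => -(q ^ j + E j)) m).2 fun n => by
    rw [h, ← Finset.sum_neg_distrib]
    exact Finset.sum_congr rfl fun _ _ => by ring
  have h2 : PowerSeries.mk (fun j => if j = 0 then 0 else -(q ^ j + E j)) =
      -PowerSeries.mk (fun j => if j = 0 then 0 else q ^ j) +
        PowerSeries.mk (fun j => if j = 0 then 0 else -E j) := by
    ext n
    rw [map_add, map_neg, PowerSeries.coeff_mk, PowerSeries.coeff_mk, PowerSeries.coeff_mk]
    split_ifs <;> ring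
  have h3 := powerSeries_mk_mul_one_sub q
  rw [h2, hmb, Derivation.leibniz, smul_eq_mul, smul_eq_mul, hdW] at h1
  have h4 : PowerSeries.X * PowerSeries.derivative ℂ (PowerSeries.mk b) =
      PowerSeries.mk (fun j => if j = 0 then 0 else -E j) * PowerSeries.mk b := by
    refine mul_left_cancel₀ hW0 ?_
    rw [← hW] at h3
    linear_combination h1 - PowerSeries.mk b * h3
  refine ⟨b, ?_, fun n => ?_, fun n => ?_⟩
  · simp [hb, hG, h0]
  · rw [(X_mul_derivative_mk_eq_iff _ b).1 h4, ← Finset.sum_neg_distrib]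
    exact Finset.sum_congr rfl fun _ _ => by ring
  · have h5 := congrArg (PowerSeries.coeff (n + 1)) hmb
    rw [hW, sub_mul, one_mul, map_sub, mul_assoc, PowerSeries.coeff_C_mul,
      PowerSeries.coeff_succ_X_mul, PowerSeries.coeff_mk, PowerSeries.coeff_mk,
      PowerSeries.coeff_mk] at h5
    exact h5

end Principal

section MoebiusBound

variable {F : Type*} [Field F] [Fintype F]

theorem muCoeff_zero (ψ : F[X] →* ℂ) : muCoeff ψ 0 = 1 := by
  rw [muCoeff, monicsOfDegree_zero, Finset.sum_singleton, map_one, polyMu_one, Int.cast_one,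
    mul_one]

theorem exists_norm_muCoeff_classMap_le (F : Type*) [Field F] [Fintype F] {ε : ℝ} (hε : 0 < ε) :
    ∃ C : ℝ, 0 ≤ C ∧ ∀ (g : F[X]) (s : ℕ) (χ : MulChar (ClassRing g s) ℂ) (n N : ℕ), g.Monic →
      g.natDegree + s ≤ N → n ≤ N →
      ‖muCoeff (χ.toMonoidHom.comp (classMap g s)) n‖ ≤
        C * (Fintype.card F : ℝ) ^ ((n : ℝ) / 2 + ε * N) := by
  have hq : (1 : ℝ) < Fintype.card F := by exact_mod_cast Fintype.one_lt_card
  set q : ℝ := (Fintype.card F : ℝ) with hqdef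
  have hq0 : 0 < q := by linarith
  obtain ⟨C, hC, h⟩ := exists_norm_le_of_recurrence hq hε
  refine ⟨C * (1 + q), by positivity, fun g s χ n N hg hN hn => ?_⟩
  have : Module.Finite F (AdjoinRoot g) := hg.finite_adjoinRoot
  have : Module.Finite F (AdjoinRoot (X ^ (s + 1) : F[X])) := (monic_X_pow _).finite_adjoinRoot
  have : Finite (ClassRing g s) := Module.finite_of_finite F
  set ψ := χ.toMonoidHom.comp (classMap g s) with hψ
  have hψ1 : ∀ f, ‖ψ f‖ ≤ 1 := fun f => norm_mulChar_le_one χ _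
  let K := AlgebraicClosure F
  have hle : C * q ^ ((n : ℝ) / 2 + ε * N) ≤ C * (1 + q) * q ^ ((n : ℝ) / 2 + ε * N) := by
    gcongr; exact le_mul_of_one_le_right hC (by linarith)
  by_cases hprin : ∃ f : F[X], f.Monic ∧ IsUnit (classMap g s f) ∧ ψ f ≠ 1
  · obtain ⟨f₀, hf₀, hu, hψf⟩ := hprin
    have hcop : ∃ x₀ : K, aeval x₀ g ≠ 0 := by
      by_contra! hx
      have h0 : g.map (algebraMap F K) = 0 := Polynomial.funext fun x => by
        rw [eval_map_algebraMap, hx, eval_zero]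
      exact (hg.map _).ne_zero h0
    obtain ⟨x₀, hx₀⟩ := hcop
    have hi : IsIntegral F x₀ := Algebra.IsIntegral.isIntegral x₀
    have hx₀' : IsUnit (classMap g s (minpoly F x₀)) := by
      rw [isUnit_classMap (minpoly.ne_zero hi), (minpoly.irreducible hi).coprime_iff_not_dvd,
        minpoly.dvd_iff]
      exact hx₀
    refine le_trans (h N (g.natDegree + s) (muCoeff ψ) (powerSum K ψ) hN (muCoeff_zero ψ)
      (natCast_mul_muCoeff K ψ) (fun j hj => ?_) (fun j hj => ?_) n hn) hle
    · rw [powerSum]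
      refine (norm_sum_le_of_le _ fun x _ => hψ1 _).trans_eq ?_
      rw [Finset.sum_const, card_frobeniusFixed (by omega), nsmul_eq_mul, mul_one, Nat.cast_pow]
    · exact norm_powerSum_le (classMap g s) (fun f _ => classMap_eq_homEval g s f) hx₀' χ
        (fun m hm => lCoeff_eq_zero (classMap g s) (fun f _ => classMap_eq_homEval g s f) χ
          (fun f hf => exists_mem_monicsOfDegree_classMap_eq hg hm.le hf) hf₀ hu hψf) hj
  · push Not at hprin
    classical
    have hval : ∀ f : F[X], f.Monic → ψ f = if IsCoprime f g then 1 else 0 := by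
      intro f hf
      split_ifs with hc
      · exact hprin f hf ((isUnit_classMap hf.ne_zero).2 hc)
      · exact χ.map_nonunit fun hu => hc ((isUnit_classMap hf.ne_zero).1 hu)
    have hS : ∀ j, 1 ≤ j → ‖powerSum K ψ j - (q : ℂ) ^ j‖ ≤ min (q ^ j) (g.natDegree + s : ℕ) := by
      intro j hj
      have h1 : powerSum K ψ j - (q : ℂ) ^ j =
          -((frobeniusFixed F K j).filter fun x => ¬ IsCoprime (orbitPoly F j x) g).card := by
        have h2 : ((q : ℂ) ^ j) = (frobeniusFixed F K j).card := by
          rw [card_frobeniusFixed (by omega), hqdef]; push_cast; rfl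
        rw [powerSum, Finset.sum_congr rfl fun x _ => hval _ (orbitPoly_monic j x),
          ← Finset.sum_filter, Finset.sum_const, nsmul_eq_mul, mul_one, h2,
          ← Finset.card_filter_add_card_filter_not (s := frobeniusFixed F K j)
            (fun x => IsCoprime (orbitPoly F j x) g)]
        push_cast; ring
      rw [h1, norm_neg, Complex.norm_natCast, le_min_iff]
      constructor
      · calc _ ≤ ((frobeniusFixed F K j).card : ℝ) := by
              exact_mod_cast Finset.card_filter_le _ _
          _ = q ^ j := by rw [card_frobeniusFixed (by omega), Nat.cast_pow]
      · refine Nat.cast_le.2 (le_trans ?_ (Nat.le_add_right _ _))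
        rw [← natDegree_map (algebraMap F K)]
        refine le_trans ?_ ((Multiset.toFinset_card_le _).trans (card_roots' (g.map (algebraMap F K))))
        refine Finset.card_le_card fun x hx => ?_
        rw [Finset.mem_filter] at hx
        rw [Multiset.mem_toFinset, mem_roots (hg.map _).ne_zero, IsRoot, eval_map_algebraMap]
        by_contra hx0
        refine hx.2 (IsCoprime.pow_left ?_)
        have hi : IsIntegral F x := Algebra.IsIntegral.isIntegral x
        rwa [(minpoly.irreducible hi).coprime_iff_not_dvd, minpoly.dvd_iff]
    obtain ⟨b, hb0, hb, hmb⟩ := exists_recurrence_of_pow_add (q := (q : ℂ)) (m := muCoeff ψ)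
      (E := fun j => powerSum K ψ j - (q : ℂ) ^ j) (muCoeff_zero ψ) fun n => by
        rw [natCast_mul_muCoeff K ψ n]
        exact congrArg Neg.neg (Finset.sum_congr rfl fun _ _ => by ring)
    have hbn := h N (g.natDegree + s) b _ hN hb0 hb
      (fun j hj => (hS j hj).trans (min_le_left _ _))
      (fun j hj => ((hS j hj).trans (min_le_right _ _)).trans
        (le_mul_of_one_le_right (by positivity) (one_le_pow₀ (Real.one_le_sqrt.2 hq.le))))
    cases n with
    | zero =>
      rw [muCoeff_zero, ← hb0]
      exact (hbn 0 (by omega)).trans hle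
    | succ n =>
      rw [hmb]
      have h1 := hbn (n + 1) hn
      have h2 := hbn n (by omega)
      have h3 : q ^ ((n : ℝ) / 2 + ε * N) ≤ q ^ (((n + 1 : ℕ) : ℝ) / 2 + ε * N) :=
        Real.rpow_le_rpow_of_exponent_le hq.le (by push_cast; linarith)
      calc ‖b (n + 1) - q * b n‖ ≤ ‖b (n + 1)‖ + q * ‖b n‖ := by
            refine (norm_sub_le _ _).trans_eq ?_
            rw [norm_mul, Complex.norm_real, Real.norm_of_nonneg hq0.le]
        _ ≤ C * q ^ (((n + 1 : ℕ) : ℝ) / 2 + ε * N) +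
              q * (C * q ^ (((n + 1 : ℕ) : ℝ) / 2 + ε * N)) := by
            gcongr
            exact h2.trans (by gcongr)
        _ = _ := by ring

end MoebiusBound

section Orthogonality

theorem AddChar.sum_norm_sq_sum {A : Type*} [AddCommGroup A] [Fintype A] (a : A → ℂ) :
    ∑ ψ : AddChar A ℂ, ‖∑ x, a x * ψ x‖ ^ 2 = Fintype.card A * ∑ x, ‖a x‖ ^ 2 := by
  classical
  have h1 : ∀ ψ : AddChar A ℂ, ((‖∑ x, a x * ψ x‖ ^ 2 : ℝ) : ℂ) =
      ∑ x, ∑ y, a x * (starRingEnd ℂ) (a y) * ψ (x - y) := by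
    intro ψ
    rw [Complex.ofReal_pow, ← Complex.mul_conj', map_sum, Finset.sum_mul_sum]
    refine Finset.sum_congr rfl fun x _ => Finset.sum_congr rfl fun y _ => ?_
    rw [map_mul, sub_eq_add_neg, AddChar.map_add_eq_mul, AddChar.map_neg_eq_conj]
    ring
  have h2 : ((∑ ψ : AddChar A ℂ, ‖∑ x, a x * ψ x‖ ^ 2 : ℝ) : ℂ) =
      (Fintype.card A * ∑ x, ‖a x‖ ^ 2 : ℝ) := by
    rw [Complex.ofReal_sum, Finset.sum_congr rfl fun ψ _ => h1 ψ, Finset.sum_comm,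
      Complex.ofReal_mul, Complex.ofReal_sum, Finset.mul_sum]
    refine Finset.sum_congr rfl fun x _ => ?_
    rw [Finset.sum_comm, Finset.sum_eq_single x]
    · rw [← Finset.mul_sum, AddChar.sum_apply_eq_ite, if_pos (sub_self x), Complex.mul_conj',
        Complex.ofReal_pow, Complex.ofReal_natCast, mul_comm]
    · intro y _ hy
      rw [← Finset.mul_sum, AddChar.sum_apply_eq_ite, if_neg (sub_ne_zero.2 hy.symm), mul_zero]
    · intro h; exact absurd (Finset.mem_univ x) h
  exact_mod_cast h2

theorem norm_sum_mul_le_sqrt_card_mul {A ι : Type*} [AddCommGroup A] [Fintype A] (T : Finset ι)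
    (w φ : ι → ℂ) (κ : ι → A) {M : ℝ} (hφ : ∀ i ∈ T, ‖φ i‖ ≤ 1)
    (hκ : ∀ i ∈ T, ∀ j ∈ T, κ i = κ j → φ i = φ j)
    (hM : ∀ ψ : AddChar A ℂ, ‖∑ i ∈ T, w i * ψ (κ i)‖ ≤ M) :
    ‖∑ i ∈ T, w i * φ i‖ ≤ √(Fintype.card A) * M := by
  classical
  have hM0 : 0 ≤ M := (norm_nonneg _).trans (hM 0)
  set a : A → ℂ := fun x => ∑ i ∈ T with κ i = x, w i with ha
  have h1 : ‖∑ i ∈ T, w i * φ i‖ ≤ ∑ x, ‖a x‖ := by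
    rw [← Finset.sum_fiberwise T κ]
    refine norm_sum_le_of_le _ fun x _ => ?_
    rcases Finset.eq_empty_or_nonempty (T.filter fun i => κ i = x) with h | ⟨i₀, h⟩
    · rw [h, Finset.sum_empty, norm_zero]; exact norm_nonneg _
    · rw [Finset.mem_filter] at h
      have h2 : ∑ i ∈ T with κ i = x, w i * φ i = a x * φ i₀ := by
        rw [ha, Finset.sum_mul]
        refine Finset.sum_congr rfl fun i hi => ?_
        rw [Finset.mem_filter] at hi
        rw [hκ i hi.1 i₀ h.1 (hi.2.trans h.2.symm)]
      rw [h2, norm_mul]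
      exact mul_le_of_le_one_right (norm_nonneg _) (hφ _ h.1)
  have h3 : ∀ ψ : AddChar A ℂ, ∑ x, a x * ψ x = ∑ i ∈ T, w i * ψ (κ i) := by
    intro ψ
    rw [← Finset.sum_fiberwise T κ]
    refine Finset.sum_congr rfl fun x _ => ?_
    rw [ha, Finset.sum_mul]
    refine Finset.sum_congr rfl fun i hi => ?_
    rw [(Finset.mem_filter.1 hi).2]
  have hA : (0 : ℝ) < Fintype.card A := by exact_mod_cast Fintype.card_pos
  have h4 : ∑ x, ‖a x‖ ^ 2 ≤ M ^ 2 := by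
    refine le_of_mul_le_mul_left ?_ hA
    rw [← AddChar.sum_norm_sq_sum]
    calc ∑ ψ : AddChar A ℂ, ‖∑ x, a x * ψ x‖ ^ 2 ≤ ∑ ψ : AddChar A ℂ, M ^ 2 :=
          Finset.sum_le_sum fun ψ _ => by
            rw [h3]; exact pow_le_pow_left₀ (norm_nonneg _) (hM ψ) 2
      _ = Fintype.card A * M ^ 2 := by
          rw [Finset.sum_const, nsmul_eq_mul, Finset.card_univ, AddChar.card_eq]
  refine h1.trans (Real.le_sqrt_of_sq_le ?_ |>.trans_eq
    (by rw [Real.sqrt_mul hA.le, Real.sqrt_sq hM0]) (b := √(Fintype.card A * M ^ 2)))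
  refine (sq_sum_le_card_mul_sum_sq (s := Finset.univ) (f := fun x => ‖a x‖)).trans ?_
  rw [Finset.card_univ]
  gcongr

end Orthogonality

section InnerSum

variable {F : Type*} [Field F]

/-- Reduction of classes along a divisor of the modulus. -/
noncomputable def classProj {g g' : F[X]} (h : g' ∣ g) (s : ℕ) : ClassRing g s →* ClassRing g' s :=
  MonoidHom.prodMap (AdjoinRoot.algHomOfDvd F g g' h : AdjoinRoot g →* AdjoinRoot g')
    (MonoidHom.id _)

theorem classProj_classMap {g g' : F[X]} (h : g' ∣ g) (s : ℕ) (f : F[X]) :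
    classProj h s (classMap g s f) = classMap g' s f := by
  rw [classMap_apply, classMap_apply, classProj, MonoidHom.prodMap_def]
  refine Prod.ext ?_ rfl
  change AdjoinRoot.algHomOfDvd F g g' h (AdjoinRoot.mk g f) = AdjoinRoot.mk g' f
  rw [← AdjoinRoot.aeval_eq, ← AdjoinRoot.aeval_eq, ← aeval_algHom_apply,
    AdjoinRoot.algHomOfDvd_root]

theorem natCard_classRing [Fintype F] {g : F[X]} (hg : g.Monic) (s : ℕ) :
    Nat.card (ClassRing g s) = Fintype.card F ^ (g.natDegree + (s + 1)) := by
  have h : ∀ f : F[X], f.Monic → Nat.card (AdjoinRoot f) = Fintype.card F ^ f.natDegree := by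
    intro f hf
    have := hf.finite_adjoinRoot
    have h1 : Module.finrank F (AdjoinRoot f) = f.natDegree :=
        finrank_quotient_span_eq_natDegree' hf
    rw [Module.natCard_eq_pow_finrank (K := F), Nat.card_eq_fintype_card, h1]
  rw [Nat.card_prod, h g hg, h _ (monic_X_pow _), natDegree_X_pow, ← pow_add]

open scoped Classical in
theorem norm_sum_coprime_le [Fintype F] {g g' : F[X]} (hg' : g'.Monic)
    (hd : g' ∣ g) (s n : ℕ) {M : ℝ}
    (hM : ∀ χ : MulChar (ClassRing g s) ℂ,
      ‖muCoeff (χ.toMonoidHom.comp (classMap g s)) n‖ ≤ M)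
    (φ : F[X] → ℂ) (hφ : ∀ f, ‖φ f‖ ≤ 1)
    (hcls : ∀ f₁ ∈ monicsOfDegree F n, ∀ f₂ ∈ monicsOfDegree F n,
      classMap g' s f₁ = classMap g' s f₂ → φ f₁ = φ f₂) :
    ‖∑ f ∈ monicsOfDegree F n with IsCoprime f g, (polyMu f : ℂ) * φ f‖ ≤
      √((Fintype.card F : ℝ) ^ (g'.natDegree + (s + 1))) * M := by
  have : Module.Finite F (AdjoinRoot g') := hg'.finite_adjoinRoot
  have : Module.Finite F (AdjoinRoot (X ^ (s + 1) : F[X])) := (monic_X_pow _).finite_adjoinRoot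
  have : Finite (ClassRing g' s) := Module.finite_of_finite F
  have := Fintype.ofFinite (ClassRing g' s)ˣ
  have := Fintype.ofFinite (ClassRing g' s)
  have hM0 : 0 ≤ M := (norm_nonneg _).trans (hM 1)
  have hu : ∀ f ∈ (monicsOfDegree F n).filter (IsCoprime · g), IsUnit (classMap g s f) := by
    intro f hf
    rw [Finset.mem_filter, mem_monicsOfDegree] at hf
    exact (isUnit_classMap hf.1.1.ne_zero).2 hf.2
  set κ : F[X] → Additive (ClassRing g' s)ˣ := fun f =>
    if h : IsUnit (classMap g s f) then Additive.ofMul (Units.map (classProj hd s) h.unit) else 0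
    with hκ
  have hκv : ∀ f, IsUnit (classMap g s f) → ((κ f).toMul : ClassRing g' s) = classMap g' s f := by
    intro f h
    rw [hκ]
    simp only [dif_pos h, toMul_ofMul, Units.coe_map, IsUnit.unit_spec]
    exact classProj_classMap hd s f
  refine (norm_sum_mul_le_sqrt_card_mul _ _ φ κ (M := M) (fun f _ => hφ f)
    (fun f₁ h₁ f₂ h₂ h => ?_) (fun ψ => ?_)).trans ?_
  · refine hcls f₁ (Finset.mem_filter.1 h₁).1 f₂ (Finset.mem_filter.1 h₂).1 ?_
    rw [← hκv f₁ (hu f₁ h₁), ← hκv f₂ (hu f₂ h₂), h]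
  · let ρ : (ClassRing g' s)ˣ →* ℂ :=
      { toFun := fun x => ψ (Additive.ofMul x)
        map_one' := ψ.map_zero_eq_one
        map_mul' := fun x y => ψ.map_add_eq_mul _ _ }
    let χ : MulChar (ClassRing g s) ℂ :=
      MulChar.ofUnitHom (ρ.toHomUnits.comp (Units.map (classProj hd s)))
    convert hM χ using 2
    rw [muCoeff, Finset.sum_filter]
    refine Finset.sum_congr rfl fun f hf => ?_
    split_ifs with hc
    · have h := hu f (Finset.mem_filter.2 ⟨hf, hc⟩)
      congr 1
      change ψ (κ f) = χ (classMap g s f)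
      have h1 : χ (classMap g s f) = χ (h.unit : ClassRing g s) := rfl
      rw [h1, MulChar.ofUnitHom_coe, hκ]
      simp only [dif_pos h]
      rfl
    · have h : ¬ IsUnit (classMap g s f) := fun h =>
        hc ((isUnit_classMap (mem_monicsOfDegree.1 hf).1.ne_zero).1 h)
      change 0 = _ * χ (classMap g s f)
      rw [χ.map_nonunit h, mul_zero]
  · gcongr
    rw [← Nat.cast_pow, ← natCard_classRing hg' s, Nat.card_eq_fintype_card]
    exact_mod_cast Fintype.card_le_of_injective (α := Additive (ClassRing g' s)ˣ)
      (fun x => (x.toMul : ClassRing g' s)) fun x y h => Units.ext h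

end InnerSum

section Annihilator

variable {F : Type*} [Field F]

theorem exists_monic_annihilator (l : F[X] →ₗ[F] F) (N : ℕ) :
    ∃ g : F[X], g.Monic ∧ g.natDegree ≤ N ∧ ∀ p : F[X], p.degree < N → l (g * p) = 0 := by
  let T : degreeLT F (N + 1) →ₗ[F] (Fin N → F) :=
    LinearMap.pi fun j => l ∘ₗ LinearMap.mulRight F (X ^ (j : ℕ)) ∘ₗ (degreeLT F (N + 1)).subtype
  have : Module.Finite F (degreeLT F (N + 1)) :=
    Module.Finite.equiv (degreeLTEquiv F (N + 1)).symm
  have hT : LinearMap.ker T ≠ ⊥ := by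
    refine LinearMap.ker_ne_bot_of_finrank_lt ?_
    rw [(degreeLTEquiv F (N + 1)).finrank_eq, Module.finrank_fin_fun, Module.finrank_fin_fun]
    exact N.lt_succ_self
  obtain ⟨⟨x, hx⟩, hker, hne⟩ := Submodule.exists_mem_ne_zero_of_ne_bot hT
  have hx0 : x ≠ 0 := fun h => hne (Subtype.ext h)
  have hxj : ∀ j < N, l (x * X ^ j) = 0 := fun j hj => congrFun hker ⟨j, hj⟩
  refine ⟨x * C x.leadingCoeff⁻¹, monic_mul_leadingCoeff_inv hx0, ?_, fun p hp => ?_⟩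
  · rw [natDegree_mul_leadingCoeff_inv _ hx0]
    exact Nat.lt_succ_iff.1 ((natDegree_lt_iff_degree_lt hx0).2 (mem_degreeLT.1 hx))
  · rcases eq_or_ne p 0 with rfl | hp0
    · rw [mul_zero, map_zero]
    have h1 : x * C x.leadingCoeff⁻¹ * p =
        ∑ j ∈ Finset.range N, (x.leadingCoeff⁻¹ * p.coeff j) • (x * X ^ j) := by
      conv_lhs => rw [p.as_sum_range_C_mul_X_pow' (n := N)
        ((natDegree_lt_iff_degree_lt hp0).2 hp)]
      rw [Finset.mul_sum]
      refine Finset.sum_congr rfl fun j _ => ?_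
      rw [smul_eq_C_mul, C_mul]; ring
    rw [h1, map_sum]
    refine Finset.sum_eq_zero fun j hj => ?_
    rw [map_smul, hxj j (Finset.mem_range.1 hj), smul_zero]

end Annihilator

section GcdDecomposition

variable {F : Type*} [Field F]

theorem squarefree_of_polyMu_ne_zero {f : F[X]} (h : polyMu f ≠ 0) : Squarefree f := by
  classical
  by_contra h1
  exact h (if_neg h1)

open scoped Classical in
theorem sum_monicDivisors_gcd_eq [Fintype F] {f g : F[X]} (hf : f.Monic) :
    ∑ D ∈ monicDivisors f, (if D ∣ g ∧ IsCoprime (f / D) g then (polyMu f : ℂ) else 0) =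
      polyMu f := by
  by_cases hμ : polyMu f = 0
  · simp [hμ]
  have hsq := squarefree_of_polyMu_ne_zero hμ
  have hd0 : EuclideanDomain.gcd f g ≠ 0 := fun h =>
    hf.ne_zero (EuclideanDomain.gcd_eq_zero_iff.1 h).1
  set D := normalize (EuclideanDomain.gcd f g) with hD
  have hDm : D.Monic := monic_normalize hd0
  have hDf : D ∣ f := normalize_dvd_iff.2 (EuclideanDomain.gcd_dvd_left f g)
  have hDg : D ∣ g := normalize_dvd_iff.2 (EuclideanDomain.gcd_dvd_right f g)
  obtain ⟨h, hh⟩ := hDf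
  have hcop : IsCoprime h g := by
    refine isCoprime_of_irreducible_dvd (fun h0 => ?_) fun p hp hph hpg => ?_
    · rw [h0.1, mul_zero] at hh; exact hf.ne_zero hh
    · have hpf : p ∣ f := hh ▸ hph.mul_left D
      have hpD : p ∣ D := dvd_normalize_iff.2 (EuclideanDomain.dvd_gcd hpf hpg)
      exact hp.not_isUnit (hsq p (hh ▸ mul_dvd_mul hpD hph))
  rw [Finset.sum_eq_single D]
  · have hfD : f / D = h := by
      conv_lhs => rw [hh]
      exact mul_div_cancel_left₀ h hDm.ne_zero
    rw [if_pos ⟨hDg, hfD ▸ hcop⟩]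
  · intro E hE hne
    rw [mem_monicDivisors hf.ne_zero] at hE
    refine if_neg fun hE2 => hne ?_
    obtain ⟨k, hk⟩ := hE.2
    have hkc : IsCoprime k g := by
      have h2 := hE2.2
      rwa [hk, mul_div_cancel_left₀ k hE.1.ne_zero] at h2
    have h3 : E ∣ D := by
      refine (hcop.of_isCoprime_of_dvd_right hE2.1).symm.dvd_of_dvd_mul_right ?_
      exact ⟨k, by rw [← hh, hk]⟩
    have h4 : D ∣ E := by
      refine (hkc.of_isCoprime_of_dvd_right hDg).symm.dvd_of_dvd_mul_right ?_
      exact ⟨h, by rw [← hk, hh]⟩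
    exact eq_of_monic_of_associated hE.1 hDm (associated_of_dvd_dvd h3 h4)
  · intro h1
    exact absurd ((mem_monicDivisors hf.ne_zero).2 ⟨hDm, h, hh⟩) h1

open scoped Classical in
theorem sum_polyMu_mul_eq [Fintype F] (g : F[X]) (n : ℕ) (φ : F[X] → ℂ) :
    ∑ f ∈ monicsOfDegree F n, (polyMu f : ℂ) * φ f =
      ∑ j ∈ Finset.range (n + 1), ∑ D ∈ monicsOfDegree F j with D ∣ g,
        (polyMu D : ℂ) * ∑ f ∈ monicsOfDegree F (n - j) with IsCoprime f g,
          (polyMu f : ℂ) * φ (D * f) := by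
  have h1 : ∀ f ∈ monicsOfDegree F n, (polyMu f : ℂ) * φ f = ∑ D ∈ monicDivisors f,
      (if D ∣ g ∧ IsCoprime (f / D) g then (polyMu f : ℂ) else 0) * φ f := by
    intro f hf
    rw [← Finset.sum_mul, sum_monicDivisors_gcd_eq (mem_monicsOfDegree.1 hf).1]
  rw [Finset.sum_congr rfl h1, sum_sum_monicDivisors n fun D f =>
    (if D ∣ g ∧ IsCoprime (f / D) g then (polyMu f : ℂ) else 0) * φ f]
  refine Finset.sum_congr rfl fun j _ => ?_
  rw [Finset.sum_filter]
  refine Finset.sum_congr rfl fun D hD => ?_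
  have hD0 : D ≠ 0 := (mem_monicsOfDegree.1 hD).1.ne_zero
  split_ifs with hDg
  · rw [Finset.mul_sum, Finset.sum_filter]
    refine Finset.sum_congr rfl fun f _ => ?_
    rw [mul_div_cancel_left₀ f hD0]
    by_cases hc : IsCoprime f g
    · rw [if_pos ⟨hDg, hc⟩, if_pos hc,
        polyMu_mul_of_isCoprime (hc.of_isCoprime_of_dvd_right hDg).symm, Int.cast_mul, mul_assoc]
    · rw [if_neg fun h => hc h.2, if_neg hc, zero_mul]
  · exact Finset.sum_eq_zero fun f _ => by rw [if_neg fun h => hDg h.1, zero_mul]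

end GcdDecomposition

section LinearPhase

theorem exists_natCast_add_one_le_rpow {q ε : ℝ} (hq : 1 < q) (hε : 0 < ε) :
    ∃ C : ℝ, 0 ≤ C ∧ ∀ n : ℕ, (n : ℝ) + 1 ≤ C * q ^ (ε * n) := by
  have hl : 0 < ε * Real.log q := mul_pos hε (Real.log_pos hq)
  refine ⟨1 + (ε * Real.log q)⁻¹, by positivity, fun n => ?_⟩
  have h1 : q ^ (ε * n) = Real.exp (ε * Real.log q * n) := by
    rw [Real.rpow_def_of_pos (by linarith)]; congr 1; ring
  have h2 := Real.add_one_le_exp (ε * Real.log q * n)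
  rw [h1]
  have h3 : (n : ℝ) = (ε * Real.log q)⁻¹ * (ε * Real.log q * n) := by
    rw [← mul_assoc, inv_mul_cancel₀ hl.ne', one_mul]
  have h4 : 0 ≤ ε * Real.log q * n := by positivity
  calc (n : ℝ) + 1 ≤ 1 + (ε * Real.log q)⁻¹ * Real.exp (ε * Real.log q * n) := by
        conv_lhs => rw [h3, add_comm]
        gcongr; linarith
    _ ≤ (1 + (ε * Real.log q)⁻¹) * Real.exp (ε * Real.log q * n) := by
        rw [add_mul, one_mul]; gcongr; linarith

variable {F : Type*} [Field F]

theorem annihilator_map_mul_eq {l : F[X] →ₗ[F] F} {g g' D f₁ f₂ : F[X]} {N s n : ℕ}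
    (hg' : g' ≠ 0) (hl : ∀ p : F[X], p.degree < N → l (g * p) = 0) (hD : g = D * g')
    (hs : n ≤ g'.natDegree + N + s) (h₁ : f₁.natDegree = n) (h₂ : f₂.natDegree = n)
    (h : classMap g' s f₁ = classMap g' s f₂) : l (D * f₁) = l (D * f₂) := by
  obtain ⟨p, hp⟩ := dvd_sub_of_classMap_eq h
  rw [← sub_eq_zero, ← map_sub, ← mul_sub, hp, ← mul_assoc, ← hD]
  refine hl p ?_
  by_cases hp0 : p = 0
  · rw [hp0, degree_zero]; exact WithBot.bot_lt_coe N
  rw [← natDegree_lt_iff_degree_lt hp0]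
  by_contra! hN
  have hne : f₁ - f₂ ≠ 0 := hp ▸ mul_ne_zero hg' hp0
  have hdeg : (f₁ - f₂).natDegree = g'.natDegree + p.natDegree := by
    rw [hp, natDegree_mul hg' hp0]
  have hle : (f₁ - f₂).natDegree ≤ n := natDegree_sub_le_of_le h₁.le h₂.le |>.trans (by simp)
  refine leadingCoeff_ne_zero.2 hne ?_
  rw [leadingCoeff, coeff_sub, sub_eq_zero]
  exact coeff_eq_of_classMap_eq h₁ h₂ h hle (by omega)

open scoped Classical in
theorem exists_norm_sum_polyMu_mul_addChar_le (F : Type*) [Field F] [Fintype F] {ε : ℝ}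
    (hε : 0 < ε) : ∃ C : ℝ, ∀ (n : ℕ) (l : F[X] →ₗ[F] F) (c₀ : F) (χ : AddChar F Circle),
      ‖∑ f ∈ monicsOfDegree F n, (polyMu f : ℂ) * (χ (c₀ + l f) : ℂ)‖ ≤
        C * (Fintype.card F : ℝ) ^ ((3 / 4 + ε) * n) := by
  have hq : (1 : ℝ) < (Fintype.card F : ℝ) := by exact_mod_cast Fintype.one_lt_card
  obtain ⟨C₀, hC₀, hmu⟩ := exists_norm_muCoeff_classMap_le F (half_pos hε)
  obtain ⟨C₁, hC₁, hlin⟩ := exists_natCast_add_one_le_rpow hq (half_pos hε)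
  set q : ℝ := (Fintype.card F : ℝ) with hqdef
  have hq0 : 0 < q := by linarith
  refine ⟨C₁ * (C₀ * q ^ (3 / 4 : ℝ)), fun n l c₀ χ => ?_⟩
  obtain ⟨g, hg, hgN, hl⟩ := exists_monic_annihilator l (n / 2)
  obtain ⟨s, hs⟩ : ∃ s, g.natDegree + n / 2 + s = n := ⟨n - (g.natDegree + n / 2), by omega⟩
  have hinner : ∀ j, ∀ D ∈ monicsOfDegree F j, D ∣ g →
      ‖∑ f ∈ monicsOfDegree F (n - j) with IsCoprime f g,
        (polyMu f : ℂ) * (χ (c₀ + l (D * f)) : ℂ)‖ ≤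
        C₀ * q ^ (3 / 4 : ℝ) * q ^ ((3 / 4 + ε / 2) * n - j) := by
    intro j D hD hDg
    rw [mem_monicsOfDegree] at hD
    obtain ⟨g', hg'⟩ := hDg
    have hg'm : g'.Monic := hD.1.of_mul_monic_left (hg' ▸ hg)
    have hdeg : j + g'.natDegree = g.natDegree := by
      rw [hg', hD.1.natDegree_mul hg'm, hD.2]
    have h1 := norm_sum_coprime_le hg'm (g := g) ⟨D, by rw [hg', mul_comm]⟩ s (n - j)
      (fun χ' => hmu g s χ' (n - j) n hg (by omega) (by omega))
      (fun f => (χ (c₀ + l (D * f)) : ℂ)) (fun f => (Circle.norm_coe _).le)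
      (fun f₁ h₁ f₂ h₂ h => by
        rw [mem_monicsOfDegree] at h₁ h₂
        rw [annihilator_map_mul_eq hg'm.ne_zero hl hg' (by omega) h₁.2 h₂.2 h])
    refine h1.trans ?_
    have h2 : √(q ^ (g'.natDegree + (s + 1))) = q ^ (((g'.natDegree + (s + 1) : ℕ) : ℝ) / 2) := by
      rw [Real.sqrt_eq_rpow, ← Real.rpow_natCast, ← Real.rpow_mul hq0.le]
      congr 1; ring
    have h3 : ((g'.natDegree + (s + 1) : ℕ) : ℝ) + j ≤ (n : ℝ) / 2 + 3 / 2 := by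
      have : 2 * (g'.natDegree + (s + 1) + j) ≤ n + 3 := by omega
      have : 2 * (((g'.natDegree + (s + 1) : ℕ) : ℝ) + j) ≤ n + 3 := by exact_mod_cast this
      linarith
    rw [h2, Nat.cast_sub (by omega)]
    calc q ^ (((g'.natDegree + (s + 1) : ℕ) : ℝ) / 2) *
          (C₀ * q ^ (((n : ℝ) - j) / 2 + ε / 2 * n))
        = C₀ * q ^ (((g'.natDegree + (s + 1) : ℕ) : ℝ) / 2 + (((n : ℝ) - j) / 2 + ε / 2 * n)) := by
          rw [Real.rpow_add hq0 (((g'.natDegree + (s + 1) : ℕ) : ℝ) / 2)]; ring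
      _ ≤ C₀ * q ^ (3 / 4 + ((3 / 4 + ε / 2) * n - j)) := by
          refine mul_le_mul_of_nonneg_left (Real.rpow_le_rpow_of_exponent_le hq.le ?_) hC₀
          linarith
      _ = _ := by rw [Real.rpow_add hq0]; ring
  rw [sum_polyMu_mul_eq g n fun f => (χ (c₀ + l f) : ℂ)]
  have houter : ∀ j, ‖∑ D ∈ monicsOfDegree F j with D ∣ g, (polyMu D : ℂ) *
      ∑ f ∈ monicsOfDegree F (n - j) with IsCoprime f g,
        (polyMu f : ℂ) * (χ (c₀ + l (D * f)) : ℂ)‖ ≤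
      C₀ * q ^ (3 / 4 : ℝ) * q ^ ((3 / 4 + ε / 2) * n) := by
    intro j
    calc _ ≤ ∑ D ∈ monicsOfDegree F j with D ∣ g,
          C₀ * q ^ (3 / 4 : ℝ) * q ^ ((3 / 4 + ε / 2) * n - j) := by
          refine norm_sum_le_of_le _ fun D hD => ?_
          rw [Finset.mem_filter] at hD
          rw [norm_mul]
          refine (mul_le_of_le_one_left (norm_nonneg _) ?_).trans (hinner j D hD.1 hD.2)
          rw [Complex.norm_intCast]
          exact_mod_cast abs_polyMu_le_one D
      _ ≤ q ^ j * (C₀ * q ^ (3 / 4 : ℝ) * q ^ ((3 / 4 + ε / 2) * n - j)) := by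
          rw [Finset.sum_const, nsmul_eq_mul]
          gcongr
          rw [hqdef, ← Nat.cast_pow, ← card_monicsOfDegree]
          exact_mod_cast Finset.card_filter_le _ _
      _ = _ := by
          rw [Real.rpow_sub hq0, Real.rpow_natCast]
          field_simp
  calc _ ≤ ∑ j ∈ Finset.range (n + 1), C₀ * q ^ (3 / 4 : ℝ) * q ^ ((3 / 4 + ε / 2) * n) :=
        norm_sum_le_of_le _ fun j _ => houter j
    _ = (n + 1) * (C₀ * q ^ (3 / 4 : ℝ) * q ^ ((3 / 4 + ε / 2) * n)) := by
        rw [Finset.sum_const, Finset.card_range, nsmul_eq_mul, Nat.cast_add, Nat.cast_one]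
    _ ≤ C₁ * q ^ (ε / 2 * n) * (C₀ * q ^ (3 / 4 : ℝ) * q ^ ((3 / 4 + ε / 2) * n)) := by
        gcongr; exact hlin n
    _ = C₁ * (C₀ * q ^ (3 / 4 : ℝ)) * (q ^ (ε / 2 * n) * q ^ ((3 / 4 + ε / 2) * n)) := by ring
    _ = _ := by
        rw [← Real.rpow_add hq0]
        congr 2; ring

end LinearPhase

/-- For every `ε > 0` there is `C = C(ε,q)` such that for every `n ≥ 1`, every affine-linear
map `ℓ(x) = c₀ + ∑_{i<n} cᵢ xᵢ` and every additive character `χ` of `F_q`,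
`|∑_{f monic, deg f = n} μ(f) χ(ℓ(x₀(f),…,x_{n-1}(f)))| ≤ C q^((3/4+ε)n)`. -/
theorem moebius_monic_linear_phase_bound {F : Type*} [Field F] [Fintype F] (q : ℕ)
    (hq : Fintype.card F = q) (ε : ℝ) (hε : 0 < ε) :
    ∃ C : ℝ, ∀ n : ℕ, 1 ≤ n → ∀ (c₀ : F) (c : Fin n → F), ∀ χ : AddChar F Circle,
      ‖∑ x : Fin n → F,
          (polyMu (monicPoly F n x) : ℂ) * (χ (c₀ + ∑ i, c i * x i) : ℂ)‖ ≤
        C * (q : ℝ) ^ ((3 / 4 + ε) * n) := by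
  subst hq
  obtain ⟨C, hC⟩ := exists_norm_sum_polyMu_mul_addChar_le F hε
  refine ⟨C, fun n _ c₀ c χ => ?_⟩
  have h := hC n (∑ i : Fin n, c i • lcoeff F (i : ℕ)) c₀ χ
  rw [sum_monicsOfDegree] at h
  simpa only [LinearMap.sum_apply, LinearMap.smul_apply, lcoeff_apply, coeff_monicPoly,
    smul_eq_mul] using h
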